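/- Let α be a fixed real constant with 0 ≤ α < 1/2, put δ = 1/(3/2 − α), and let c be a fixed nonzero real constant. Then for large T₁, the triple exponential sum S₁ = ∑_{T₁ ≤ k₁k₂k₃ ≤ 2T₁} e^{2πi c (k₁k₂k₃)^{δ}}, where the sum is over ordered triples (k₁,k₂,k₃) of positive integers whose product lies in [T₁, 2T₁], satisfies S₁ ≪ T₁^{2/3 + δ/4 + ε}. -/

import Mathlib

open Complex Filter Real MeasureTheory Finset

noncomputable def chi (s : ℂ) : ℂ :=
  2 ^ s * (π : ℂ) ^ (s - 1) * Complex.sin (π * s / 2) * Complex.Gamma (1 - s)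

noncomputable def Z (t : ℝ) : ℂ :=
  chi (1 / 2 + I * t) ^ (-(1 / 2 : ℂ)) * riemannZeta (1 / 2 + I * t)

/-- number of positive divisors -/
noncomputable def d (k : ℕ) : ℕ := k.divisors.card

/-- number of ordered triples of positive integers with product `n` -/
noncomputable def d3 (n : ℕ) : ℕ :=
  ((Finset.Icc 1 n ×ˢ Finset.Icc 1 n ×ˢ Finset.Icc 1 n).filter
    fun p : ℕ × ℕ × ℕ => p.1 * p.2.1 * p.2.2 = n).card

/-- sum over integers `a ≤ k ≤ b` where terms at integer endpoints are halved -/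
noncomputable def psum (a b : ℝ) (f : ℕ → ℂ) : ℂ :=
  ∑ k ∈ Finset.Icc ⌈a⌉₊ ⌊b⌋₊,
    (if (k : ℝ) = a ∨ (k : ℝ) = b then (1 / 2 : ℂ) else 1) * f k

namespace ExpSum

/-- The additive character `x ↦ exp(2πix)`. -/
noncomputable def e (x : ℝ) : ℂ := Complex.exp ((2 * π * x : ℝ) * I)

lemma norm_e (x : ℝ) : ‖e x‖ = 1 := Complex.norm_exp_ofReal_mul_I _

lemma e_add (x y : ℝ) : e (x + y) = e x * e y := by
  simp only [e, ← Complex.exp_add]; congr 1; push_cast; ring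

lemma e_neg (x : ℝ) : e (-x) = (starRingEnd ℂ) (e x) := by
  simp only [e, ← Complex.exp_conj]; congr 1
  rw [map_mul, Complex.conj_ofReal, Complex.conj_I]; push_cast; ring

lemma e_sub (x y : ℝ) : e (x - y) = e x * (starRingEnd ℂ) (e y) := by
  rw [sub_eq_add_neg, e_add, e_neg]

lemma e_int (n : ℤ) : e n = 1 := by
  rw [e, Complex.exp_eq_one_iff]; exact ⟨n, by push_cast; ring⟩

lemma e_nat (n : ℕ) : e n = 1 := by simpa using e_int n

lemma e_zero : e 0 = 1 := by simp [e]

lemma hasDerivAt_e (x : ℝ) : HasDerivAt e (2 * π * I * e x) x := by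
  have h : HasDerivAt (fun x : ℝ => (((2 * π * x : ℝ) : ℂ) * I)) (2 * π * I) x := by
    have := (((hasDerivAt_id x).const_mul (2 * π)).ofReal_comp).mul_const I
    simpa using this
  have h2 : HasDerivAt e (e x * (2 * π * I)) x := h.cexp
  rwa [mul_comm] at h2

lemma continuous_e : Continuous e := by unfold e; fun_prop

lemma norm_e_sub_e_le (x y : ℝ) : ‖e x - e y‖ ≤ 2 * π * |x - y| := by
  have := Convex.norm_image_sub_le_of_norm_hasDerivWithin_le (f := e) (s := Set.univ)
    (f' := fun x => 2 * π * I * e x) (C := 2 * π)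
    (fun x _ => (hasDerivAt_e x).hasDerivWithinAt)
    (fun x _ => by simp [norm_e, abs_of_pos Real.pi_pos]) convex_univ
    (Set.mem_univ y) (Set.mem_univ x)
  simpa using this

lemma four_mul_abs_le_norm_one_sub_e {x : ℝ} (hx : |x| ≤ 1 / 2) : 4 * |x| ≤ ‖1 - e x‖ := by
  have h1 : ‖1 - e x‖ = 2 * |Real.sin (π * x)| := by
    have : ‖e x - 1‖ = ‖2 * Real.sin ((2 * π * x) / 2)‖ := by
      rw [e, mul_comm]; exact Complex.norm_exp_I_mul_ofReal_sub_one _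
    rw [norm_sub_rev, this, norm_mul, Real.norm_eq_abs, Real.norm_eq_abs, abs_two]
    congr 3; ring
  have h2 : |Real.sin (π * x)| = Real.sin (π * |x|) := by
    rcases abs_cases x with ⟨h, h'⟩ | ⟨h, h'⟩
    · rw [h] at hx ⊢
      exact abs_of_nonneg (Real.sin_nonneg_of_nonneg_of_le_pi (by positivity)
        (by nlinarith [Real.pi_pos]))
    · rw [h] at hx ⊢
      rw [mul_neg, Real.sin_neg]
      refine abs_of_nonpos ?_
      have := Real.sin_nonneg_of_nonneg_of_le_pi (x := π * (-x))
        (mul_nonneg Real.pi_pos.le (by linarith)) (by nlinarith [Real.pi_pos])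
      rw [mul_neg, Real.sin_neg] at this; linarith
  rw [h1, h2]
  have := Real.mul_le_sin (x := π * |x|) (by positivity) (by nlinarith [Real.pi_pos])
  have h3 : 2 / π * (π * |x|) = 2 * |x| := by field_simp
  linarith

/-- The Kusmin–Landau inequality for phase differences close to `0`. -/
lemma kusmin_landau_aux (g : ℕ → ℝ) (a j : ℕ) {Δ : ℝ} (hΔ : 0 < Δ)
    (hmono : ∀ i, i < j → g (a + i + 1) - g (a + i) ≤ g (a + i + 2) - g (a + i + 1))
    (hle : ∀ i, i ≤ j → |g (a + i + 1) - g (a + i)| ≤ 1 / 2)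
    (hsign : (∀ i, i ≤ j → Δ ≤ g (a + i + 1) - g (a + i)) ∨
      (∀ i, i ≤ j → g (a + i + 1) - g (a + i) ≤ -Δ)) :
    ‖∑ i ∈ range (j + 1), e (g (a + i))‖ ≤ 2 / Δ := by
  set θ : ℕ → ℝ := fun i => g (a + i + 1) - g (a + i) with hθ
  have hΔθ : ∀ i, i ≤ j → Δ ≤ |θ i| := by
    intro i hi
    rcases hsign with h | h
    · exact (h i hi).trans (le_abs_self _)
    · have := h i hi
      exact (by linarith : Δ ≤ -θ i).trans (neg_le_abs _)
  set w : ℕ → ℂ := fun i => (1 - e (θ i))⁻¹ with hw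
  have hnw : ∀ i, i ≤ j → 4 * |θ i| ≤ ‖1 - e (θ i)‖ := fun i hi =>
    four_mul_abs_le_norm_one_sub_e (hle i hi)
  have hne : ∀ i, i ≤ j → 1 - e (θ i) ≠ 0 := by
    intro i hi h
    have h1 := hnw i hi
    have h2 := hΔθ i hi
    rw [h, norm_zero] at h1; linarith
  have hwle : ∀ i, i ≤ j → ‖w i‖ ≤ 1 / (4 * Δ) := by
    intro i hi
    rw [hw, norm_inv, ← one_div]
    exact one_div_le_one_div_of_le (by positivity)
      (by linarith [hnw i hi, hΔθ i hi])
  have hstep : ∀ i, i < j → ‖w (i + 1) - w i‖ ≤ π / 8 * (1 / θ i - 1 / θ (i + 1)) := by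
    intro i hi
    have n1 := hne i hi.le
    have n2 := hne (i + 1) hi
    have h1 : w (i + 1) - w i = (e (θ (i + 1)) - e (θ i)) / ((1 - e (θ (i + 1))) * (1 - e (θ i))) := by
      rw [hw]; simp only; field_simp; ring
    have p1 : 0 < |θ i| := hΔ.trans_le (hΔθ i hi.le)
    have p2 : 0 < |θ (i + 1)| := hΔ.trans_le (hΔθ (i + 1) hi)
    have hm : θ i ≤ θ (i + 1) := hmono i hi
    have hpos : 0 < θ i * θ (i + 1) := by
      rcases hsign with h | h
      · exact mul_pos (hΔ.trans_le (h i hi.le)) (hΔ.trans_le (h (i + 1) hi))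
      · exact mul_pos_of_neg_of_neg (by linarith [h i hi.le]) (by
          have : θ (i + 1) ≤ -Δ := h (i + 1) hi
          linarith)
    rw [h1, norm_div, norm_mul]
    calc ‖e (θ (i + 1)) - e (θ i)‖ / (‖1 - e (θ (i + 1))‖ * ‖1 - e (θ i)‖)
        ≤ (2 * π * |θ (i + 1) - θ i|) / ((4 * |θ (i + 1)|) * (4 * |θ i|)) := by
          gcongr
          · exact norm_e_sub_e_le _ _
          · exact hnw (i + 1) hi
          · exact hnw i hi.le
      _ = π / 8 * (1 / θ i - 1 / θ (i + 1)) := by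
          have q1 : θ i ≠ 0 := abs_pos.1 p1
          have q2 : θ (i + 1) ≠ 0 := abs_pos.1 p2
          have : (4 * |θ (i + 1)|) * (4 * |θ i|) = 16 * (θ i * θ (i + 1)) := by
            rw [← abs_of_pos hpos, abs_mul]; ring
          rw [this, abs_of_nonneg (by linarith)]
          field_simp
          ring
  have key : ∀ i, i ≤ j → ‖∑ k ∈ range (i + 1), e (g (a + k)) + e (g (a + i + 1)) * w i‖
      ≤ ‖w 0‖ + π / 8 * (1 / θ 0 - 1 / θ i) := by
    have hE : ∀ i, i ≤ j → e (g (a + i)) + e (g (a + i + 1)) * w i = e (g (a + i)) * w i := by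
      intro i hi
      have n1 := hne i hi
      have : e (g (a + i + 1)) = e (g (a + i)) * e (θ i) := by
        rw [← e_add]; congr 1; simp [hθ]
      rw [this, hw]; simp only; field_simp; ring
    intro i
    induction i with
    | zero =>
      intro h0
      have := hE 0 h0
      simp only [add_zero] at this
      simp [this, norm_e]
    | succ i ih =>
      intro hi
      rw [sum_range_succ, add_assoc, hE (i + 1) hi]
      have : ∑ k ∈ range (i + 1), e (g (a + k)) + e (g (a + (i + 1))) * w (i + 1)
        = (∑ k ∈ range (i + 1), e (g (a + k)) + e (g (a + i + 1)) * w i)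
          + e (g (a + i + 1)) * (w (i + 1) - w i) := by
        rw [← add_assoc a i 1]; ring
      rw [this]
      refine (norm_add_le _ _).trans ?_
      rw [norm_mul, norm_e, one_mul]
      have := ih (by omega)
      have := hstep i (by omega)
      linarith
  have h1 := key j le_rfl
  have h2 : ‖∑ k ∈ range (j + 1), e (g (a + k))‖ ≤
      ‖∑ k ∈ range (j + 1), e (g (a + k)) + e (g (a + j + 1)) * w j‖ + ‖w j‖ := by
    have := norm_sub_le (∑ k ∈ range (j + 1), e (g (a + k)) + e (g (a + j + 1)) * w j)
      (e (g (a + j + 1)) * w j)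
    rwa [add_sub_cancel_right, norm_mul, norm_e, one_mul] at this
  have h3 : 1 / θ 0 - 1 / θ j ≤ 1 / Δ := by
    rcases hsign with h | h
    · have a1 : 1 / θ 0 ≤ 1 / Δ := one_div_le_one_div_of_le hΔ (h 0 (by omega))
      have a2 : 0 < 1 / θ j := one_div_pos.2 (hΔ.trans_le (h j le_rfl))
      linarith
    · have a1 : 1 / (-θ j) ≤ 1 / Δ := one_div_le_one_div_of_le hΔ
        (by have : θ j ≤ -Δ := h j le_rfl
            linarith)
      have a2 : 1 / θ 0 < 0 := one_div_neg.2 (by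
        have : θ 0 ≤ -Δ := h 0 (by omega)
        linarith)
      rw [one_div_neg_eq_neg_one_div] at a1
      linarith
  have h4 : π / 8 * (1 / θ 0 - 1 / θ j) ≤ 1 / 2 * (1 / Δ) := by
    have : π / 8 ≤ 1 / 2 := by linarith [Real.pi_le_four]
    calc π / 8 * (1 / θ 0 - 1 / θ j) ≤ π / 8 * (1 / Δ) := by gcongr
      _ ≤ _ := by gcongr
  have h5 : 1 / (4 * Δ) = 1 / 4 * (1 / Δ) := by field_simp
  have h6 : 2 / Δ = 2 * (1 / Δ) := by ring
  have h7 : 0 < 1 / Δ := by positivity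
  have := hwle 0 (by omega)
  have := hwle j le_rfl
  linarith

/-- A finite set of natural numbers without gaps. -/
def IsIntvl (s : Finset ℕ) : Prop := ∀ x ∈ s, ∀ y ∈ s, ∀ z, x ≤ z → z ≤ y → z ∈ s

lemma IsIntvl.eq_Ico {s : Finset ℕ} (hs : IsIntvl s) (hne : s.Nonempty) :
    ∃ a j, s = Ico a (a + (j + 1)) := by
  refine ⟨s.min' hne, s.max' hne - s.min' hne, ?_⟩
  have hmm := s.min'_le _ (s.max'_mem hne)
  ext z
  rw [mem_Ico]
  constructor
  · intro hz
    have := s.min'_le _ hz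
    have := s.le_max' _ hz
    omega
  · rintro ⟨h1, h2⟩
    exact hs _ (s.min'_mem hne) _ (s.max'_mem hne) z h1 (by omega)

/-- The Kusmin–Landau inequality. -/
lemma kusmin_landau {g : ℕ → ℝ} {s : Finset ℕ} (hs : IsIntvl s) {Δ : ℝ} (hΔ : 0 < Δ) (k : ℤ)
    (hmono : ∀ n ∈ s, g (n + 1) - g n ≤ g (n + 2) - g (n + 1))
    (hle : ∀ n ∈ s, |g (n + 1) - g n - k| ≤ 1 / 2)
    (hsign : (∀ n ∈ s, Δ ≤ g (n + 1) - g n - k) ∨ (∀ n ∈ s, g (n + 1) - g n - k ≤ -Δ)) :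
    ‖∑ n ∈ s, e (g n)‖ ≤ 2 / Δ := by
  rcases s.eq_empty_or_nonempty with rfl | hne
  · simp; positivity
  obtain ⟨a, j, rfl⟩ := hs.eq_Ico hne
  have hmem : ∀ i, i ≤ j → a + i ∈ Ico a (a + (j + 1)) := fun i hi => by
    rw [mem_Ico]; omega
  set g' : ℕ → ℝ := fun n => g n - k * n with hg'
  have hd : ∀ n : ℕ, g' (n + 1) - g' n = g (n + 1) - g n - k := fun n => by
    simp only [hg']; push_cast; ring
  have h1 : ∑ n ∈ Ico a (a + (j + 1)), e (g n) = ∑ i ∈ range (j + 1), e (g' (a + i)) := by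
    rw [Finset.sum_Ico_eq_sum_range]
    simp only [add_tsub_cancel_left]
    refine sum_congr rfl fun i _ => ?_
    have h2 : e (k * ((a + i : ℕ) : ℝ)) = 1 := by
      have := e_int (k * (a + i : ℕ))
      push_cast at this ⊢; exact this
    have h3 : g (a + i) = g' (a + i) + k * ((a + i : ℕ) : ℝ) := by simp only [hg']; ring
    rw [h3, e_add, h2, mul_one]
  rw [h1]
  clear_value g'
  refine kusmin_landau_aux g' a j hΔ ?_ ?_ ?_
  · intro i hi
    have h2 := hd (a + i)
    have h3 := hd (a + i + 1)
    rw [h2, h3]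
    linarith [hmono _ (hmem i hi.le)]
  · intro i hi
    rw [hd]
    exact hle _ (hmem i hi)
  · rcases hsign with h | h
    · left; intro i hi; rw [hd]; exact h _ (hmem i hi)
    · right; intro i hi; rw [hd]; exact h _ (hmem i hi)

lemma IsIntvl.filter_mono {s : Finset ℕ} (hs : IsIntvl s) {β : Type*} [Preorder β] {θ : ℕ → β}
    (hθ : ∀ x ∈ s, ∀ y ∈ s, x ≤ y → θ x ≤ θ y) (P : β → Prop) [DecidablePred P]
    (hP : ∀ x y z, x ≤ y → y ≤ z → P x → P z → P y) : IsIntvl (s.filter fun n => P (θ n)) := by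
  intro x hx y hy z h1 h2
  rw [mem_filter] at hx hy ⊢
  have hz := hs x hx.1 y hy.1 z h1 h2
  exact ⟨hz, hP _ _ _ (hθ _ hx.1 _ hz h1) (hθ _ hz _ hy.1 h2) hx.2 hy.2⟩

lemma norm_sum_e_le_card {ι : Type*} (s : Finset ι) (g : ι → ℝ) :
    ‖∑ n ∈ s, e (g n)‖ ≤ #s := by
  refine (norm_sum_le _ _).trans ?_
  simp [norm_e]

lemma increments {g : ℕ → ℝ} {a j : ℕ} {lo hi : ℝ}
    (h : ∀ n ∈ Ico a (a + (j + 1)), lo ≤ (g (n + 2) - g (n + 1)) - (g (n + 1) - g n) ∧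
      (g (n + 2) - g (n + 1)) - (g (n + 1) - g n) ≤ hi) (i : ℕ) (hi' : i ≤ j) :
    lo * i ≤ (g (a + i + 1) - g (a + i)) - (g (a + 1) - g a) ∧
    (g (a + i + 1) - g (a + i)) - (g (a + 1) - g a) ≤ hi * i := by
  induction i with
  | zero => simp
  | succ i ih =>
    have := ih (by omega)
    have h2 := h (a + i) (by rw [mem_Ico]; omega)
    rw [show a + (i + 1) = a + i + 1 by ring, show a + i + 1 + 1 = a + i + 2 by ring]
    push_cast
    constructor <;> nlinarith [this.1, this.2, h2.1, h2.2]

/-- A discrete version of van der Corput's second derivative test. -/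
lemma second_difference_test {g : ℕ → ℝ} {s : Finset ℕ} (hs : IsIntvl s) {l K : ℝ} (hl : 0 < l)
    (hK : 1 ≤ K)
    (h : ∀ n ∈ s, l ≤ (g (n + 2) - g (n + 1)) - (g (n + 1) - g n) ∧
      (g (n + 2) - g (n + 1)) - (g (n + 1) - g n) ≤ K * l) :
    ‖∑ n ∈ s, e (g n)‖ ≤ 20 * K * (#s * √l + 1 / √l) := by
  rcases s.eq_empty_or_nonempty with rfl | hne
  · simp; positivity
  rcases le_total 1 l with hl1 | hl1
  · have h1 : (1 : ℝ) ≤ √l := Real.one_le_sqrt.2 hl1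
    refine (norm_sum_e_le_card s g).trans ?_
    have h2 : (#s : ℝ) ≤ #s * √l := le_mul_of_one_le_right (by positivity) h1
    have h3 : 0 ≤ 1 / √l := by positivity
    have h4 : 0 ≤ #s * √l := by positivity
    nlinarith
  set q := √l with hq
  have hq0 : 0 < q := Real.sqrt_pos.2 hl
  have hq1 : q ≤ 1 := Real.sqrt_le_one.2 hl1
  have hqq : q * q = l := Real.mul_self_sqrt hl.le
  set θ : ℕ → ℝ := fun n => g (n + 1) - g n with hθ
  have hdiff : ∀ x ∈ s, ∀ y ∈ s, x ≤ y → l * ((y : ℝ) - x) ≤ θ y - θ x ∧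
      θ y - θ x ≤ K * l * ((y : ℝ) - x) := by
    intro x hx y hy hxy
    obtain ⟨j, rfl⟩ := Nat.exists_eq_add_of_le hxy
    have := increments (g := g) (a := x) (j := j) (lo := l) (hi := K * l)
      (fun n hn => h n (hs x hx _ hy n (mem_Ico.1 hn).1 (by have := (mem_Ico.1 hn).2; omega))) j le_rfl
    push_cast
    simpa [hθ] using this
  have hmono : ∀ x ∈ s, ∀ y ∈ s, x ≤ y → θ x ≤ θ y := by
    intro x hx y hy hxy
    have := (hdiff x hx y hy hxy).1
    have h2 : (x : ℝ) ≤ y := by exact_mod_cast hxy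
    nlinarith
  set r : ℝ → ℤ := fun x => ⌊x + 1 / 2⌋ with hr
  have hrmono : Monotone r := fun x y hxy => Int.floor_mono (by linarith)
  have hr1 : ∀ x, -(1 / 2) ≤ x - r x := fun x => by
    have := Int.floor_le (x + 1 / 2); simp only [hr]; linarith
  have hr2 : ∀ x, x - r x ≤ 1 / 2 := fun x => by
    have := Int.lt_floor_add_one (x + 1 / 2); simp only [hr]; linarith
  have hfib : ∀ k : ℤ, ‖∑ n ∈ s.filter (fun n => r (θ n) = k), e (g n)‖ ≤ 7 / q := by
    intro k
    set t := s.filter (fun n => r (θ n) = k) with ht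
    have hts : t ⊆ s := filter_subset _ _
    have htI : IsIntvl t := hs.filter_mono hmono (fun x => r x = k) (by
      intro x y z h1 h2 h3 h4
      exact le_antisymm (h4 ▸ hrmono h2) (h3 ▸ hrmono h1))
    have htk : ∀ n ∈ t, |θ n - k| ≤ 1 / 2 := by
      intro n hn
      rw [mem_filter] at hn
      rw [← hn.2, abs_le]
      exact ⟨hr1 _, hr2 _⟩
    have hm' : ∀ x ∈ t, ∀ y ∈ t, x ≤ y → θ x ≤ θ y := fun x hx y hy =>
      hmono x (hts hx) y (hts hy)
    set A := t.filter (fun n => q ≤ θ n - k) with hA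
    set t' := t.filter (fun n => ¬ q ≤ θ n - k) with ht'
    set B := t'.filter (fun n => θ n - k ≤ -q) with hB
    set D := t'.filter (fun n => ¬ θ n - k ≤ -q) with hD
    have hAI : IsIntvl A := htI.filter_mono hm' (fun x => q ≤ x - k) (by
      intro x y z h1 h2 h3 h4; linarith)
    have ht'I : IsIntvl t' := htI.filter_mono hm' (fun x => ¬ q ≤ x - k) (by
      intro x y z h1 h2 h3 h4; rw [not_le] at *; linarith)
    have hm'' : ∀ x ∈ t', ∀ y ∈ t', x ≤ y → θ x ≤ θ y := fun x hx y hy =>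
      hm' x (filter_subset _ _ hx) y (filter_subset _ _ hy)
    have hBI : IsIntvl B := ht'I.filter_mono hm'' (fun x => x - k ≤ -q) (by
      intro x y z h1 h2 h3 h4; linarith)
    have hDI : IsIntvl D := ht'I.filter_mono hm'' (fun x => ¬ x - k ≤ -q) (by
      intro x y z h1 h2 h3 h4; rw [not_le] at *; linarith)
    have hAt : A ⊆ t := filter_subset _ _
    have ht't : t' ⊆ t := filter_subset _ _
    have hBt : B ⊆ t := (filter_subset _ _).trans ht't
    have hDt : D ⊆ t := (filter_subset _ _).trans ht't
    have hgm : ∀ n ∈ s, g (n + 1) - g n ≤ g (n + 2) - g (n + 1) := fun n hn => by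
      linarith [(h n hn).1]
    have e1 : ‖∑ n ∈ A, e (g n)‖ ≤ 2 / q := kusmin_landau hAI hq0 k
      (fun n hn => hgm n (hts (hAt hn))) (fun n hn => htk n (hAt hn))
      (Or.inl fun n hn => (mem_filter.1 hn).2)
    have e2 : ‖∑ n ∈ B, e (g n)‖ ≤ 2 / q := kusmin_landau hBI hq0 k
      (fun n hn => hgm n (hts (hBt hn))) (fun n hn => htk n (hBt hn))
      (Or.inr fun n hn => (mem_filter.1 hn).2)
    have e3 : ‖∑ n ∈ D, e (g n)‖ ≤ 3 / q := by
      refine (norm_sum_e_le_card _ _).trans ?_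
      rcases D.eq_empty_or_nonempty with hD0 | hDne
      · rw [hD0]; simp; positivity
      obtain ⟨a, j, haj⟩ := hDI.eq_Ico hDne
      have ha : a ∈ D := by rw [haj, mem_Ico]; omega
      have hb : a + j ∈ D := by rw [haj, mem_Ico]; omega
      have h1 := (hdiff a (hts (hDt ha)) (a + j) (hts (hDt hb)) (by omega)).1
      have a1 : -q < θ a - k := by
        have := (mem_filter.1 ha).2; rwa [not_le] at this
      have a2 : θ (a + j) - k < q := by
        have := (mem_filter.1 ((filter_subset _ _ hb : _ ∈ t'))).2; rwa [not_le] at this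
      rw [haj, Nat.card_Ico, Nat.add_sub_cancel_left, le_div_iff₀ hq0]
      push_cast at h1 ⊢
      have h2 : q * (q * j) ≤ q * 2 := by nlinarith
      have h3 : q * j ≤ 2 := le_of_mul_le_mul_left h2 hq0
      nlinarith
    have hsplit : ∑ n ∈ t, e (g n) = ∑ n ∈ A, e (g n) + (∑ n ∈ B, e (g n) + ∑ n ∈ D, e (g n)) := by
      rw [hB, hD, sum_filter_add_sum_filter_not, hA, ht', sum_filter_add_sum_filter_not]
    rw [hsplit]
    calc _ ≤ 2 / q + (2 / q + 3 / q) :=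
          (norm_add_le _ _).trans (add_le_add e1 ((norm_add_le _ _).trans (add_le_add e2 e3)))
      _ = 7 / q := by ring
  have himg : (#(s.image fun n => r (θ n)) : ℝ) ≤ K * l * #s + 2 := by
    obtain ⟨a, j, haj⟩ := hs.eq_Ico hne
    have ha : a ∈ s := by rw [haj, mem_Ico]; omega
    have hb : a + j ∈ s := by rw [haj, mem_Ico]; omega
    have h1 := (hdiff a ha (a + j) hb (by omega)).2
    have hsub : s.image (fun n => r (θ n)) ⊆ Finset.Icc (r (θ a)) (r (θ (a + j))) := by
      intro k hk
      obtain ⟨n, hn, rfl⟩ := mem_image.1 hk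
      have hn' : a ≤ n ∧ n ≤ a + j := by rw [haj, mem_Ico] at hn; omega
      exact Finset.mem_Icc.2 ⟨hrmono (hmono _ ha _ hn hn'.1), hrmono (hmono _ hn _ hb hn'.2)⟩
    have hle : r (θ a) ≤ r (θ (a + j)) := hrmono (hmono _ ha _ hb (by omega))
    have hc : (#(s.image fun n => r (θ n)) : ℝ) ≤ (r (θ (a + j)) + 1 - r (θ a) : ℤ) := by
      have := card_le_card hsub
      rw [Int.card_Icc] at this
      have h3 : ((r (θ (a + j)) + 1 - r (θ a)).toNat : ℤ) = r (θ (a + j)) + 1 - r (θ a) :=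
        Int.toNat_of_nonneg (by omega)
      rw [← h3]
      exact_mod_cast this
    refine hc.trans ?_
    have b1 := hr1 (θ (a + j))
    have b2 := hr2 (θ a)
    have : (#s : ℝ) = j + 1 := by
      rw [haj, Nat.card_Ico, Nat.add_sub_cancel_left]; push_cast; ring
    rw [this]
    push_cast at h1 ⊢
    have : 0 ≤ K * l := by positivity
    nlinarith
  have hsum : ∑ n ∈ s, e (g n) = ∑ k ∈ s.image (fun n => r (θ n)),
      ∑ n ∈ s.filter (fun n => r (θ n) = k), e (g n) :=
    (sum_fiberwise_of_maps_to (fun n hn => mem_image_of_mem _ hn) _).symm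
  rw [hsum]
  calc _ ≤ ∑ k ∈ s.image (fun n => r (θ n)), 7 / q :=
        (norm_sum_le _ _).trans (sum_le_sum fun k _ => hfib k)
    _ = #(s.image fun n => r (θ n)) * (7 / q) := by rw [sum_const, nsmul_eq_mul]
    _ ≤ (K * l * #s + 2) * (7 / q) := by gcongr
    _ = 7 * K * (#s * q) + 14 * (1 / q) := by rw [← hqq]; field_simp; ring
    _ ≤ 20 * K * (#s * q + 1 / q) := by
      have : 0 ≤ #s * q := by positivity
      have : 0 < 1 / q := by positivity
      have : 0 ≤ K * (#s * q) := by positivity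
      nlinarith

lemma rpow_bounds (p : ℝ) {u B : ℝ} (hu : 1 ≤ u) (huB : u ≤ B) :
    B ^ (-|p|) ≤ u ^ p ∧ u ^ p ≤ B ^ |p| := by
  have hB : 1 ≤ B := hu.trans huB
  have hu0 : 0 < u := by linarith
  constructor
  · calc B ^ (-|p|) ≤ u ^ (-|p|) :=
          Real.rpow_le_rpow_of_nonpos hu0 huB (by simp)
      _ ≤ u ^ p := Real.rpow_le_rpow_of_exponent_le hu (neg_abs_le p)
  · calc u ^ p ≤ u ^ |p| := Real.rpow_le_rpow_of_exponent_le hu (le_abs_self p)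
      _ ≤ B ^ |p| := Real.rpow_le_rpow hu0.le huB (abs_nonneg p)

lemma rpow_bounds_mul (p : ℝ) {M x B : ℝ} (hM : 0 < M) (hx : M ≤ x) (hxB : x ≤ B * M) :
    B ^ (-|p|) * M ^ p ≤ x ^ p ∧ x ^ p ≤ B ^ |p| * M ^ p := by
  have h := rpow_bounds p (u := x / M) (B := B) (by rwa [one_le_div hM])
    (by rwa [div_le_iff₀ hM])
  have hx' : x ^ p = (x / M) ^ p * M ^ p := by
    rw [← Real.mul_rpow (by have := hM.trans_le hx; positivity) hM.le, div_mul_cancel₀ _ hM.ne']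
  have := Real.rpow_pos_of_pos hM p
  rw [hx']
  exact ⟨by gcongr; exact h.1, by gcongr; exact h.2⟩

lemma hasDerivAt_const_mul_rpow (A γ : ℝ) {x : ℝ} (hx : 0 < x) :
    HasDerivAt (fun t : ℝ => A * t ^ γ) (A * (γ * x ^ (γ - 1))) x :=
  (Real.hasDerivAt_rpow_const (Or.inl hx.ne')).const_mul A

lemma exists_second_difference_rpow (A γ : ℝ) {x : ℝ} (hx : 0 < x) :
    ∃ η, x ≤ η ∧ η ≤ x + 2 ∧
      (A * (x + 2) ^ γ - A * (x + 1) ^ γ) - (A * (x + 1) ^ γ - A * x ^ γ) =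
        A * (γ * (γ - 1)) * η ^ (γ - 2) := by
  have h1 : ∀ t, 0 < t → HasDerivAt (fun t : ℝ => A * (t + 1) ^ γ - A * t ^ γ)
      (A * (γ * (t + 1) ^ (γ - 1)) - A * (γ * t ^ (γ - 1))) t := fun t ht =>
    ((hasDerivAt_const_mul_rpow A γ (by linarith)).comp_add_const t 1).sub
      (hasDerivAt_const_mul_rpow A γ ht)
  obtain ⟨ξ, hξ, e1⟩ := exists_hasDerivAt_eq_slope
    (fun t : ℝ => A * (t + 1) ^ γ - A * t ^ γ)
    (fun t => A * (γ * (t + 1) ^ (γ - 1)) - A * (γ * t ^ (γ - 1))) (show x < x + 1 by linarith)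
    (fun t ht => (h1 t (hx.trans_le ht.1)).continuousAt.continuousWithinAt)
    (fun t ht => h1 t (hx.trans ht.1))
  have hξ0 : 0 < ξ := hx.trans hξ.1
  have h2 : ∀ t, 0 < t → HasDerivAt (fun t : ℝ => A * (γ * t ^ (γ - 1)))
      (A * (γ * ((γ - 1) * t ^ (γ - 1 - 1)))) t := fun t ht =>
    ((Real.hasDerivAt_rpow_const (Or.inl ht.ne')).const_mul γ).const_mul A
  obtain ⟨η, hη, e2⟩ := exists_hasDerivAt_eq_slope
    (fun t : ℝ => A * (γ * t ^ (γ - 1)))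
    (fun t => A * (γ * ((γ - 1) * t ^ (γ - 1 - 1)))) (show ξ < ξ + 1 by linarith)
    (fun t ht => (h2 t (hξ0.trans_le ht.1)).continuousAt.continuousWithinAt)
    (fun t ht => h2 t (hξ0.trans ht.1))
  refine ⟨η, by linarith [hη.1, hξ.1], by linarith [hη.2, hξ.2], ?_⟩
  simp only [add_sub_cancel_left, div_one] at e1 e2
  rw [show γ - 2 = γ - 1 - 1 by ring, show x + 2 = x + 1 + 1 by ring, ← e1, ← e2]
  ring

lemma card_le_of_subset_Icc {s : Finset ℕ} {M B : ℝ} (hM : 1 ≤ M) (hB : 0 ≤ B)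
    (hs : ∀ n ∈ s, M ≤ n ∧ (n : ℝ) ≤ B) : (#s : ℝ) ≤ B := by
  have : s ⊆ Finset.Icc 1 ⌊B⌋₊ := fun n hn => by
    rw [Finset.mem_Icc]
    exact ⟨by exact_mod_cast hM.trans (hs n hn).1, Nat.le_floor (hs n hn).2⟩
  have h2 := card_le_card this
  rw [Nat.card_Icc, Nat.add_sub_cancel] at h2
  exact (Nat.cast_le.2 h2).trans (Nat.floor_le hB)

lemma monomial_sum_pos {γ : ℝ} {R : ℝ} (hγ : γ * (γ - 1) ≠ 0) (hR : 1 ≤ R) :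
    ∃ C, 0 < C ∧ ∀ (A M : ℝ) (s : Finset ℕ), 0 < A * (γ * (γ - 1)) → 1 ≤ M → IsIntvl s →
      (∀ n ∈ s, M ≤ n ∧ (n : ℝ) ≤ R * M) →
      ‖∑ n ∈ s, e (A * (n : ℝ) ^ γ)‖ ≤ C * (√(|A| * M ^ γ) + M / √(|A| * M ^ γ)) := by
  set B := R + 2 with hB
  set p := |γ - 2| with hp
  set k := |γ * (γ - 1)| * B ^ (-p) with hk
  have hB1 : 1 ≤ B := by linarith
  have hB0 : 0 < B := by linarith
  have hk0 : 0 < k := mul_pos (abs_pos.2 hγ) (Real.rpow_pos_of_pos hB0 _)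
  set K := B ^ p * B ^ p with hK
  have hBp : 1 ≤ B ^ p := Real.one_le_rpow hB1 (abs_nonneg _)
  have hK1 : 1 ≤ K := by nlinarith
  have hsk : 0 < √k := Real.sqrt_pos.2 hk0
  refine ⟨20 * K * (R * √k + 1 / √k), by positivity, ?_⟩
  intro A M s hA hM hs hsM
  have hM0 : 0 < M := by linarith
  have hA0 : A ≠ 0 := by rintro rfl; simp at hA
  set F := |A| * M ^ γ with hF
  have hF0 : 0 < F := mul_pos (abs_pos.2 hA0) (Real.rpow_pos_of_pos hM0 _)
  have hAab : A * (γ * (γ - 1)) = |A| * |γ * (γ - 1)| := by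
    rw [← abs_mul, abs_of_pos hA]
  set l := k * F / M ^ 2 with hl
  have hl0 : 0 < l := by positivity
  have hMp : M ^ (γ - 2) = M ^ γ / M ^ 2 := by
    rw [Real.rpow_sub hM0, Real.rpow_two]
  have hmain := second_difference_test (g := fun n : ℕ => A * (n : ℝ) ^ γ) hs hl0 hK1 (by
    intro n hn
    obtain ⟨h1, h2⟩ := hsM n hn
    obtain ⟨η, g1, g2, g3⟩ := exists_second_difference_rpow A γ (hM0.trans_le h1)
    push_cast
    rw [g3, hAab]
    have hb := rpow_bounds_mul (γ - 2) hM0 (h1.trans g1) (show η ≤ B * M by nlinarith)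
    rw [hMp, ← hp] at hb
    have hpp : B ^ (-p) * B ^ p = 1 := by
      rw [← Real.rpow_add hB0]; simp
    have e1 : l = |A| * |γ * (γ - 1)| * (B ^ (-p) * (M ^ γ / M ^ 2)) := by
      rw [hl, hk, hF]; ring
    have e2 : K * l = |A| * |γ * (γ - 1)| * (B ^ p * (M ^ γ / M ^ 2)) := by
      rw [e1, hK]
      linear_combination (|A| * |γ * (γ - 1)| * (B ^ p * (M ^ γ / M ^ 2))) * hpp
    have hnn : 0 ≤ |A| * |γ * (γ - 1)| := by positivity
    constructor
    · rw [e1]; exact mul_le_mul_of_nonneg_left hb.1 hnn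
    · rw [e2]; exact mul_le_mul_of_nonneg_left hb.2 hnn)
  refine hmain.trans ?_
  have hcard : (#s : ℝ) ≤ R * M := card_le_of_subset_Icc hM (by positivity) hsM
  have hsl : √l = √k * √F / M := by
    rw [hl, Real.sqrt_div (by positivity), Real.sqrt_mul hk0.le, Real.sqrt_sq hM0.le]
  have hsF : 0 < √F := Real.sqrt_pos.2 hF0
  calc 20 * K * (#s * √l + 1 / √l) ≤ 20 * K * (R * M * √l + 1 / √l) := by gcongr
    _ = 20 * K * (R * √k * √F + 1 / √k * (M / √F)) := by
        rw [hsl]; field_simp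
    _ ≤ 20 * K * (R * √k + 1 / √k) * (√F + M / √F) := by
        have : 0 ≤ R * √k * (M / √F) := by positivity
        have : 0 ≤ 1 / √k * √F := by positivity
        rw [mul_assoc (20 * K)]
        refine mul_le_mul_of_nonneg_left ?_ (by positivity)
        nlinarith

lemma monomial_sum {γ : ℝ} {R : ℝ} (hγ : γ * (γ - 1) ≠ 0) (hR : 1 ≤ R) :
    ∃ C, 0 < C ∧ ∀ (A M : ℝ) (s : Finset ℕ), A ≠ 0 → 1 ≤ M → IsIntvl s →
      (∀ n ∈ s, M ≤ n ∧ (n : ℝ) ≤ R * M) →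
      ‖∑ n ∈ s, e (A * (n : ℝ) ^ γ)‖ ≤ C * (√(|A| * M ^ γ) + M / √(|A| * M ^ γ)) := by
  obtain ⟨C, hC, h⟩ := monomial_sum_pos hγ hR
  refine ⟨C, hC, fun A M s hA hM hs hsM => ?_⟩
  rcases lt_or_gt_of_ne (mul_ne_zero hA hγ) with h1 | h1
  · have := h (-A) M s (by linarith) hM hs hsM
    rw [abs_neg] at this
    convert this using 1
    rw [← Complex.norm_conj, map_sum]
    congr 1
    refine sum_congr rfl fun n _ => ?_
    rw [← e_neg]; congr 1; ring
  · exact h A M s h1 hM hs hsM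

/-- Mean value bounds for `x ↦ x ^ σ` on a dyadic-type interval. -/
lemma rpow_sub_bounds {σ : ℝ} (hσ : σ ≠ 0) {R : ℝ} (hR : 1 ≤ R) :
    ∃ k K, 0 < k ∧ 0 < K ∧ ∀ N x y : ℝ, 0 < N → N ≤ x → x < y → y ≤ R * N →
      k * ((y - x) * N ^ (σ - 1)) ≤ |y ^ σ - x ^ σ| ∧
      |y ^ σ - x ^ σ| ≤ K * ((y - x) * N ^ (σ - 1)) := by
  have hR0 : 0 < R := by linarith
  have hσ' := abs_pos.2 hσ
  refine ⟨|σ| * R ^ (-|σ - 1|), |σ| * R ^ |σ - 1|, by positivity, by positivity, ?_⟩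
  intro N x y hN hx hxy hy
  have hx0 : 0 < x := hN.trans_le hx
  obtain ⟨ξ, hξ, e1⟩ := exists_hasDerivAt_eq_slope (fun t : ℝ => t ^ σ)
    (fun t => σ * t ^ (σ - 1)) hxy
    (fun t ht => (Real.hasDerivAt_rpow_const
      (Or.inl (hx0.trans_le ht.1).ne')).continuousAt.continuousWithinAt)
    (fun t ht => Real.hasDerivAt_rpow_const (Or.inl (hx0.trans ht.1).ne'))
  have hd : 0 < y - x := by linarith
  rw [eq_div_iff hd.ne'] at e1
  have hb := rpow_bounds_mul (σ - 1) hN (hx.trans hξ.1.le) (hξ.2.le.trans hy)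
  have hξ0 : 0 < ξ := hx0.trans hξ.1
  rw [← e1, abs_mul, abs_mul, abs_of_pos hd, abs_of_pos (Real.rpow_pos_of_pos hξ0 _)]
  constructor
  · calc _ = |σ| * (R ^ (-|σ - 1|) * N ^ (σ - 1)) * (y - x) := by ring
      _ ≤ _ := by gcongr; exact hb.1
  · calc _ ≤ |σ| * (R ^ (|σ - 1|) * N ^ (σ - 1)) * (y - x) := by gcongr; exact hb.2
      _ = _ := by ring

lemma sum_range_inv_sqrt_le (n : ℕ) : ∑ j ∈ range n, 1 / √((j : ℝ) + 1) ≤ 2 * √n := by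
  induction n with
  | zero => simp
  | succ n ih =>
    rw [sum_range_succ]
    push_cast
    have h1 : 0 < √((n : ℝ) + 1) := Real.sqrt_pos.2 (by positivity)
    have h2 : √((n : ℝ) + 1) * √((n : ℝ) + 1) = n + 1 := Real.mul_self_sqrt (by positivity)
    have h3 : √(n : ℝ) * √(n : ℝ) = n := Real.mul_self_sqrt (by positivity)
    have h4 : 1 / √((n : ℝ) + 1) ≤ 2 * √((n : ℝ) + 1) - 2 * √n := by
      rw [div_le_iff₀ h1]
      nlinarith [sq_nonneg (√((n : ℝ) + 1) - √n)]
    linarith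

lemma sum_inv_sqrt_dist_le (H h : ℕ) (hh : h < H) :
    ∑ h' ∈ range H, 1 / √|(h : ℝ) - h'| ≤ 4 * √H := by
  have hsplit : ∑ h' ∈ range H, 1 / √|(h : ℝ) - h'| =
      ∑ h' ∈ range h, 1 / √|(h : ℝ) - h'| + ∑ j ∈ range (H - h), 1 / √|(h : ℝ) - (h + j : ℕ)| := by
    conv_lhs => rw [show H = h + (H - h) by omega, sum_range_add]
  have e1 : ∑ h' ∈ range h, 1 / √|(h : ℝ) - h'| = ∑ j ∈ range h, 1 / √((j : ℝ) + 1) := by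
    rw [← sum_range_reflect]
    refine sum_congr rfl fun j hj => ?_
    have hj := mem_range.1 hj
    congr 2
    rw [show h - 1 - j = h - (j + 1) by omega, Nat.cast_sub (by omega)]
    push_cast
    rw [abs_of_nonneg] <;> [ring; skip]
    ring_nf; positivity
  have e2 : ∑ j ∈ range (H - h), 1 / √|(h : ℝ) - (h + j : ℕ)| =
      ∑ j ∈ range (H - h - 1), 1 / √((j : ℝ) + 1) := by
    conv_lhs => rw [show H - h = H - h - 1 + 1 by omega, sum_range_succ']
    simp only [Nat.cast_add, Nat.cast_one, add_zero, sub_self, abs_zero,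
      Real.sqrt_zero, div_zero]
    refine sum_congr rfl fun j hj => ?_
    congr 2
    rw [show (h : ℝ) - (h + (j + 1)) = -(j + 1) by ring, abs_neg, abs_of_nonneg (by positivity)]
  rw [hsplit, e1, e2]
  have m1 : √(h : ℝ) ≤ √H := Real.sqrt_le_sqrt (by exact_mod_cast hh.le)
  have m2 : √((H - h - 1 : ℕ) : ℝ) ≤ √H := Real.sqrt_le_sqrt (by exact_mod_cast by omega)
  linarith [sum_range_inv_sqrt_le h, sum_range_inv_sqrt_le (H - h - 1)]

/-- Cauchy–Schwarz for the norm of a sum. -/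
lemma norm_sum_sq_le {ι : Type*} (s : Finset ι) (f : ι → ℂ) :
    ‖∑ i ∈ s, f i‖ ^ 2 ≤ #s * ∑ i ∈ s, ‖f i‖ ^ 2 :=
  (pow_le_pow_left₀ (norm_nonneg _) (norm_sum_le _ _) 2).trans sq_sum_le_card_mul_sum_sq

/-- Averaging over shifts followed by Cauchy–Schwarz. -/
lemma shift_average {z : ℕ → ℂ} {K H : ℕ} (hz : ∀ n, z n ≠ 0 → H ≤ n ∧ n < K) :
    (H : ℝ) ^ 2 * ‖∑ n ∈ range K, z n‖ ^ 2 ≤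
      K * ∑ k ∈ range K, ‖∑ h ∈ range H, z (k + h)‖ ^ 2 := by
  have h1 : ∀ h ∈ range H, ∑ k ∈ range K, z (k + h) = ∑ n ∈ range K, z n := by
    intro h hh
    have hh := mem_range.1 hh
    refine sum_bij_ne_zero (fun k _ _ => k + h) ?_ ?_ ?_ ?_
    · intro k hk hne; exact mem_range.2 (hz _ hne).2
    · intro k _ _ k' _ _ hkk; omega
    · intro n hn hne
      obtain ⟨a1, a2⟩ := hz n hne
      refine ⟨n - h, mem_range.2 (by omega), ?_, by omega⟩
      rwa [Nat.sub_add_cancel (by omega)]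
    · intro k _ _; rfl
  have h2 : (H : ℂ) * ∑ n ∈ range K, z n = ∑ k ∈ range K, ∑ h ∈ range H, z (k + h) := by
    rw [sum_comm, sum_congr rfl h1, sum_const, card_range, nsmul_eq_mul]
  have h3 := norm_sum_sq_le (range K) (fun k => ∑ h ∈ range H, z (k + h))
  rw [← h2, norm_mul, mul_pow, Complex.norm_natCast, card_range] at h3
  exact h3

lemma sum_norm_sq_le {ι : Type*} (s : Finset ι) (H : ℕ) (w : ι → ℕ → ℂ) :
    ∑ m ∈ s, ‖∑ h ∈ range H, w m h‖ ^ 2 ≤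
      ∑ h ∈ range H, ∑ h' ∈ range H, ‖∑ m ∈ s, w m h * (starRingEnd ℂ) (w m h')‖ := by
  have h1 : ((∑ m ∈ s, ‖∑ h ∈ range H, w m h‖ ^ 2 : ℝ) : ℂ) =
      ∑ h ∈ range H, ∑ h' ∈ range H, ∑ m ∈ s, w m h * (starRingEnd ℂ) (w m h') := by
    push_cast
    rw [sum_congr rfl fun m _ => (Complex.mul_conj' (∑ h ∈ range H, w m h)).symm]
    simp_rw [map_sum, sum_mul_sum]
    rw [sum_comm]
    exact sum_congr rfl fun h _ => sum_comm
  have h2 : 0 ≤ ∑ m ∈ s, ‖∑ h ∈ range H, w m h‖ ^ 2 := sum_nonneg fun _ _ => by positivity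
  calc _ = ‖((∑ m ∈ s, ‖∑ h ∈ range H, w m h‖ ^ 2 : ℝ) : ℂ)‖ := by
        rw [Complex.norm_real, Real.norm_of_nonneg h2]
    _ ≤ _ := by
        rw [h1]
        exact (norm_sum_le _ _).trans (sum_le_sum fun h _ => norm_sum_le _ _)

lemma correlation_bound {γ σ R : ℝ} (hγ : γ * (γ - 1) ≠ 0) (hσ : σ ≠ 0) (hR : 1 ≤ R) :
    ∃ C, 0 < C ∧ ∀ (M N A₀ : ℝ) (s : Finset ℕ) (ν ν' : ℕ), 1 ≤ M → 1 ≤ N → A₀ ≠ 0 →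
      IsIntvl s → (∀ m ∈ s, M ≤ m ∧ (m : ℝ) ≤ R * M) → N ≤ ν → ν < ν' → ν' ≤ R * N →
      ‖∑ m ∈ s, e (A₀ * ((ν : ℝ) ^ σ - (ν' : ℝ) ^ σ) * (m : ℝ) ^ γ)‖ ≤
        C * (√(|A₀| * M ^ γ * N ^ σ / N) * √((ν' : ℝ) - ν) +
          M / √(|A₀| * M ^ γ * N ^ σ / N) * (1 / √((ν' : ℝ) - ν))) := by
  obtain ⟨C, hC, h⟩ := monomial_sum hγ hR
  obtain ⟨k, K, hk, hK, hd⟩ := rpow_sub_bounds hσ hR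
  have hsk := Real.sqrt_pos.2 hk
  have hsK := Real.sqrt_pos.2 hK
  refine ⟨C * (√K + 1 / √k), by positivity, ?_⟩
  intro M N A₀ s ν ν' hM hN hA hs hsM h1 h2 h3
  have hM0 : 0 < M := by linarith
  have hN0 : 0 < N := by linarith
  have h2' : (ν : ℝ) < ν' := by exact_mod_cast h2
  have hA' := abs_pos.2 hA
  obtain ⟨b1, b2⟩ := hd N ν ν' hN0 h1 h2' h3
  have hj : 0 < (ν' : ℝ) - ν := by linarith
  set F := |A₀| * M ^ γ * N ^ σ / N with hF
  have hF0 : 0 < F := by positivity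
  have hN1 : N ^ (σ - 1) = N ^ σ / N := by rw [Real.rpow_sub hN0, Real.rpow_one]
  rw [hN1] at b1 b2
  have hpos : 0 < |(ν' : ℝ) ^ σ - (ν : ℝ) ^ σ| := lt_of_lt_of_le (by positivity) b1
  have hne : (ν : ℝ) ^ σ - (ν' : ℝ) ^ σ ≠ 0 := by
    rw [abs_sub_comm] at hpos; exact abs_pos.1 hpos
  refine (h _ M s (mul_ne_zero hA hne) hM hs hsM).trans ?_
  rw [abs_mul, abs_sub_comm]
  set G := |A₀| * |(ν' : ℝ) ^ σ - (ν : ℝ) ^ σ| * M ^ γ with hG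
  have g1 : k * (F * ((ν' : ℝ) - ν)) ≤ G := by
    calc _ = |A₀| * (k * (((ν' : ℝ) - ν) * (N ^ σ / N))) * M ^ γ := by rw [hF]; ring
      _ ≤ _ := by rw [hG]; gcongr
  have g2 : G ≤ K * (F * ((ν' : ℝ) - ν)) := by
    calc _ ≤ |A₀| * (K * (((ν' : ℝ) - ν) * (N ^ σ / N))) * M ^ γ := by rw [hG]; gcongr
      _ = _ := by rw [hF]; ring
  have g3 : √G ≤ √K * (√F * √((ν' : ℝ) - ν)) := by
    rw [← Real.sqrt_mul hF0.le, ← Real.sqrt_mul hK.le]; exact Real.sqrt_le_sqrt g2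
  have g4 : √k * (√F * √((ν' : ℝ) - ν)) ≤ √G := by
    rw [← Real.sqrt_mul hF0.le, ← Real.sqrt_mul hk.le]; exact Real.sqrt_le_sqrt g1
  have hsF := Real.sqrt_pos.2 hF0
  have hsj := Real.sqrt_pos.2 hj
  calc C * (√G + M / √G) ≤ C * (√K * (√F * √((ν' : ℝ) - ν)) +
        M / (√k * (√F * √((ν' : ℝ) - ν)))) := by gcongr
    _ = C * (√K * (√F * √((ν' : ℝ) - ν)) + 1 / √k * (M / √F * (1 / √((ν' : ℝ) - ν)))) := by
        field_simp
    _ ≤ _ := by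
        rw [mul_assoc]
        refine mul_le_mul_of_nonneg_left ?_ hC.le
        have : 0 ≤ √K * (M / √F * (1 / √((ν' : ℝ) - ν))) := by positivity
        have : 0 ≤ 1 / √k * (√F * √((ν' : ℝ) - ν)) := by positivity
        nlinarith

/-- A bilinear (type II) estimate for monomial phases. -/
lemma bilinear_estimate {γ σ R : ℝ} (hγ : γ * (γ - 1) ≠ 0) (hσ : σ ≠ 0) (hR : 1 ≤ R) :
    ∃ C, 0 < C ∧ ∀ (M N A₀ A : ℝ) (H : ℕ) (s t : Finset ℕ) (D : ℕ → ℕ → Prop)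
      [∀ m ν, Decidable (D m ν)] (a b : ℕ → ℂ), 1 ≤ M → 1 ≤ N → A₀ ≠ 0 → 1 ≤ H → (H : ℝ) ≤ N →
      (∀ m ∈ s, M ≤ m ∧ (m : ℝ) ≤ R * M) → (∀ ν ∈ t, N ≤ ν ∧ (ν : ℝ) ≤ R * N) →
      (∀ ν ∈ t, IsIntvl (s.filter fun m => D m ν)) → (∀ m ∈ s, ‖a m‖ ≤ A) →
      (∀ ν ∈ t, ‖b ν‖ ≤ 1) →
      ‖∑ m ∈ s, a m * ∑ ν ∈ t, if D m ν then b ν * e (A₀ * (m : ℝ) ^ γ * (ν : ℝ) ^ σ) else 0‖ ^ 2 ≤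
        C * A ^ 2 * (M * N ^ 2) * (M / H + √(|A₀| * M ^ γ * N ^ σ / N) * √H +
          M / √(|A₀| * M ^ γ * N ^ σ / N) / √H) := by
  obtain ⟨C₁, hC₁, hcor⟩ := correlation_bound hγ hσ hR
  refine ⟨4 * R ^ 3 * (R + 4 * C₁), by positivity, ?_⟩
  intro M N A₀ A H s t D _ a b hM hN hA₀ hH hHN hsM htN hD ha hb
  have hM0 : 0 < M := by linarith
  have hN0 : 0 < N := by linarith
  have hH0 : (0 : ℝ) < H := by exact_mod_cast hH
  set F := |A₀| * M ^ γ * N ^ σ / N with hF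
  have hF0 : 0 < F := by have := abs_pos.2 hA₀; positivity
  have hsF := Real.sqrt_pos.2 hF0
  have hsH := Real.sqrt_pos.2 hH0
  set z : ℕ → ℕ → ℂ := fun m ν => if ν ∈ t ∧ D m ν then b ν * e (A₀ * (m : ℝ) ^ γ * (ν : ℝ) ^ σ)
    else 0 with hz
  set K := ⌊R * N⌋₊ + 1 with hK
  have htK : ∀ ν ∈ t, ν < K := fun ν hν => Nat.lt_succ_of_le (Nat.le_floor (htN ν hν).2)
  have hKle : (K : ℝ) ≤ 2 * R * N := by
    rw [hK]; push_cast
    have := Nat.floor_le (show 0 ≤ R * N by positivity)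
    nlinarith
  have hcs : (#s : ℝ) ≤ R * M := card_le_of_subset_Icc hM (by positivity) hsM
  have hW : ∀ m, ∑ ν ∈ t, (if D m ν then b ν * e (A₀ * (m : ℝ) ^ γ * (ν : ℝ) ^ σ) else 0) =
      ∑ ν ∈ range K, z m ν := by
    intro m
    rw [← sum_subset (show t ⊆ range K from fun ν hν => mem_range.2 (htK ν hν))]
    · exact sum_congr rfl fun ν hν => by simp [hz, hν]
    · intro ν _ hν; simp [hz, hν]
  have hzs : ∀ m n, z m n ≠ 0 → H ≤ n ∧ n < K := by
    intro m n hne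
    have : n ∈ t := by by_contra hcon; exact hne (by simp [hz, hcon])
    exact ⟨by exact_mod_cast hHN.trans (htN n this).1, htK n this⟩
  have hzn : ∀ m n, ‖z m n‖ ≤ 1 := by
    intro m n
    simp only [hz]
    split_ifs with hc
    · rw [norm_mul, norm_e, mul_one]; exact hb n hc.1
    · simp
  -- off-diagonal correlations
  have hoff : ∀ ν ν' : ℕ, ν < ν' → ν' < ν + H →
      ‖∑ m ∈ s, z m ν * (starRingEnd ℂ) (z m ν')‖ ≤
        C₁ * (√F * √H + M / √F * (1 / √|(ν : ℝ) - ν'|)) := by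
    intro ν ν' hlt hltH
    by_cases hmem : ν ∈ t ∧ ν' ∈ t
    · have hI : IsIntvl (s.filter fun m => D m ν ∧ D m ν') := by
        intro x hx y hy w h1 h2
        rw [mem_filter] at hx hy ⊢
        have w1 := mem_filter.1 (hD ν hmem.1 x (mem_filter.2 ⟨hx.1, hx.2.1⟩) y
          (mem_filter.2 ⟨hy.1, hy.2.1⟩) w h1 h2)
        have w2 := mem_filter.1 (hD ν' hmem.2 x (mem_filter.2 ⟨hx.1, hx.2.2⟩) y
          (mem_filter.2 ⟨hy.1, hy.2.2⟩) w h1 h2)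
        exact ⟨w1.1, w1.2, w2.2⟩
      have hsum : ∑ m ∈ s, z m ν * (starRingEnd ℂ) (z m ν') =
          b ν * (starRingEnd ℂ) (b ν') * ∑ m ∈ s.filter (fun m => D m ν ∧ D m ν'),
            e (A₀ * ((ν : ℝ) ^ σ - (ν' : ℝ) ^ σ) * (m : ℝ) ^ γ) := by
        rw [mul_sum, sum_filter]
        refine sum_congr rfl fun m _ => ?_
        simp only [hz, hmem, true_and]
        by_cases d1 : D m ν <;> by_cases d2 : D m ν' <;> simp only [d1, d2, if_true, if_false,
          and_self, and_true, and_false, map_zero, mul_zero, zero_mul, map_mul]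
        rw [show A₀ * ((ν : ℝ) ^ σ - (ν' : ℝ) ^ σ) * (m : ℝ) ^ γ =
          A₀ * (m : ℝ) ^ γ * (ν : ℝ) ^ σ - A₀ * (m : ℝ) ^ γ * (ν' : ℝ) ^ σ by ring, e_sub]
        ring
      have hlt' : (ν : ℝ) < ν' := by exact_mod_cast hlt
      have hj : (ν' : ℝ) - ν ≤ H := by
        have : (ν' : ℝ) < ν + H := by exact_mod_cast hltH
        linarith
      rw [hsum, norm_mul, norm_mul, Complex.norm_conj, abs_sub_comm,
        abs_of_pos (show 0 < (ν' : ℝ) - ν by linarith)]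
      have hbb : ‖b ν‖ * ‖b ν'‖ ≤ 1 :=
        mul_le_one₀ (hb ν hmem.1) (norm_nonneg _) (hb ν' hmem.2)
      refine (mul_le_of_le_one_left (norm_nonneg _) hbb).trans ?_
      refine (hcor M N A₀ _ ν ν' hM hN hA₀ hI (fun m hm => hsM m (mem_filter.1 hm).1)
        (htN ν hmem.1).1 hlt (htN ν' hmem.2).2).trans ?_
      gcongr
    · have : ∑ m ∈ s, z m ν * (starRingEnd ℂ) (z m ν') = 0 := by
        refine sum_eq_zero fun m _ => ?_
        rcases not_and_or.1 hmem with h1 | h1 <;> simp [hz, h1]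
      rw [this, norm_zero]; positivity
  have hpair : ∀ k : ℕ, ∀ h ∈ range H, ∀ h' ∈ range H,
      ‖∑ m ∈ s, z m (k + h) * (starRingEnd ℂ) (z m (k + h'))‖ ≤
        (if h = h' then R * M else 0) +
          C₁ * (√F * √H + M / √F * (1 / √|(h : ℝ) - h'|)) := by
    intro k h hh h' hh'
    have hh := mem_range.1 hh
    have hh' := mem_range.1 hh'
    rcases lt_trichotomy h h' with hlt | heq | hgt
    · have := hoff (k + h) (k + h') (by omega) (by omega)
      rw [if_neg hlt.ne, zero_add]
      push_cast at this
      rwa [add_sub_add_left_eq_sub] at this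
    · rw [if_pos heq]
      have h1 : ‖∑ m ∈ s, z m (k + h) * (starRingEnd ℂ) (z m (k + h'))‖ ≤ R * M := by
        refine (norm_sum_le _ _).trans (le_trans ?_ hcs)
        refine (sum_le_card_nsmul s _ 1 fun m _ => ?_).trans (by simp)
        rw [norm_mul, Complex.norm_conj]
        exact mul_le_one₀ (hzn _ _) (norm_nonneg _) (hzn _ _)
      have h2 : 0 ≤ C₁ * (√F * √H + M / √F * (1 / √|(h : ℝ) - h'|)) := by positivity
      linarith
    · have := hoff (k + h') (k + h) (by omega) (by omega)
      rw [if_neg hgt.ne', zero_add]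
      push_cast at this
      rw [add_sub_add_left_eq_sub, abs_sub_comm] at this
      refine le_trans (le_of_eq ?_) this
      rw [← Complex.norm_conj, map_sum]
      congr 1
      refine sum_congr rfl fun m _ => ?_
      rw [map_mul, Complex.conj_conj, mul_comm]
  set E := R * M + H * (C₁ * (√F * √H)) + C₁ * (M / √F * (4 * √H)) with hE
  have hk : ∀ k ∈ range K, ∑ m ∈ s, ‖∑ h ∈ range H, z m (k + h)‖ ^ 2 ≤ H * E := by
    intro k _
    refine (sum_norm_sq_le s H (fun m h => z m (k + h))).trans ?_
    calc _ ≤ ∑ h ∈ range H, E := by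
          refine sum_le_sum fun h hh => ?_
          refine (sum_le_sum (hpair k h hh)).trans ?_
          rw [sum_add_distrib, sum_ite_eq, if_pos hh, ← mul_sum, sum_add_distrib, ← mul_sum,
            sum_const, card_range, nsmul_eq_mul, mul_add, ← add_assoc, hE]
          have := sum_inv_sqrt_dist_le H h (mem_range.1 hh)
          have e1 : C₁ * (√F * (H * √H)) = H * (C₁ * (√F * √H)) := by ring
          rw [e1, ← mul_sum]
          gcongr
      _ = H * E := by rw [sum_const, card_range, nsmul_eq_mul]
  have hWs : (H : ℝ) ^ 2 * ∑ m ∈ s, ‖∑ ν ∈ range K, z m ν‖ ^ 2 ≤ K * (K * (H * E)) := by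
    rw [mul_sum]
    refine (sum_le_sum fun m _ => shift_average (hzs m)).trans ?_
    rw [← mul_sum, sum_comm]
    refine mul_le_mul_of_nonneg_left ?_ (by positivity)
    refine (sum_le_sum hk).trans ?_
    rw [sum_const, card_range, nsmul_eq_mul]
  have hWs' : ∑ m ∈ s, ‖∑ ν ∈ range K, z m ν‖ ^ 2 ≤ (2 * R * N) ^ 2 * (E / H) := by
    have hE0 : 0 ≤ E := by positivity
    have : (H : ℝ) ^ 2 * ∑ m ∈ s, ‖∑ ν ∈ range K, z m ν‖ ^ 2 ≤
        (H : ℝ) ^ 2 * ((2 * R * N) ^ 2 * (E / H)) := by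
      calc _ ≤ K * (K * (H * E)) := hWs
        _ ≤ (2 * R * N) * ((2 * R * N) * (H * E)) := by gcongr
        _ = _ := by field_simp
    exact le_of_mul_le_mul_left this (by positivity)
  have hEH : E / H ≤ (R + 4 * C₁) * (M / H + √F * √H + M / √F / √H) := by
    have hHH : √(H : ℝ) * √H = H := Real.mul_self_sqrt hH0.le
    have : E / H = R * (M / H) + C₁ * (√F * √H) + 4 * C₁ * (M / √F / √H) := by
      rw [hE]
      have h3 : √(H : ℝ) / H = 1 / √H := by
        rw [div_eq_div_iff hH0.ne' hsH.ne', one_mul, hHH]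
      calc _ = R * (M / H) + C₁ * (√F * √H) * (H / H) + 4 * C₁ * (M / √F) * (√H / H) := by
            ring
        _ = _ := by rw [h3, div_self hH0.ne']; ring
    rw [this]
    have p1 : 0 ≤ M / H := by positivity
    have p2 : 0 ≤ √F * √H := by positivity
    have p3 : 0 ≤ M / √F / √H := by positivity
    nlinarith [mul_nonneg hC₁.le p1, mul_nonneg hC₁.le p2,
      mul_nonneg (show 0 ≤ R by linarith) p2, mul_nonneg (show 0 ≤ R by linarith) p3]
  simp_rw [hW]
  have hA2 : ∀ m ∈ s, ‖a m * ∑ ν ∈ range K, z m ν‖ ^ 2 ≤ A ^ 2 * ‖∑ ν ∈ range K, z m ν‖ ^ 2 := by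
    intro m hm
    rw [norm_mul, mul_pow]
    gcongr
    exact ha m hm
  calc _ ≤ #s * ∑ m ∈ s, ‖a m * ∑ ν ∈ range K, z m ν‖ ^ 2 := norm_sum_sq_le _ _
    _ ≤ (R * M) * (A ^ 2 * ((2 * R * N) ^ 2 * ((R + 4 * C₁) *
          (M / H + √F * √H + M / √F / √H)))) := by
        refine mul_le_mul hcs ?_ (by positivity) (by positivity)
        refine (sum_le_sum hA2).trans ?_
        rw [← mul_sum]
        refine mul_le_mul_of_nonneg_left (hWs'.trans ?_) (by positivity)
        exact mul_le_mul_of_nonneg_left hEH (by positivity)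
    _ = _ := by ring

section Oscillatory

variable {a b : ℝ} {G G' h h' : ℝ → ℝ}

lemma HasDerivAt.e {x : ℝ} {h : ℝ → ℝ} {h'x : ℝ} (hh : HasDerivAt h h'x x) :
    HasDerivAt (fun t => e (h t)) (2 * π * I * (h'x * e (h x))) x := by
  refine ((hasDerivAt_e (h x)).scomp x hh).congr_deriv ?_
  rw [Complex.real_smul]; ring

lemma integral_mul_deriv_mul_e (hab : a ≤ b)
    (hG : ∀ x ∈ Set.Icc a b, HasDerivAt G (G' x) x)
    (hh : ∀ x ∈ Set.Icc a b, HasDerivAt h (h' x) x)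
    (cG : ContinuousOn G' (Set.Icc a b)) (ch : ContinuousOn h' (Set.Icc a b)) :
    2 * π * I * ∫ x in a..b, ((G x * h' x : ℝ) : ℂ) * e (h x) =
      G b * e (h b) - G a * e (h a) - ∫ x in a..b, (G' x : ℂ) * e (h x) := by
  have hu : Set.uIcc a b = Set.Icc a b := Set.uIcc_of_le hab
  have che : ContinuousOn (fun x => e (h x)) (Set.Icc a b) := fun x hx =>
    (continuous_e.continuousAt.comp (hh x hx).continuousAt).continuousWithinAt
  have key := intervalIntegral.integral_mul_deriv_eq_deriv_mul (a := a) (b := b)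
    (u := fun x => (G x : ℂ)) (v := fun x => e (h x)) (u' := fun x => (G' x : ℂ))
    (v' := fun x => 2 * π * I * (h' x * e (h x)))
    (fun x hx => (hG x (hu ▸ hx)).ofReal_comp) (fun x hx => HasDerivAt.e (hh x (hu ▸ hx)))
    (ContinuousOn.intervalIntegrable (hu ▸ Complex.continuous_ofReal.comp_continuousOn cG))
    (ContinuousOn.intervalIntegrable (hu ▸ continuousOn_const.mul
      ((Complex.continuous_ofReal.comp_continuousOn ch).mul che)))
  rw [← key, ← intervalIntegral.integral_const_mul]
  refine intervalIntegral.integral_congr fun x _ => ?_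
  push_cast; ring

lemma norm_integral_deriv_mul_e_le (hab : a ≤ b)
    (hG : ∀ x ∈ Set.Icc a b, HasDerivAt G (G' x) x)
    (cG : ContinuousOn G' (Set.Icc a b))
    (sgn : (∀ x ∈ Set.Icc a b, 0 ≤ G' x) ∨ ∀ x ∈ Set.Icc a b, G' x ≤ 0) :
    ‖∫ x in a..b, (G' x : ℂ) * e (h x)‖ ≤ |G b - G a| := by
  have hu : Set.uIcc a b = Set.Icc a b := Set.uIcc_of_le hab
  have h1 : ‖∫ x in a..b, (G' x : ℂ) * e (h x)‖ ≤ ∫ x in a..b, |G' x| := by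
    refine (intervalIntegral.norm_integral_le_integral_norm hab).trans (le_of_eq ?_)
    refine intervalIntegral.integral_congr fun x _ => ?_
    simp [norm_e]
  have h2 : ∫ x in a..b, G' x = G b - G a :=
    intervalIntegral.integral_eq_sub_of_hasDerivAt (fun x hx => hG x (hu ▸ hx))
      (ContinuousOn.intervalIntegrable (hu ▸ cG))
  refine h1.trans ?_
  rcases sgn with hs | hs
  · rw [intervalIntegral.integral_congr (g := G') fun x hx => abs_of_nonneg (hs x (hu ▸ hx)), h2]
    exact le_abs_self _
  · rw [intervalIntegral.integral_congr (g := fun x => -G' x)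
      fun x hx => abs_of_nonpos (hs x (hu ▸ hx)), intervalIntegral.integral_neg, h2]
    exact neg_le_abs _

lemma norm_integral_mul_deriv_mul_e_le (hab : a ≤ b)
    (hG : ∀ x ∈ Set.Icc a b, HasDerivAt G (G' x) x)
    (hh : ∀ x ∈ Set.Icc a b, HasDerivAt h (h' x) x)
    (cG : ContinuousOn G' (Set.Icc a b)) (ch : ContinuousOn h' (Set.Icc a b))
    (sgn : (∀ x ∈ Set.Icc a b, 0 ≤ G' x) ∨ ∀ x ∈ Set.Icc a b, G' x ≤ 0) :
    ‖∫ x in a..b, ((G x * h' x : ℝ) : ℂ) * e (h x)‖ ≤ (|G a| + |G b|) / π := by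
  have h1 := congrArg norm (integral_mul_deriv_mul_e hab hG hh cG ch)
  have h2 : ‖∫ x in a..b, (G' x : ℂ) * e (h x)‖ ≤ |G b - G a| :=
    norm_integral_deriv_mul_e_le hab hG cG sgn
  have h3 : ‖(G b * e (h b) - G a * e (h a) : ℂ)‖ ≤ |G b| + |G a| := by
    refine (norm_sub_le _ _).trans ?_
    simp [norm_e]
  have h4 := abs_sub (G b) (G a)
  have h5 : ‖(2 * π * I : ℂ)‖ = 2 * π := by simp [Real.pi_pos.le]
  rw [norm_mul, h5] at h1
  rw [le_div_iff₀ Real.pi_pos]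
  have h6 := norm_sub_le (G b * e (h b) - G a * e (h a) : ℂ) (∫ x in a..b, (G' x : ℂ) * e (h x))
  linarith

/-- The first derivative test. -/
lemma first_derivative_test (hab : a ≤ b) {h'' : ℝ → ℝ} {μ : ℝ} (hμ : 0 < μ)
    (hh : ∀ x ∈ Set.Icc a b, HasDerivAt h (h' x) x)
    (hh' : ∀ x ∈ Set.Icc a b, HasDerivAt h' (h'' x) x)
    (ch : ContinuousOn h'' (Set.Icc a b)) (sgn : ∀ x ∈ Set.Icc a b, h'' x ≤ 0)
    (hle : ∀ x ∈ Set.Icc a b, μ ≤ |h' x|) :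
    ‖∫ x in a..b, e (h x)‖ ≤ 1 / μ := by
  have hu : Set.uIcc a b = Set.Icc a b := Set.uIcc_of_le hab
  have hne : ∀ x ∈ Set.Icc a b, h' x ≠ 0 := fun x hx => abs_pos.1 (hμ.trans_le (hle x hx))
  have ch' : ContinuousOn h' (Set.Icc a b) := fun x hx =>
    (hh' x hx).continuousAt.continuousWithinAt
  have key := norm_integral_mul_deriv_mul_e_le (G := fun x => (h' x)⁻¹)
    (G' := fun x => -h'' x / h' x ^ 2) (h := h) (h' := h') hab
    (fun x hx => (hh' x hx).inv (hne x hx)) hh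
    (ch.neg.div (ch'.pow 2) fun x hx => pow_ne_zero 2 (hne x hx)) ch'
    (Or.inl fun x hx => div_nonneg (neg_nonneg.2 (sgn x hx)) (sq_nonneg _))
  have e1 : ∫ x in a..b, (((h' x)⁻¹ * h' x : ℝ) : ℂ) * e (h x) = ∫ x in a..b, e (h x) :=
    intervalIntegral.integral_congr fun x hx => by
      simp [inv_mul_cancel₀ (show (h' x : ℂ) ≠ 0 by exact_mod_cast hne x (hu ▸ hx))]
  rw [e1] at key
  refine key.trans ?_
  have b1 : |(h' a)⁻¹| ≤ 1 / μ := by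
    rw [abs_inv, one_div]; exact inv_anti₀ hμ (hle a ⟨le_rfl, hab⟩)
  have b2 : |(h' b)⁻¹| ≤ 1 / μ := by
    rw [abs_inv, one_div]; exact inv_anti₀ hμ (hle b ⟨hab, le_rfl⟩)
  rw [div_le_iff₀ Real.pi_pos]
  have : 0 < 1 / μ := by positivity
  nlinarith [Real.pi_gt_three]

end Oscillatory

/-- `cos (2 π x)` written through `e`. -/
noncomputable def ecos (x : ℝ) : ℂ := (e x + e (-x)) / 2

lemma ecos_neg (x : ℝ) : ecos (-x) = ecos x := by
  unfold ecos; rw [neg_neg, add_comm]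

lemma continuous_ecos : Continuous ecos := by
  unfold ecos
  have := continuous_e
  fun_prop

lemma hasSum_ecos_unit {g : ℝ → ℂ} (k : ℕ) (hg : ContinuousOn g (Set.Icc k (k + 1)))
    (hs : Summable fun n : ℤ => ∫ x in (k : ℝ)..(k + 1), ecos (n * x) * g x) :
    HasSum (fun n : ℤ => ∫ x in (k : ℝ)..(k + 1), ecos (n * x) * g x)
      ((g k + g (k + 1)) / 2) := by
  set G : ℝ → ℂ := fun x => (g (k + x) + g (k + 1 - x)) / 2 with hG
  have c1 : ContinuousOn (fun x : ℝ => g (k + x)) (Set.Icc 0 1) :=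
    hg.comp (by fun_prop) fun x hx => ⟨by linarith [hx.1], by linarith [hx.2]⟩
  have c2 : ContinuousOn (fun x : ℝ => g (k + 1 - x)) (Set.Icc 0 1) :=
    hg.comp (by fun_prop) fun x hx => ⟨by linarith [hx.2], by linarith [hx.1]⟩
  have cG : ContinuousOn G (Set.Icc 0 (0 + 1)) := by
    rw [zero_add]; exact (c1.add c2).div_const 2
  have hGp : G 0 = G (0 + 1) := by simp [hG]; ring
  have : Fact (0 < (1 : ℝ)) := ⟨one_pos⟩
  set f : C(AddCircle (1 : ℝ), ℂ) :=
    ⟨AddCircle.liftIco 1 0 G, AddCircle.liftIco_continuous hGp cG⟩ with hf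
  have hcoef : ∀ n : ℤ, fourierCoeff f n = ∫ x in (k : ℝ)..(k + 1), ecos (n * x) * g x := by
    intro n
    have e0 : fourierCoeff f n = ∫ x in (0 : ℝ)..1, e (-(n * x)) * G x := by
      change fourierCoeff (AddCircle.liftIco 1 0 G) n = _
      rw [fourierCoeff_liftIco_eq, fourierCoeffOn_eq_integral]
      simp only [zero_add, sub_zero, div_one, one_smul, smul_eq_mul]
      refine intervalIntegral.integral_congr fun x _ => ?_
      have : (fourier (-n) (x : AddCircle ((0 : ℝ) + 1 - 0)) : ℂ) = e (-(n * x)) := by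
        rw [fourier_coe_apply, e]
        congr 1
        push_cast; ring
      simp only [this]
    have hu : Set.uIcc (0 : ℝ) 1 = Set.Icc 0 1 := Set.uIcc_of_le zero_le_one
    have ce : ∀ c : ℝ, Continuous fun x : ℝ => e (c * x) := fun c =>
      continuous_e.comp (by fun_prop)
    have i1 : IntervalIntegrable (fun x : ℝ => e (-(n * x)) * g (k + x)) volume 0 1 :=
      ContinuousOn.intervalIntegrable (by
        rw [hu]
        exact (continuous_e.comp (by fun_prop : Continuous fun x : ℝ => -(n * x))).continuousOn.mul c1)
    have i2 : IntervalIntegrable (fun x : ℝ => e (-(n * x)) * g (k + 1 - x)) volume 0 1 :=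
      ContinuousOn.intervalIntegrable (by
        rw [hu]
        exact (continuous_e.comp (by fun_prop : Continuous fun x : ℝ => -(n * x))).continuousOn.mul c2)
    have i3 : IntervalIntegrable (fun x : ℝ => e (n * x) * g (k + x)) volume 0 1 :=
      ContinuousOn.intervalIntegrable (by
        rw [hu]
        exact (continuous_e.comp (by fun_prop : Continuous fun x : ℝ => n * x)).continuousOn.mul c1)
    have e1 : ∫ x in (0 : ℝ)..1, e (-(n * x)) * g (k + 1 - x) =
        ∫ x in (0 : ℝ)..1, e (n * x) * g (k + x) := by
      have := intervalIntegral.integral_comp_sub_left (a := 0) (b := 1)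
        (fun x : ℝ => e (n * x) * g (k + x)) 1
      rw [sub_self, sub_zero] at this
      rw [← this]
      refine intervalIntegral.integral_congr fun x _ => ?_
      rw [show (n : ℝ) * (1 - x) = n + -(n * x) by ring, e_add, e_int, one_mul, add_sub_assoc]
    have e2 : ∫ x in (0 : ℝ)..1, e (-(n * x)) * G x =
        ∫ x in (0 : ℝ)..1, ecos (n * x) * g (k + x) := by
      calc _ = ∫ x in (0 : ℝ)..1, (1 / 2 : ℂ) * (e (-(n * x)) * g (k + x) +
            e (-(n * x)) * g (k + 1 - x)) :=
            intervalIntegral.integral_congr fun x _ => by simp only [hG]; ring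
        _ = (1 / 2 : ℂ) * (∫ x in (0 : ℝ)..1, (e (-(n * x)) * g (k + x) +
            e (n * x) * g (k + x))) := by
            rw [intervalIntegral.integral_const_mul, intervalIntegral.integral_add i1 i2, e1,
              ← intervalIntegral.integral_add i1 i3]
        _ = _ := by
            rw [← intervalIntegral.integral_const_mul]
            exact intervalIntegral.integral_congr fun x _ => by simp only [ecos]; ring
    rw [e0, e2]
    have := intervalIntegral.integral_comp_add_left (a := 0) (b := 1)
      (fun x : ℝ => ecos (n * x) * g x) k
    rw [add_zero] at this
    rw [← this]
    refine intervalIntegral.integral_congr fun x _ => ?_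
    have h1 : e (n * (k + x)) = e (n * x) := by
      rw [mul_add, e_add, show (n : ℝ) * k = ((n * k : ℤ) : ℝ) by push_cast; ring, e_int, one_mul]
    have h2 : e (-(n * (k + x))) = e (-(n * x)) := by
      rw [e_neg, e_neg, h1]
    simp only [ecos, h1, h2]
  have hsum : Summable (fourierCoeff f) := by
    refine hs.congr fun n => (hcoef n).symm
  have key := has_pointwise_sum_fourier_series_of_summable hsum (0 : AddCircle (1 : ℝ))
  have hf0 : f 0 = (g k + g (k + 1)) / 2 := by
    have : AddCircle.liftIco (1 : ℝ) 0 G ((0 : ℝ) : AddCircle (1 : ℝ)) = G 0 :=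
      AddCircle.liftIco_zero_coe_apply ⟨le_rfl, one_pos⟩
    change AddCircle.liftIco (1 : ℝ) 0 G ((0 : ℝ) : AddCircle (1 : ℝ)) = _
    rw [this]; simp [hG]
  rw [hf0] at key
  convert key using 2 with n
  rw [hcoef, fourier_eval_zero, smul_eq_mul, mul_one]

section Poisson

variable {f f' f'' : ℝ → ℝ} {D : ℝ}

lemma norm_integral_ecos_mul_e_le {a b : ℕ} (hab : a ≤ b)
    (hf : ∀ x ∈ Set.Icc (a : ℝ) b, HasDerivAt f (f' x) x)
    (hf' : ∀ x ∈ Set.Icc (a : ℝ) b, HasDerivAt f' (f'' x) x)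
    (cf : ContinuousOn f'' (Set.Icc (a : ℝ) b)) (sgn : ∀ x ∈ Set.Icc (a : ℝ) b, f'' x ≤ 0)
    (h0 : ∀ x ∈ Set.Icc (a : ℝ) b, 0 ≤ f' x ∧ f' x ≤ D) (ν : ℕ) (hν : 1 ≤ ν) (hνD : 2 * D ≤ ν) :
    ‖∫ x in (a : ℝ)..b, ecos (ν * x) * e (f x)‖ ≤ 2 * D / ν ^ 2 := by
  have hab' : (a : ℝ) ≤ b := by exact_mod_cast hab
  have hν0 : (0 : ℝ) < ν := by exact_mod_cast hν
  have hD0 : 0 ≤ D := (h0 a ⟨le_rfl, hab'⟩).1.trans (h0 a ⟨le_rfl, hab'⟩).2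
  have hu : Set.uIcc (a : ℝ) b = Set.Icc (a : ℝ) b := Set.uIcc_of_le hab'
  have cf' : ContinuousOn f' (Set.Icc (a : ℝ) b) := fun x hx =>
    (hf' x hx).continuousAt.continuousWithinAt
  have cff : ContinuousOn f (Set.Icc (a : ℝ) b) := fun x hx =>
    (hf x hx).continuousAt.continuousWithinAt
  have cef : ContinuousOn (fun x => e (f x)) (Set.Icc (a : ℝ) b) :=
    continuous_e.comp_continuousOn cff
  -- the integrals `∫ f' e(f + s x)` for `s = ± ν`
  have hosc : ∀ s : ℝ, (s = ν ∨ s = -ν) →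
      ‖∫ x in (a : ℝ)..b, (f' x : ℂ) * e (f x + s * x)‖ ≤ 4 * D / ν / π := by
    intro s hs
    have hlow : ∀ x ∈ Set.Icc (a : ℝ) b, (ν : ℝ) / 2 ≤ |f' x + s| := by
      intro x hx
      obtain ⟨p1, p2⟩ := h0 x hx
      rcases hs with rfl | rfl
      · rw [abs_of_nonneg (by linarith)]; linarith
      · rw [abs_of_nonpos (by linarith)]; linarith
    have hne : ∀ x ∈ Set.Icc (a : ℝ) b, f' x + s ≠ 0 := fun x hx =>
      abs_pos.1 (lt_of_lt_of_le (by positivity) (hlow x hx))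
    have cfs : ContinuousOn (fun x => f' x + s) (Set.Icc (a : ℝ) b) := cf'.add continuousOn_const
    have key := norm_integral_mul_deriv_mul_e_le (G := fun x => f' x / (f' x + s))
      (G' := fun x => s * f'' x / (f' x + s) ^ 2) (h := fun x => f x + s * x)
      (h' := fun x => f' x + s) hab'
      (fun x hx => by
        refine ((hf' x hx).div ((hf' x hx).add_const s) (hne x hx)).congr_deriv ?_
        congr 1; ring)
      (fun x hx => by
        refine ((hf x hx).add ((hasDerivAt_id x).const_mul s)).congr_deriv ?_
        ring)
      ((continuousOn_const.mul cf).div (cfs.pow 2) fun x hx => pow_ne_zero 2 (hne x hx)) cfs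
      (by
        rcases hs with rfl | rfl
        · exact Or.inr fun x hx => div_nonpos_of_nonpos_of_nonneg
            (mul_nonpos_of_nonneg_of_nonpos hν0.le (sgn x hx)) (sq_nonneg _)
        · exact Or.inl fun x hx => div_nonneg
            (mul_nonneg_of_nonpos_of_nonpos (by linarith) (sgn x hx)) (sq_nonneg _))
    have e1 : ∫ x in (a : ℝ)..b, ((f' x / (f' x + s) * (f' x + s) : ℝ) : ℂ) * e (f x + s * x) =
        ∫ x in (a : ℝ)..b, (f' x : ℂ) * e (f x + s * x) :=
      intervalIntegral.integral_congr fun x hx => by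
        rw [div_mul_cancel₀ _ (hne x (hu ▸ hx))]
    rw [e1] at key
    refine key.trans ?_
    have hb : ∀ x ∈ Set.Icc (a : ℝ) b, |f' x / (f' x + s)| ≤ 2 * D / ν := by
      intro x hx
      rw [abs_div, abs_of_nonneg (h0 x hx).1]
      calc f' x / |f' x + s| ≤ D / (ν / 2) := by
            have := h0 x hx
            have := hlow x hx
            gcongr
            · exact (h0 x hx).2
        _ = 2 * D / ν := by field_simp
    have := Real.pi_pos
    gcongr
    have b1 := hb a ⟨le_rfl, hab'⟩
    have b2 := hb b ⟨hab', le_rfl⟩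
    calc _ ≤ 2 * D / ν + 2 * D / ν := add_le_add b1 b2
      _ = _ := by ring
  have hsinder : ∀ x : ℝ, HasDerivAt (fun x : ℝ => (e (ν * x) - e (-(ν * x))) / (4 * π * I * ν))
      (ecos (ν * x)) x := by
    intro x
    have d1 := HasDerivAt.e ((hasDerivAt_id x).const_mul (ν : ℝ))
    have d2 := HasDerivAt.e ((hasDerivAt_id x).const_mul (ν : ℝ)).neg
    refine ((d1.sub d2).div_const _).congr_deriv ?_
    have : (π : ℂ) ≠ 0 := by exact_mod_cast Real.pi_ne_zero
    have : (ν : ℂ) ≠ 0 := by exact_mod_cast hν0.ne'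
    have := Complex.I_ne_zero
    simp only [ecos, id, Pi.neg_apply]
    push_cast
    field_simp
    ring
  have hzero : ∀ n : ℕ, (e (ν * n) - e (-(ν * n))) = 0 := by
    intro n
    have h1 : e (ν * n) = 1 := by rw [show (ν : ℝ) * n = (ν * n : ℕ) by push_cast; ring, e_nat]
    rw [e_neg, h1]; simp
  have ibp := intervalIntegral.integral_mul_deriv_eq_deriv_mul (a := (a : ℝ)) (b := b)
    (u := fun x => e (f x)) (v := fun x => (e (ν * x) - e (-(ν * x))) / (4 * π * I * ν))
    (u' := fun x => 2 * π * I * (f' x * e (f x))) (v' := fun x => ecos (ν * x))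
    (fun x hx => HasDerivAt.e (hf x (hu ▸ hx))) (fun x _ => hsinder x)
    (ContinuousOn.intervalIntegrable (hu ▸ continuousOn_const.mul
      ((Complex.continuous_ofReal.comp_continuousOn cf').mul cef)))
    (Continuous.intervalIntegrable (continuous_ecos.comp (by fun_prop)) _ _)
  rw [hzero, hzero, zero_div, mul_zero, mul_zero, sub_zero, zero_sub] at ibp
  have hi : ∀ s : ℝ, IntervalIntegrable (fun x => (f' x : ℂ) * e (f x + s * x)) volume a b := by
    intro s
    refine ContinuousOn.intervalIntegrable (hu ▸
      (Complex.continuous_ofReal.comp_continuousOn cf').mul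
        (continuous_e.comp_continuousOn (cff.add (by fun_prop))))
  have e2 : ∫ x in (a : ℝ)..b, ecos (ν * x) * e (f x) = -((1 / (2 * ν) : ℂ) *
      ((∫ x in (a : ℝ)..b, (f' x : ℂ) * e (f x + ν * x)) -
        ∫ x in (a : ℝ)..b, (f' x : ℂ) * e (f x + (-ν) * x))) := by
    rw [← intervalIntegral.integral_sub (hi _) (hi _), ← intervalIntegral.integral_const_mul]
    calc _ = ∫ x in (a : ℝ)..b, e (f x) * ecos (ν * x) :=
          intervalIntegral.integral_congr fun x _ => mul_comm _ _
      _ = _ := by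
          rw [ibp]
          congr 1
          refine intervalIntegral.integral_congr fun x _ => ?_
          have : (π : ℂ) ≠ 0 := by exact_mod_cast Real.pi_ne_zero
          have : (ν : ℂ) ≠ 0 := by exact_mod_cast hν0.ne'
          have := Complex.I_ne_zero
          rw [e_add, e_add, neg_mul]
          field_simp
          ring
  rw [e2, norm_neg, norm_mul]
  have e3 : ‖(1 / (2 * ν) : ℂ)‖ = 1 / (2 * ν) := by simp
  rw [e3]
  calc _ ≤ 1 / (2 * (ν : ℝ)) * (4 * D / ν / π + 4 * D / ν / π) := by
        refine mul_le_mul_of_nonneg_left ?_ (by positivity)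
        exact (norm_sub_le _ _).trans (add_le_add (hosc _ (Or.inl rfl)) (hosc _ (Or.inr rfl)))
    _ = 2 * D / ν ^ 2 * (2 / π) := by field_simp; ring
    _ ≤ 2 * D / ν ^ 2 := by
        refine mul_le_of_le_one_right (by positivity) ?_
        rw [div_le_one Real.pi_pos]; linarith [Real.pi_gt_three]

end Poisson

lemma sum_Icc_eq_trapezoid (g : ℕ → ℂ) {a b : ℕ} (hab : a ≤ b) :
    ∑ n ∈ Icc a b, g n = ∑ k ∈ Ico a b, (g k + g (k + 1)) / 2 + (g a + g b) / 2 := by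
  induction b, hab using Nat.le_induction with
  | base => simp
  | succ b hab ih =>
    rw [sum_Icc_succ_top (by omega), ih, sum_Ico_succ_top hab]
    ring

lemma sum_Icc_inv_le (κ : ℕ) : ∑ n ∈ Icc 1 κ, 1 / (n : ℝ) ≤ 1 + Real.log κ := by
  have := harmonic_le_one_add_log κ
  rw [harmonic_eq_sum_Icc] at this
  push_cast at this
  simpa using this

section Poisson

variable {f f' f'' : ℝ → ℝ} {D d₀ : ℝ}

/-- A truncated Poisson summation formula for exponential sums. -/
lemma truncated_poisson {a b : ℕ} (hab : a ≤ b)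
    (hf : ∀ x ∈ Set.Icc (a : ℝ) b, HasDerivAt f (f' x) x)
    (hf' : ∀ x ∈ Set.Icc (a : ℝ) b, HasDerivAt f' (f'' x) x)
    (cf : ContinuousOn f'' (Set.Icc (a : ℝ) b)) (sgn : ∀ x ∈ Set.Icc (a : ℝ) b, f'' x ≤ 0)
    (hd : 0 < d₀) (h0 : ∀ x ∈ Set.Icc (a : ℝ) b, d₀ ≤ f' x ∧ f' x ≤ D) {κ : ℕ} (hκ : 1 ≤ κ)
    (hκD : 2 * D ≤ κ) :
    ‖∑ n ∈ Icc a b, e (f n) - ∑ ν ∈ Icc 1 κ, ∫ x in (a : ℝ)..b, e (f x - ν * x)‖ ≤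
      4 + 1 / d₀ + Real.log κ := by
  have hab' : (a : ℝ) ≤ b := by exact_mod_cast hab
  have hκ0 : (0 : ℝ) < κ := by exact_mod_cast hκ
  have hu : Set.uIcc (a : ℝ) b = Set.Icc (a : ℝ) b := Set.uIcc_of_le hab'
  have hD0 : 0 ≤ D := by have := h0 a ⟨le_rfl, hab'⟩; linarith
  have cff : ContinuousOn f (Set.Icc (a : ℝ) b) := fun x hx =>
    (hf x hx).continuousAt.continuousWithinAt
  have cef : ContinuousOn (fun x => e (f x)) (Set.Icc (a : ℝ) b) :=
    continuous_e.comp_continuousOn cff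
  have hcint : ∀ c : ℝ, ContinuousOn (fun x => ecos (c * x) * e (f x)) (Set.Icc (a : ℝ) b) :=
    fun c => (continuous_ecos.comp (by fun_prop : Continuous fun x : ℝ => c * x)).continuousOn.mul
      cef
  set J : ℕ → ℂ := fun n => ∫ x in (a : ℝ)..b, ecos (n * x) * e (f x) with hJ
  have hJb : ∀ n : ℕ, 1 ≤ n → 2 * D ≤ n → ‖J n‖ ≤ 2 * D / n ^ 2 := fun n h1 h2 =>
    norm_integral_ecos_mul_e_le hab hf hf' cf sgn
      (fun x hx => ⟨hd.le.trans (h0 x hx).1, (h0 x hx).2⟩) n h1 h2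
  have hsub : ∀ k ∈ Ico a b, Set.Icc (k : ℝ) (k + 1) ⊆ Set.Icc (a : ℝ) b := by
    intro k hk
    rw [mem_Ico] at hk
    have h1 : (a : ℝ) ≤ k := by exact_mod_cast hk.1
    have h2 : (k : ℝ) + 1 ≤ b := by exact_mod_cast hk.2
    exact Set.Icc_subset_Icc h1 h2
  have hunit : ∀ k ∈ Ico a b, HasSum
      (fun n : ℤ => ∫ x in (k : ℝ)..(k + 1), ecos (n * x) * e (f x))
      ((e (f k) + e (f (k + 1 : ℕ))) / 2) := by
    intro k hk
    have hs := hsub k hk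
    push_cast
    refine hasSum_ecos_unit (g := fun x => e (f x)) k (cef.mono hs) ?_
    have hnat : Summable fun n : ℕ => ∫ x in (k : ℝ)..(k + 1), ecos ((n : ℝ) * x) * e (f x) := by
      refine Summable.of_norm_bounded_eventually_nat (g := fun n : ℕ => 2 * D * (1 / (n : ℝ) ^ 2))
        ((Real.summable_one_div_nat_pow.2 one_lt_two).mul_left _) ?_
      filter_upwards [eventually_ge_atTop (max 1 ⌈2 * D⌉₊)] with n hn
      have h2 : 2 * D ≤ n := (Nat.le_ceil _).trans (by exact_mod_cast (le_max_right _ _).trans hn)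
      have hs' : Set.Icc (k : ℝ) ((k + 1 : ℕ) : ℝ) ⊆ Set.Icc (a : ℝ) b := by
        push_cast; exact hs
      have := norm_integral_ecos_mul_e_le (a := k) (b := k + 1) (Nat.le_succ k)
        (fun x hx => hf x (hs' hx)) (fun x hx => hf' x (hs' hx)) (cf.mono hs')
        (fun x hx => sgn x (hs' hx))
        (fun x hx => ⟨hd.le.trans (h0 x (hs' hx)).1, (h0 x (hs' hx)).2⟩) n
        ((le_max_left _ _).trans hn) h2
      push_cast at this
      rwa [mul_one_div]
    refine Summable.of_nat_of_neg (by simpa using hnat) ?_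
    refine hnat.congr fun n => ?_
    refine intervalIntegral.integral_congr fun x _ => ?_
    push_cast
    rw [neg_mul, ecos_neg]
  have hsum := hasSum_sum hunit
  have hJint : ∀ n : ℤ, ∑ k ∈ Ico a b, ∫ x in (k : ℝ)..(k + 1), ecos (n * x) * e (f x) =
      ∫ x in (a : ℝ)..b, ecos (n * x) * e (f x) := by
    intro n
    have := intervalIntegral.sum_integral_adjacent_intervals_Ico (a := fun k : ℕ => (k : ℝ))
      (f := fun x => ecos (n * x) * e (f x)) (μ := volume) hab (fun k hk => by
        have hk' : k ∈ Ico a b := mem_Ico.2 hk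
        refine ContinuousOn.intervalIntegrable ?_
        push_cast
        rw [Set.uIcc_of_le (by linarith)]
        exact (hcint n).mono (hsub k hk'))
    push_cast at this
    exact this
  simp_rw [hJint] at hsum
  set T := ∑ k ∈ Ico a b, (e (f k) + e (f (k + 1 : ℕ))) / 2 with hT
  have hnat := hsum.nat_add_neg
  have hnat' : HasSum (fun n : ℕ => 2 * J n) (T + J 0) := by
    convert hnat using 2 with n
    · rw [two_mul]
      congr 1
      refine intervalIntegral.integral_congr fun x _ => ?_
      push_cast
      rw [neg_mul, ecos_neg]
    · simp [hJ]
  have htail : ‖T + J 0 - ∑ n ∈ range (κ + 1), 2 * J n‖ ≤ 2 := by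
    have ht := (hnat'.tendsto_sum_nat.sub_const (∑ n ∈ range (κ + 1), 2 * J n)).norm
    refine le_of_tendsto ht ?_
    filter_upwards [eventually_ge_atTop (κ + 1)] with N hN
    rw [← sum_Ico_eq_sub _ hN]
    refine (norm_sum_le _ _).trans ?_
    have h1 : ∀ n ∈ Ico (κ + 1) N, ‖2 * J n‖ ≤ 4 * D * ((n : ℝ) ^ 2)⁻¹ := by
      intro n hn
      rw [mem_Ico] at hn
      have : (κ : ℝ) ≤ n := by exact_mod_cast (by omega : κ ≤ n)
      rw [norm_mul]
      have h3 := hJb n (by omega) (hκD.trans this)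
      simp only [Complex.norm_ofNat]
      calc 2 * ‖J n‖ ≤ 2 * (2 * D / n ^ 2) := by gcongr
        _ = _ := by rw [← div_eq_mul_inv]; ring
    refine (sum_le_sum h1).trans ?_
    rw [← mul_sum]
    have h2 : ∑ n ∈ Ico (κ + 1) N, ((n : ℝ) ^ 2)⁻¹ ≤ (κ : ℝ)⁻¹ := by
      have h3 := sum_Ioc_inv_sq_le_sub (α := ℝ) (k := κ) (n := N) (by omega) (by omega)
      have h4 : Ico (κ + 1) N ⊆ Ioc κ N := fun n hn => by
        rw [mem_Ico] at hn; rw [mem_Ioc]; omega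
      have h5 : (0 : ℝ) ≤ (N : ℝ)⁻¹ := by positivity
      have h6 := sum_le_sum_of_subset_of_nonneg h4
        (fun (n : ℕ) _ _ => show (0 : ℝ) ≤ ((n : ℝ) ^ 2)⁻¹ by positivity)
      linarith
    calc _ ≤ 4 * D * (κ : ℝ)⁻¹ := by gcongr
      _ ≤ 2 := by rw [← div_eq_mul_inv, div_le_iff₀ hκ0]; linarith
  -- pieces with frequencies of the wrong sign
  have hplus : ∀ ν : ℕ, ∀ μ : ℝ, 0 < μ → (∀ x ∈ Set.Icc (a : ℝ) b, μ ≤ f' x + ν) →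
      ‖∫ x in (a : ℝ)..b, e (f x + ν * x)‖ ≤ 1 / μ := by
    intro ν μ hμ hle
    refine first_derivative_test (h := fun x => f x + ν * x) (h' := fun x => f' x + ν) hab' hμ
      (fun x hx => ?_) (fun x hx => (hf' x hx).add_const _) cf sgn
      (fun x hx => (hle x hx).trans (le_abs_self _))
    refine ((hf x hx).add ((hasDerivAt_id x).const_mul (ν : ℝ))).congr_deriv ?_
    ring
  have hJ0 : ‖J 0‖ ≤ 1 / d₀ := by
    have h1 := hplus 0 d₀ hd (fun x hx => by simpa using (h0 x hx).1)
    have h2 : J 0 = ∫ x in (a : ℝ)..b, e (f x + (0 : ℕ) * x) :=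
      intervalIntegral.integral_congr fun x _ => by simp [ecos, e_zero]
    rwa [h2]
  have hJn : ∀ n : ℕ, 2 * J n = (∫ x in (a : ℝ)..b, e (f x + n * x)) +
      ∫ x in (a : ℝ)..b, e (f x - n * x) := by
    intro n
    have i1 : IntervalIntegrable (fun x => e (f x + n * x)) volume a b :=
      ContinuousOn.intervalIntegrable (hu ▸
        continuous_e.comp_continuousOn (cff.add (by fun_prop)))
    have i2 : IntervalIntegrable (fun x => e (f x - n * x)) volume a b :=
      ContinuousOn.intervalIntegrable (hu ▸
        continuous_e.comp_continuousOn (cff.sub (by fun_prop)))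
    rw [← intervalIntegral.integral_add i1 i2, ← intervalIntegral.integral_const_mul]
    refine intervalIntegral.integral_congr fun x _ => ?_
    simp only [ecos]
    rw [e_add, sub_eq_add_neg, e_add]
    ring
  have hrange : ∑ n ∈ range (κ + 1), 2 * J n = 2 * J 0 + ∑ n ∈ Icc 1 κ, 2 * J n := by
    rw [sum_range_succ', add_comm, range_eq_Ico, sum_Ico_add' (fun n => 2 * J n) 0 κ 1]
    rfl
  have hpl : ‖∑ n ∈ Icc 1 κ, ∫ x in (a : ℝ)..b, e (f x + n * x)‖ ≤ 1 + Real.log κ := by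
    refine (norm_sum_le _ _).trans (le_trans (sum_le_sum fun n hn => ?_) (sum_Icc_inv_le κ))
    have hn1 : 1 ≤ n := (mem_Icc.1 hn).1
    exact hplus n n (by exact_mod_cast hn1) fun x hx => by linarith [(h0 x hx).1]
  have hfin : ∑ n ∈ Icc a b, e (f n) - ∑ ν ∈ Icc 1 κ, ∫ x in (a : ℝ)..b, e (f x - ν * x) =
      (T + J 0 - ∑ n ∈ range (κ + 1), 2 * J n) + J 0 +
        (∑ n ∈ Icc 1 κ, ∫ x in (a : ℝ)..b, e (f x + n * x)) + (e (f a) + e (f b)) / 2 := by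
    rw [hrange, sum_Icc_eq_trapezoid (fun n : ℕ => e (f n)) hab, sum_congr rfl fun n _ => hJn n,
      sum_add_distrib]
    ring
  have hend : ‖(e (f a) + e (f b)) / 2‖ ≤ 1 := by
    rw [norm_div, Complex.norm_ofNat, div_le_one two_pos]
    refine (norm_add_le _ _).trans ?_
    rw [norm_e, norm_e]; norm_num
  rw [hfin]
  calc _ ≤ 2 + 1 / d₀ + (1 + Real.log κ) + 1 :=
        (norm_add_le _ _).trans (add_le_add ((norm_add_le _ _).trans (add_le_add
          ((norm_add_le _ _).trans (add_le_add htail hJ0)) hpl)) hend)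
    _ = _ := by ring

end Poisson

/-- The normalised phase `v ^ δ - v` of the stationary phase integrals and its derivatives. -/
noncomputable def ph (δ v : ℝ) : ℝ := v ^ δ - v

noncomputable def ph' (δ v : ℝ) : ℝ := δ * v ^ (δ - 1) - 1

noncomputable def ph'' (δ v : ℝ) : ℝ := δ * ((δ - 1) * v ^ (δ - 2))

/-- The stationary point of `ph δ` and a neighbourhood `[lft δ, rgt δ]` of it. -/
noncomputable def stat (δ : ℝ) : ℝ := δ ^ (1 / (1 - δ))

noncomputable def lft (δ : ℝ) : ℝ := stat δ / 2

noncomputable def rgt (δ : ℝ) : ℝ := (stat δ + 1) / 2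

/-- Weight localising to the stationary point at scale `ω`. -/
noncomputable def wloc (δ ω v : ℝ) : ℝ := ω ^ 2 / (ph' δ v ^ 2 + ω ^ 2)

noncomputable def wreg (δ ω v : ℝ) : ℝ := ph' δ v / (ph' δ v ^ 2 + ω ^ 2)

noncomputable def wreg' (δ ω v : ℝ) : ℝ :=
  ph'' δ v * (ω ^ 2 - ph' δ v ^ 2) / (ph' δ v ^ 2 + ω ^ 2) ^ 2

/-- A common majorant for the weights. -/
noncomputable def wmaj (δ ω v : ℝ) : ℝ := -ph'' δ v / (ph' δ v ^ 2 + ω ^ 2)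

lemma stat_pos {δ : ℝ} (h0 : 0 < δ) : 0 < stat δ := Real.rpow_pos_of_pos h0 _

lemma stat_lt_one {δ : ℝ} (h0 : 0 < δ) (h1 : δ < 1) : stat δ < 1 :=
  Real.rpow_lt_one h0.le h1 (one_div_pos.2 (by linarith))

lemma lft_pos {δ : ℝ} (h0 : 0 < δ) : 0 < lft δ := half_pos (stat_pos h0)

lemma lft_lt_stat {δ : ℝ} (h0 : 0 < δ) : lft δ < stat δ := half_lt_self (stat_pos h0)

lemma stat_lt_rgt {δ : ℝ} (h0 : 0 < δ) (h1 : δ < 1) : stat δ < rgt δ := by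
  have := stat_lt_one h0 h1; unfold rgt; linarith

lemma rgt_lt_one {δ : ℝ} (h0 : 0 < δ) (h1 : δ < 1) : rgt δ < 1 := by
  have := stat_lt_one h0 h1; unfold rgt; linarith

lemma lft_lt_rgt {δ : ℝ} (h0 : 0 < δ) (h1 : δ < 1) :
    lft δ < rgt δ := (lft_lt_stat h0).trans (stat_lt_rgt h0 h1)

lemma ph'_strictAnti {δ : ℝ} (h0 : 0 < δ) (h1 : δ < 1) {v w : ℝ} (hv : 0 < v) (hvw : v < w) :
    ph' δ w < ph' δ v := by
  have := Real.rpow_lt_rpow_of_neg hv hvw (show δ - 1 < 0 by linarith)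
  unfold ph'
  nlinarith

lemma ph'_anti {δ : ℝ} (h0 : 0 < δ) (h1 : δ < 1) {v w : ℝ} (hv : 0 < v) (hvw : v ≤ w) :
    ph' δ w ≤ ph' δ v := by
  rcases hvw.eq_or_lt with rfl | h
  · rfl
  · exact (ph'_strictAnti h0 h1 hv h).le

lemma ph'_stat {δ : ℝ} (h0 : 0 < δ) (h1 : δ < 1) : ph' δ (stat δ) = 0 := by
  unfold ph' stat
  rw [← Real.rpow_mul h0.le, show 1 / (1 - δ) * (δ - 1) = -1 by
    rw [div_mul_eq_mul_div, div_eq_iff (by linarith)]; ring, Real.rpow_neg_one,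
    mul_inv_cancel₀ h0.ne', sub_self]

lemma ph'_lft_pos {δ : ℝ} (h0 : 0 < δ) (h1 : δ < 1) : 0 < ph' δ (lft δ) := by
  rw [← ph'_stat h0 h1]
  exact ph'_strictAnti h0 h1 (lft_pos h0) (lft_lt_stat h0)

lemma ph'_rgt_neg {δ : ℝ} (h0 : 0 < δ) (h1 : δ < 1) : ph' δ (rgt δ) < 0 := by
  rw [← ph'_stat h0 h1]
  exact ph'_strictAnti h0 h1 (stat_pos h0) (stat_lt_rgt h0 h1)

lemma ph''_neg {δ : ℝ} (h0 : 0 < δ) (h1 : δ < 1) {v : ℝ} (hv : 0 < v) : ph'' δ v < 0 :=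
  mul_neg_of_pos_of_neg h0 (mul_neg_of_neg_of_pos (by linarith) (Real.rpow_pos_of_pos hv _))

lemma le_neg_ph'' {δ : ℝ} (h0 : 0 < δ) (h1 : δ < 1) {v : ℝ} (hv : 0 < v) (hv1 : v ≤ 1) :
    δ * (1 - δ) ≤ -ph'' δ v := by
  have : 1 ≤ v ^ (δ - 2) := Real.one_le_rpow_of_pos_of_le_one_of_nonpos hv hv1 (by linarith)
  have h2 : 0 < δ * (1 - δ) := mul_pos h0 (by linarith)
  unfold ph''
  nlinarith

lemma ph_pos {δ : ℝ} (h1 : δ < 1) {v : ℝ} (hv : 0 < v) (hv1 : v < 1) : 0 < ph δ v := by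
  have := Real.rpow_lt_rpow_of_exponent_gt hv hv1 h1
  rw [Real.rpow_one] at this
  unfold ph; linarith

lemma hasDerivAt_ph (δ : ℝ) {v : ℝ} (hv : 0 < v) : HasDerivAt (ph δ) (ph' δ v) v :=
  (Real.hasDerivAt_rpow_const (Or.inl hv.ne')).sub (hasDerivAt_id v)

lemma hasDerivAt_ph' (δ : ℝ) {v : ℝ} (hv : 0 < v) : HasDerivAt (ph' δ) (ph'' δ v) v := by
  have := ((Real.hasDerivAt_rpow_const (p := δ - 1) (Or.inl hv.ne')).const_mul δ).sub_const 1
  rwa [sub_sub, show (1 : ℝ) + 1 = 2 by norm_num] at this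

lemma continuousOn_ph'' (δ : ℝ) {s : Set ℝ} (hs : ∀ v ∈ s, 0 < v) : ContinuousOn (ph'' δ) s := by
  refine continuousOn_const.mul (continuousOn_const.mul ?_)
  exact continuousOn_id.rpow_const fun v hv => Or.inl (hs v hv).ne'

lemma continuousOn_ph' (δ : ℝ) {s : Set ℝ} (hs : ∀ v ∈ s, 0 < v) : ContinuousOn (ph' δ) s :=
  fun v hv => (hasDerivAt_ph' δ (hs v hv)).continuousAt.continuousWithinAt

lemma continuousOn_ph (δ : ℝ) {s : Set ℝ} (hs : ∀ v ∈ s, 0 < v) : ContinuousOn (ph δ) s :=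
  fun v hv => (hasDerivAt_ph δ (hs v hv)).continuousAt.continuousWithinAt

lemma wden_pos {δ ω : ℝ} (hω : 0 < ω) (v : ℝ) : 0 < ph' δ v ^ 2 + ω ^ 2 := by positivity

lemma hasDerivAt_wreg {δ ω : ℝ} (hω : 0 < ω) {v : ℝ} (hv : 0 < v) :
    HasDerivAt (wreg δ ω) (wreg' δ ω v) v := by
  have h := hasDerivAt_ph' δ hv
  refine (h.div ((h.pow 2).add_const (ω ^ 2)) (wden_pos hω v).ne').congr_deriv ?_
  unfold wreg'
  congr 1
  simp only [Pi.pow_apply]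
  push_cast
  ring

lemma continuousOn_wreg' {δ ω : ℝ} (hω : 0 < ω) {s : Set ℝ} (hs : ∀ v ∈ s, 0 < v) :
    ContinuousOn (wreg' δ ω) s := by
  have h1 := continuousOn_ph' δ hs
  exact ((continuousOn_ph'' δ hs).mul (continuousOn_const.sub (h1.pow 2))).div
    (((h1.pow 2).add continuousOn_const).pow 2) fun v _ => pow_ne_zero 2 (wden_pos hω v).ne'

lemma continuousOn_wloc {δ ω : ℝ} (hω : 0 < ω) {s : Set ℝ} (hs : ∀ v ∈ s, 0 < v) :
    ContinuousOn (wloc δ ω) s :=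
  continuousOn_const.div (((continuousOn_ph' δ hs).pow 2).add continuousOn_const)
    fun v _ => (wden_pos hω v).ne'

lemma continuousOn_wmaj {δ ω : ℝ} (hω : 0 < ω) {s : Set ℝ} (hs : ∀ v ∈ s, 0 < v) :
    ContinuousOn (wmaj δ ω) s :=
  (continuousOn_ph'' δ hs).neg.div (((continuousOn_ph' δ hs).pow 2).add continuousOn_const)
    fun v _ => (wden_pos hω v).ne'

lemma wreg_mul_add_wloc {δ ω : ℝ} (hω : 0 < ω) (v : ℝ) : wreg δ ω v * ph' δ v + wloc δ ω v = 1 := by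
  unfold wreg wloc
  rw [div_mul_eq_mul_div, ← add_div, div_eq_one_iff_eq (wden_pos hω v).ne']
  ring

lemma abs_wreg_le {δ ω : ℝ} (hω : 0 < ω) (v : ℝ) : |wreg δ ω v| ≤ 2 / (|ph' δ v| + ω) := by
  unfold wreg
  have hd := wden_pos (δ := δ) hω v
  rw [abs_div, abs_of_pos hd, div_le_div_iff₀ hd (by positivity)]
  nlinarith [sq_abs (ph' δ v), sq_nonneg (|ph' δ v| - ω), abs_nonneg (ph' δ v)]

lemma wloc_nonneg {δ ω : ℝ} (hω : 0 < ω) (v : ℝ) :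
    0 ≤ wloc δ ω v := div_nonneg (sq_nonneg _) (wden_pos hω v).le

lemma abs_wreg'_le {δ ω : ℝ} (hω : 0 < ω) (h0 : 0 < δ) (h1 : δ < 1) {v : ℝ} (hv : 0 < v) :
    |wreg' δ ω v| ≤ wmaj δ ω v := by
  have hd := wden_pos (δ := δ) hω v
  unfold wreg' wmaj
  rw [abs_div, abs_mul, abs_of_neg (ph''_neg h0 h1 hv), abs_of_pos (pow_pos hd 2),
    div_le_div_iff₀ (pow_pos hd 2) hd]
  have h2 : |ω ^ 2 - ph' δ v ^ 2| ≤ ph' δ v ^ 2 + ω ^ 2 := by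
    rw [abs_le]; constructor <;> nlinarith [sq_nonneg ω, sq_nonneg (ph' δ v)]
  have h3 := (ph''_neg h0 h1 hv)
  calc _ ≤ -ph'' δ v * (ph' δ v ^ 2 + ω ^ 2) * (ph' δ v ^ 2 + ω ^ 2) := by gcongr; linarith
    _ = _ := by ring

lemma wloc_le {δ ω : ℝ} (hω : 0 < ω) (h0 : 0 < δ) (h1 : δ < 1) {v : ℝ} (hv : 0 < v) (hv1 : v ≤ 1) :
    wloc δ ω v ≤ ω ^ 2 / (δ * (1 - δ)) * wmaj δ ω v := by
  have hd := wden_pos (δ := δ) hω v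
  have hc : 0 < δ * (1 - δ) := mul_pos h0 (by linarith)
  unfold wloc wmaj
  rw [div_mul_div_comm, div_le_div_iff₀ hd (by positivity)]
  have := le_neg_ph'' h0 h1 hv hv1
  have h5 : ω ^ 2 * (δ * (1 - δ)) ≤ ω ^ 2 * -ph'' δ v := by gcongr
  nlinarith

lemma wmaj_nonneg {δ ω : ℝ} (hω : 0 < ω) (h0 : 0 < δ) (h1 : δ < 1) {v : ℝ} (hv : 0 < v) :
    0 ≤ wmaj δ ω v :=
  (abs_nonneg _).trans (abs_wreg'_le hω h0 h1 hv)

lemma integral_wmaj_le {δ ω : ℝ} (hω : 0 < ω) (h0 : 0 < δ) (h1 : δ < 1) :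
    ∫ v in lft δ..rgt δ, wmaj δ ω v ≤ π / ω := by
  have hlr := (lft_lt_rgt h0 h1).le
  have hpos : ∀ v ∈ Set.Icc (lft δ) (rgt δ), 0 < v := fun v hv => (lft_pos h0).trans_le hv.1
  have hu : Set.uIcc (lft δ) (rgt δ) = Set.Icc (lft δ) (rgt δ) := Set.uIcc_of_le hlr
  have key := intervalIntegral.integral_eq_sub_of_hasDerivAt (a := lft δ) (b := rgt δ)
    (f := fun v => -Real.arctan (ph' δ v / ω) / ω) (f' := wmaj δ ω)
    (fun v hv => by
      have hv' := hpos v (hu ▸ hv)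
      refine ((((hasDerivAt_ph' δ hv').div_const ω).arctan).neg.div_const ω).congr_deriv ?_
      unfold wmaj
      have := (wden_pos (δ := δ) hω v).ne'
      have h3 : 1 + (ph' δ v / ω) ^ 2 = (ph' δ v ^ 2 + ω ^ 2) / ω ^ 2 := by
        field_simp; ring
      rw [h3]
      field_simp)
    (ContinuousOn.intervalIntegrable (hu ▸ continuousOn_wmaj hω hpos))
  rw [key, ← sub_div]
  gcongr
  have a1 := Real.neg_pi_div_two_lt_arctan (ph' δ (rgt δ) / ω)
  have a2 := Real.arctan_lt_pi_div_two (ph' δ (lft δ) / ω)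
  linarith

lemma integral_ite_Ioc {l r A B : ℝ} (hlr : l ≤ r) (G : ℝ → ℂ) :
    ∫ v in l..r, (if A < v ∧ v ≤ B then G v else 0) =
      ∫ v in max A (min B l)..max A (min B r), G v := by
  have hpq : max A (min B l) ≤ max A (min B r) := by gcongr
  rw [intervalIntegral.integral_of_le hlr, intervalIntegral.integral_of_le hpq]
  have h1 : ∀ v, (if A < v ∧ v ≤ B then G v else 0) = (Set.Ioc A B).indicator G v := fun v => by
    simp [Set.indicator_apply]
  simp_rw [h1]
  rw [setIntegral_indicator measurableSet_Ioc]
  congr 2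
  ext v
  simp only [Set.mem_inter_iff, Set.mem_Ioc, max_lt_iff, min_lt_iff, le_max_iff, le_min_iff]
  grind

lemma max_min_endpoints {A B l r : ℝ} (h : max A (min B l) < max A (min B r)) :
    (max A (min B l) = A ∨ max A (min B l) = l) ∧ (max A (min B r) = B ∨ max A (min B r) = r) := by
  have := max_choice A (min B l)
  have := max_choice A (min B r)
  have := min_choice B l
  have := min_choice B r
  have := min_le_left B l
  have := min_le_left B r
  have := min_le_right B l
  have := le_max_left A (min B l)
  have := le_max_right A (min B l)
  grind only

/-- The integrand to which the stationary phase integral is reduced. -/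
noncomputable def wgt (δ ω l v : ℝ) : ℂ := wloc δ ω v - wreg' δ ω v / (2 * π * I * l)

lemma norm_integral_sub_wgt_le {δ ω l p q : ℝ} (hω : 0 < ω) (hl : 0 < l) (hp : 0 < p)
    (hpq : p ≤ q) :
    ‖(∫ v in p..q, e (l * ph δ v)) - ∫ v in p..q, wgt δ ω l v * e (l * ph δ v)‖ ≤
      (|wreg δ ω p| + |wreg δ ω q|) / l := by
  have hpos : ∀ v ∈ Set.Icc p q, 0 < v := fun v hv => hp.trans_le hv.1
  have hu : Set.uIcc p q = Set.Icc p q := Set.uIcc_of_le hpq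
  have key := integral_mul_deriv_mul_e (a := p) (b := q) (G := wreg δ ω) (G' := wreg' δ ω)
    (h := fun v => l * ph δ v) (h' := fun v => l * ph' δ v) hpq
    (fun x hx => hasDerivAt_wreg hω (hpos x hx))
    (fun x hx => (hasDerivAt_ph δ (hpos x hx)).const_mul l)
    (continuousOn_wreg' hω hpos) (continuousOn_const.mul (continuousOn_ph' δ hpos))
  have ce : ContinuousOn (fun v => e (l * ph δ v)) (Set.Icc p q) :=
    continuous_e.comp_continuousOn (continuousOn_const.mul (continuousOn_ph δ hpos))
  have cw := continuousOn_wreg' (δ := δ) hω hpos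
  have cl := continuousOn_wloc (δ := δ) hω hpos
  have cr : ContinuousOn (wreg δ ω) (Set.Icc p q) := fun x hx =>
    (hasDerivAt_wreg hω (hpos x hx)).continuousAt.continuousWithinAt
  have cp := continuousOn_ph' δ hpos
  have hlc : (l : ℂ) ≠ 0 := by exact_mod_cast hl.ne'
  have i1 : IntervalIntegrable (fun v => ((wreg δ ω v * (l * ph' δ v) : ℝ) : ℂ) * e (l * ph δ v))
      volume p q := by
    refine ContinuousOn.intervalIntegrable (hu ▸ ?_)
    fun_prop
  have i2 : IntervalIntegrable (fun v => (wreg' δ ω v : ℂ) * e (l * ph δ v)) volume p q := by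
    refine ContinuousOn.intervalIntegrable (hu ▸ ?_)
    fun_prop
  have i3 : IntervalIntegrable (fun v => e (l * ph δ v)) volume p q :=
    ContinuousOn.intervalIntegrable (hu ▸ ce)
  have i4 : IntervalIntegrable (fun v => wgt δ ω l v * e (l * ph δ v)) volume p q := by
    refine ContinuousOn.intervalIntegrable (hu ▸ ?_)
    unfold wgt
    fun_prop
  have e1 : 2 * π * I * l * ((∫ v in p..q, e (l * ph δ v)) -
      ∫ v in p..q, wgt δ ω l v * e (l * ph δ v)) =
      wreg δ ω q * e (l * ph δ q) - wreg δ ω p * e (l * ph δ p) := by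
    rw [eq_sub_iff_add_eq, ← intervalIntegral.integral_const_mul,
      ← intervalIntegral.integral_add (i1.const_mul _) i2] at key
    rw [← key, ← intervalIntegral.integral_sub i3 i4, ← intervalIntegral.integral_const_mul]
    refine intervalIntegral.integral_congr fun v _ => ?_
    have h1 : (wreg δ ω v * ph' δ v + wloc δ ω v : ℂ) = 1 := by
      exact_mod_cast wreg_mul_add_wloc (δ := δ) hω v
    have h2 : (wloc δ ω v : ℂ) = 1 - wreg δ ω v * ph' δ v := by rw [← h1]; ring
    simp only [wgt, h2]
    push_cast
    field_simp
    ring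
  have e2 := congrArg norm e1
  rw [norm_mul] at e2
  have e3 : ‖(wreg δ ω q * e (l * ph δ q) - wreg δ ω p * e (l * ph δ p) : ℂ)‖ ≤
      |wreg δ ω q| + |wreg δ ω p| := by
    refine (norm_sub_le _ _).trans ?_
    simp [norm_e]
  have e4 : ‖(2 * π * I * l : ℂ)‖ = 2 * π * l := by
    simp [abs_of_pos Real.pi_pos, abs_of_pos hl]
  rw [le_div_iff₀ hl]
  rw [e4] at e2
  have hpi := Real.pi_gt_three
  have hn := norm_nonneg ((∫ v in p..q, e (l * ph δ v)) -
      ∫ v in p..q, wgt δ ω l v * e (l * ph δ v))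
  nlinarith [mul_nonneg hn hl.le]

lemma norm_integral_sub_integral_wgt_le {δ : ℝ} (h0 : 0 < δ) (h1 : δ < 1) : ∃ C, 0 < C ∧
    ∀ ω l A B : ℝ, 0 < ω → 0 < l → 0 < A → A ≤ B →
    ‖(∫ v in A..B, e (l * ph δ v)) - ∫ v in lft δ..rgt δ,
        (if A < v ∧ v ≤ B then wgt δ ω l v * e (l * ph δ v) else 0)‖ ≤
      (C + 2 / (|ph' δ A| + ω) + 2 / (|ph' δ B| + ω)) / l := by
  have hL := ph'_lft_pos h0 h1
  have hR := ph'_rgt_neg h0 h1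
  have hlp := lft_pos h0
  have hlr := lft_lt_rgt h0 h1
  refine ⟨3 / |ph' δ (lft δ)| + 3 / |ph' δ (rgt δ)|,
    by have := abs_pos.2 hL.ne'; have := abs_pos.2 hR.ne; positivity, ?_⟩
  intro ω l A B hω hl hA hAB
  rw [integral_ite_Ioc hlr.le]
  set p := max A (min B (lft δ)) with hp
  set q := max A (min B (rgt δ)) with hq
  have hpq : p ≤ q := by rw [hp, hq]; gcongr
  have hAp : A ≤ p := le_max_left _ _
  have hqB : q ≤ B := max_le hAB (min_le_left _ _)
  have hpos : ∀ v ∈ Set.Icc A B, 0 < v := fun v hv => hA.trans_le hv.1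
  have ii : ∀ s t, A ≤ s → s ≤ t → t ≤ B →
      IntervalIntegrable (fun v => e (l * ph δ v)) volume s t := fun s t h1 h2 h3 => by
    refine ContinuousOn.intervalIntegrable (Set.uIcc_of_le h2 ▸ ?_)
    exact continuous_e.comp_continuousOn (continuousOn_const.mul
      (continuousOn_ph δ fun v hv => hA.trans_le (h1.trans hv.1)))
  have hsplit : ∫ v in A..B, e (l * ph δ v) = (∫ v in A..p, e (l * ph δ v)) +
      (∫ v in p..q, e (l * ph δ v)) + ∫ v in q..B, e (l * ph δ v) := by
    rw [intervalIntegral.integral_add_adjacent_intervals (ii A p le_rfl hAp (hpq.trans hqB))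
      (ii p q hAp hpq hqB), intervalIntegral.integral_add_adjacent_intervals
      (ii A q le_rfl (hAp.trans hpq) hqB) (ii q B (hAp.trans hpq) hqB le_rfl)]
  have fdt : ∀ s t μ, A ≤ s → s ≤ t → 0 < μ → (∀ x ∈ Set.Icc s t, μ ≤ |ph' δ x|) →
      ‖∫ v in s..t, e (l * ph δ v)‖ ≤ 1 / μ / l := fun s t μ hs hst hμ hle => by
    have hpos' : ∀ x ∈ Set.Icc s t, 0 < x := fun x hx => hA.trans_le (hs.trans hx.1)
    have := first_derivative_test (h := fun v => l * ph δ v) (h' := fun v => l * ph' δ v)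
      (h'' := fun v => l * ph'' δ v) hst (mul_pos hl hμ)
      (fun x hx => (hasDerivAt_ph δ (hpos' x hx)).const_mul l)
      (fun x hx => (hasDerivAt_ph' δ (hpos' x hx)).const_mul l)
      (continuousOn_const.mul (continuousOn_ph'' δ hpos'))
      (fun x hx => (mul_neg_of_pos_of_neg hl (ph''_neg h0 h1 (hpos' x hx))).le)
      (fun x hx => by rw [abs_mul, abs_of_pos hl]; gcongr; exact hle x hx)
    rwa [mul_comm, ← div_div] at this
  have b1 : ‖∫ v in A..p, e (l * ph δ v)‖ ≤ 1 / |ph' δ (lft δ)| / l := by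
    rcases hAp.eq_or_lt with h | h
    · rw [← h, intervalIntegral.integral_same, norm_zero]; positivity
    · have hpl : p ≤ lft δ := by
        rcases lt_max_iff.1 (hp ▸ h) with h | h
        · exact absurd h (lt_irrefl _)
        · rw [hp, max_eq_right h.le]; exact min_le_right _ _
      refine fdt A p _ le_rfl hAp (abs_pos.2 hL.ne') fun x hx => ?_
      rw [abs_of_pos hL]
      exact (ph'_anti h0 h1 (hA.trans_le hx.1) (hx.2.trans hpl)).trans (le_abs_self _)
  have b3 : ‖∫ v in q..B, e (l * ph δ v)‖ ≤ 1 / |ph' δ (rgt δ)| / l := by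
    rcases hqB.eq_or_lt with h | h
    · rw [h, intervalIntegral.integral_same, norm_zero]; positivity
    · have hqr : rgt δ ≤ q := by
        rw [hq, max_lt_iff, min_lt_iff] at h
        have : min B (rgt δ) = rgt δ := min_eq_right (by grind)
        rw [hq, this]; exact le_max_right _ _
      refine fdt q B _ (hAp.trans hpq) hqB (abs_pos.2 hR.ne) fun x hx => ?_
      rw [abs_of_neg hR]
      have := ph'_anti h0 h1 (hlp.trans hlr) (hqr.trans hx.1)
      exact (neg_le_neg this).trans (neg_le_abs _)
  have bw : ∀ u, ph' δ u ≠ 0 → |wreg δ ω u| ≤ 2 / |ph' δ u| := fun u hu => by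
    refine (abs_wreg_le hω u).trans ?_
    have := abs_pos.2 hu
    gcongr
    linarith
  have nn : ∀ u, 0 ≤ 2 / (|ph' δ u| + ω) := fun u => by positivity
  have b2 : ‖(∫ v in p..q, e (l * ph δ v)) - ∫ v in p..q, wgt δ ω l v * e (l * ph δ v)‖ ≤
      (2 / |ph' δ (lft δ)| + 2 / |ph' δ (rgt δ)| + 2 / (|ph' δ A| + ω) +
        2 / (|ph' δ B| + ω)) / l := by
    rcases hpq.eq_or_lt with h | h
    · rw [h, intervalIntegral.integral_same, intervalIntegral.integral_same, sub_zero, norm_zero]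
      have := nn A; have := nn B; positivity
    · refine (norm_integral_sub_wgt_le hω hl (hA.trans_le hAp) hpq).trans ?_
      obtain ⟨c1, c2⟩ := max_min_endpoints (hp ▸ hq ▸ h)
      rw [← hp] at c1
      rw [← hq] at c2
      have d1 : |wreg δ ω p| ≤ 2 / |ph' δ (lft δ)| + 2 / (|ph' δ A| + ω) := by
        rcases c1 with h | h <;> rw [h]
        · exact (abs_wreg_le hω A).trans (le_add_of_nonneg_left (by positivity))
        · exact (bw _ hL.ne').trans (le_add_of_nonneg_right (nn A))
      have d2 : |wreg δ ω q| ≤ 2 / |ph' δ (rgt δ)| + 2 / (|ph' δ B| + ω) := by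
        rcases c2 with h | h <;> rw [h]
        · exact (abs_wreg_le hω B).trans (le_add_of_nonneg_left (by positivity))
        · exact (bw _ hR.ne).trans (le_add_of_nonneg_right (nn B))
      exact (div_le_div_of_nonneg_right (add_le_add d1 d2) hl.le).trans (le_of_eq (by ring))
  rw [hsplit]
  set X := ∫ v in A..p, e (l * ph δ v)
  set Y := ∫ v in p..q, e (l * ph δ v)
  set Z' := ∫ v in q..B, e (l * ph δ v)
  set W := ∫ v in p..q, wgt δ ω l v * e (l * ph δ v)
  calc ‖X + Y + Z' - W‖ = ‖X + Z' + (Y - W)‖ := by congr 1; ring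
    _ ≤ ‖X‖ + ‖Z'‖ + ‖Y - W‖ := (norm_add_le _ _).trans (by gcongr; exact norm_add_le _ _)
    _ ≤ _ := add_le_add (add_le_add b1 b3) b2
    _ = _ := by ring

lemma separated_stationary_phase {δ : ℝ} (h0 : 0 < δ) (h1 : δ < 1) : ∃ C, 0 < C ∧
    ∀ y ν ρ a b ω : ℝ, 0 < y → 0 < ν → 0 < ρ → y * ρ ^ δ = ν * ρ → 0 < a → a ≤ b →
      0 < ω → ω ≤ 1 →
    ‖(∫ x in a..b, e (y * x ^ δ - ν * x)) - ∫ v in lft δ..rgt δ,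
        (if a < ρ * v ∧ ρ * v ≤ b then ρ * wgt δ ω (ν * ρ) v * e (ν * ρ * ph δ v) else 0)‖ ≤
      C * (1 / ν + 1 / (|y * (δ * a ^ (δ - 1)) - ν| + ω * (y * (δ * a ^ (δ - 1)))) +
        1 / (|y * (δ * b ^ (δ - 1)) - ν| + ω * (y * (δ * b ^ (δ - 1))))) := by
  obtain ⟨C, hC, hmain⟩ := norm_integral_sub_integral_wgt_le h0 h1
  refine ⟨C + 4, by positivity, ?_⟩
  intro y ν ρ a b ω hy hν hρ hρe ha hab hω hω1
  have hl : 0 < ν * ρ := mul_pos hν hρ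
  have key := hmain ω (ν * ρ) (a / ρ) (b / ρ) hω hl (by positivity) (by gcongr)
  have hu : Set.uIcc (a / ρ) (b / ρ) = Set.Icc (a / ρ) (b / ρ) := Set.uIcc_of_le (by gcongr)
  have e1 : ∫ x in a..b, e (y * x ^ δ - ν * x) =
      ρ * ∫ v in a / ρ..b / ρ, e (ν * ρ * ph δ v) := by
    have := intervalIntegral.smul_integral_comp_mul_left (a := a / ρ) (b := b / ρ)
      (fun x => e (y * x ^ δ - ν * x)) ρ
    rw [mul_div_cancel₀ _ hρ.ne', mul_div_cancel₀ _ hρ.ne'] at this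
    rw [← this, Complex.real_smul]
    congr 1
    refine intervalIntegral.integral_congr fun v hv => ?_
    have hv0 : 0 < v := (show 0 < a / ρ by positivity).trans_le (hu ▸ hv).1
    refine congrArg e ?_
    rw [Real.mul_rpow hρ.le hv0.le, ← mul_assoc, hρe]
    unfold ph; ring
  have e2 : ∫ v in lft δ..rgt δ,
        (if a < ρ * v ∧ ρ * v ≤ b then ρ * wgt δ ω (ν * ρ) v * e (ν * ρ * ph δ v) else 0) =
      ρ * ∫ v in lft δ..rgt δ, (if a / ρ < v ∧ v ≤ b / ρ then
        wgt δ ω (ν * ρ) v * e (ν * ρ * ph δ v) else 0) := by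
    rw [← intervalIntegral.integral_const_mul]
    refine intervalIntegral.integral_congr fun v _ => ?_
    simp only [div_lt_iff₀' hρ, le_div_iff₀' hρ, mul_ite, mul_zero, mul_assoc]
  rw [e1, e2, ← mul_sub, norm_mul, Complex.norm_real, Real.norm_of_nonneg hρ.le]
  have bd : ∀ x, 0 < x → 2 / (|ph' δ (x / ρ)| + ω) / ν ≤
      4 * (1 / (|y * (δ * x ^ (δ - 1)) - ν| + ω * (y * (δ * x ^ (δ - 1))))) := fun x hx => by
    set θ := y * (δ * x ^ (δ - 1)) with hθ
    have hθ0 : 0 < θ := by positivity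
    have t1 : θ - ν = ν * ph' δ (x / ρ) := by
      have : y * ρ ^ (δ - 1) = ν := by
        rw [Real.rpow_sub_one hρ.ne', ← mul_div_assoc, hρe, mul_div_assoc, div_self hρ.ne', mul_one]
      unfold ph'
      rw [Real.div_rpow hx.le hρ.le, hθ, ← this]
      have := (Real.rpow_pos_of_pos hρ (δ - 1)).ne'
      field_simp
    have t2 : |θ - ν| = ν * |ph' δ (x / ρ)| := by rw [t1, abs_mul, abs_of_pos hν]
    have t3 : ω * θ ≤ |θ - ν| + ω * ν := by
      have := le_abs_self (θ - ν)
      nlinarith [abs_nonneg (θ - ν)]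
    rw [div_div, mul_one_div, div_le_div_iff₀ (by positivity) (by positivity)]
    nlinarith [abs_nonneg (θ - ν)]
  calc _ ≤ ρ * ((C + 2 / (|ph' δ (a / ρ)| + ω) + 2 / (|ph' δ (b / ρ)| + ω)) / (ν * ρ)) := by
        gcongr
    _ = C * (1 / ν) + 2 / (|ph' δ (a / ρ)| + ω) / ν + 2 / (|ph' δ (b / ρ)| + ω) / ν := by
        field_simp
    _ ≤ _ := by
        have t1 := bd a ha
        have t2 := bd b (ha.trans_le hab)
        set U := 1 / (|y * (δ * a ^ (δ - 1)) - ν| + ω * (y * (δ * a ^ (δ - 1)))) with hU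
        set V := 1 / (|y * (δ * b ^ (δ - 1)) - ν| + ω * (y * (δ * b ^ (δ - 1)))) with hV
        have hU0 : 0 ≤ U := by positivity
        have hV0 : 0 ≤ V := by have := ha.trans_le hab; positivity
        have hn : 0 ≤ 1 / ν := by positivity
        nlinarith

lemma sum_inv_abs_sub_add_le {θ η : ℝ} (hθ : 0 ≤ θ) (hη : 0 < η) (κ : ℕ) :
    ∑ ν ∈ Icc 1 κ, 1 / (|θ - ν| + η) ≤ 2 * (1 / η + (1 + Real.log κ)) := by
  have main : ∀ (s : Finset ℕ) (j : ℕ → ℕ), Set.InjOn j s → (∀ ν ∈ s, j ν ≤ κ) →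
      (∀ ν ∈ s, (j ν : ℝ) ≤ |θ - ν|) →
      ∑ ν ∈ s, 1 / (|θ - ν| + η) ≤ 1 / η + (1 + Real.log κ) := fun s j hj hle hd => by
    calc ∑ ν ∈ s, 1 / (|θ - ν| + η) ≤ ∑ ν ∈ s, 1 / ((j ν : ℝ) + η) :=
          sum_le_sum fun ν hν => by gcongr; exact hd ν hν
      _ = ∑ k ∈ s.image j, 1 / ((k : ℝ) + η) :=
          (sum_image (f := fun k : ℕ => 1 / ((k : ℝ) + η)) hj).symm
      _ ≤ ∑ k ∈ range (κ + 1), 1 / ((k : ℝ) + η) := by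
          refine sum_le_sum_of_subset_of_nonneg (fun k hk => ?_) fun k _ _ => by positivity
          obtain ⟨ν, hν, rfl⟩ := mem_image.1 hk
          exact mem_range.2 (Nat.lt_succ_of_le (hle ν hν))
      _ ≤ _ := by
          rw [range_eq_Ico, sum_eq_sum_Ico_succ_bot (by omega)]
          gcongr
          · simp
          · refine le_trans (sum_le_sum fun k hk => ?_) (sum_Icc_inv_le κ)
            have : (1 : ℝ) ≤ k := by exact_mod_cast (mem_Ico.1 hk).1
            gcongr
            linarith
  rw [← sum_filter_add_sum_filter_not (Icc 1 κ) (fun ν => (ν : ℝ) ≤ θ), two_mul]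
  gcongr
  · refine main _ (fun ν => min ⌊θ⌋₊ κ - ν) ?_ ?_ ?_
    · intro x hx z hz h
      simp only [mem_coe, mem_filter, mem_Icc] at hx hz h
      have := Nat.le_floor hx.2
      have := Nat.le_floor hz.2
      omega
    · intro ν hν
      omega
    · intro ν hν
      simp only [mem_filter, mem_Icc] at hν
      have h1 := Nat.le_floor hν.2
      have h2 := Nat.floor_le hθ
      have h3 : ((min ⌊θ⌋₊ κ - ν : ℕ) : ℝ) ≤ ((⌊θ⌋₊ - ν : ℕ) : ℝ) := by
        exact_mod_cast (by omega)
      rw [Nat.cast_sub h1] at h3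
      exact h3.trans ((by linarith : _ ≤ θ - ν).trans (le_abs_self _))
  · refine main _ (fun ν => ν - ⌊θ⌋₊ - 1) ?_ ?_ ?_
    · intro x hx z hz h
      simp only [mem_coe, mem_filter, mem_Icc, not_le] at hx hz h
      have := (Nat.floor_lt hθ).2 hx.2
      have := (Nat.floor_lt hθ).2 hz.2
      omega
    · intro ν hν
      simp only [mem_filter, mem_Icc] at hν
      omega
    · intro ν hν
      simp only [mem_filter, mem_Icc, not_le] at hν
      have h1 := (Nat.floor_lt hθ).2 hν.2
      have h2 := Nat.lt_floor_add_one θ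
      rw [Nat.sub_sub, Nat.cast_sub (by omega)]
      push_cast
      rw [abs_sub_comm]
      exact (by linarith : _ ≤ (ν : ℝ) - θ).trans (le_abs_self _)

/-- The location of the stationary point (up to a constant factor) of `y * x ^ δ - ν * x`. -/
noncomputable def rho (δ y ν : ℝ) : ℝ := (y / ν) ^ (1 / (1 - δ))

lemma rho_pos (δ : ℝ) {y ν : ℝ} (hy : 0 < y) (hν : 0 < ν) : 0 < rho δ y ν :=
  Real.rpow_pos_of_pos (div_pos hy hν) _

lemma mul_rho_rpow {δ y ν : ℝ} (h1 : δ < 1) (hy : 0 < y) (hν : 0 < ν) :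
    y * rho δ y ν ^ δ = ν * rho δ y ν := by
  have hr := rho_pos δ hy hν
  have h2 : rho δ y ν ^ (1 - δ) = y / ν := by
    unfold rho
    rw [← Real.rpow_mul (div_pos hy hν).le, one_div_mul_cancel (by linarith), Real.rpow_one]
  rw [Real.rpow_sub hr, Real.rpow_one, div_eq_div_iff (by positivity) hν.ne'] at h2
  linarith

lemma process_B {δ : ℝ} (h0 : 0 < δ) (h1 : δ < 1) : ∃ C, 0 < C ∧
    ∀ (y ω : ℝ) (a b κ : ℕ), 0 < y → 1 ≤ a → a ≤ b → 1 ≤ κ → 0 < ω → ω ≤ 1 →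
      2 * (y * (δ * (a : ℝ) ^ (δ - 1))) ≤ κ →
    ‖∑ n ∈ Icc a b, e (y * (n : ℝ) ^ δ) - ∑ ν ∈ Icc 1 κ, ∫ v in lft δ..rgt δ,
        (if a < rho δ y ν * v ∧ rho δ y ν * v ≤ b then
          rho δ y ν * wgt δ ω (ν * rho δ y ν) v * e (ν * rho δ y ν * ph δ v) else 0)‖ ≤
      C * (1 + Real.log κ + 1 / (ω * (y * (b : ℝ) ^ (δ - 1)))) := by
  obtain ⟨C, hC, hssp⟩ := separated_stationary_phase h0 h1
  refine ⟨4 + 1 / δ + C * 5 + C * 4 / δ, by positivity, ?_⟩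
  intro y ω a b κ hy ha hab hκ hω hω1 hκD
  have ha' : (1 : ℝ) ≤ a := by exact_mod_cast ha
  have hab' : (a : ℝ) ≤ b := by exact_mod_cast hab
  have hb0 : (0 : ℝ) < b := by linarith
  have hpos : ∀ x ∈ Set.Icc (a : ℝ) b, 0 < x := fun x hx => by linarith [hx.1]
  set θ : ℝ → ℝ := fun x => y * (δ * x ^ (δ - 1)) with hθ
  have hθpos : ∀ x, 0 < x → 0 < θ x := fun x hx => by positivity
  have hmono : ∀ x z, 0 < x → x ≤ z → θ z ≤ θ x := fun x z hx hxz => by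
    have := Real.rpow_le_rpow_of_nonpos hx hxz (show δ - 1 ≤ 0 by linarith)
    simp only [hθ]; gcongr
  have hlog : 0 ≤ Real.log κ := Real.log_natCast_nonneg κ
  have hp := truncated_poisson (f := fun x => y * x ^ δ) (f' := θ)
    (f'' := fun x => y * (δ * ((δ - 1) * x ^ (δ - 1 - 1)))) (d₀ := θ b) (D := θ a) hab
    (fun x hx => hasDerivAt_const_mul_rpow y δ (hpos x hx))
    (fun x hx => ((Real.hasDerivAt_rpow_const (Or.inl (hpos x hx).ne')).const_mul δ).const_mul y)
    (continuousOn_const.mul (continuousOn_const.mul (continuousOn_const.mul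
      (continuousOn_id.rpow_const fun x hx => Or.inl (hpos x hx).ne'))))
    (fun x hx => by
      have := Real.rpow_pos_of_pos (hpos x hx) (δ - 1 - 1)
      exact (mul_neg_of_pos_of_neg hy (mul_neg_of_pos_of_neg h0
        (mul_neg_of_neg_of_pos (by linarith) this))).le)
    (hθpos b hb0) (fun x hx => ⟨hmono _ _ (hpos x hx) hx.2, hmono _ _ (by linarith) hx.1⟩) hκ hκD
  have hs : ∑ ν ∈ Icc 1 κ, ‖(∫ x in (a : ℝ)..b, e (y * x ^ δ - ν * x)) - ∫ v in lft δ..rgt δ,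
        (if a < rho δ y ν * v ∧ rho δ y ν * v ≤ b then
          rho δ y ν * wgt δ ω (ν * rho δ y ν) v * e (ν * rho δ y ν * ph δ v) else 0)‖ ≤
      C * ((1 + Real.log κ) + 2 * (1 / (ω * θ a) + (1 + Real.log κ)) +
        2 * (1 / (ω * θ b) + (1 + Real.log κ))) := by
    calc _ ≤ ∑ ν ∈ Icc 1 κ, C * (1 / (ν : ℝ) + 1 / (|θ a - ν| + ω * θ a) +
          1 / (|θ b - ν| + ω * θ b)) := sum_le_sum fun ν hν => by
            have hν : (0 : ℝ) < ν := by exact_mod_cast (mem_Icc.1 hν).1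
            exact hssp y ν _ a b ω hy hν (rho_pos δ hy hν) (mul_rho_rpow h1 hy hν)
              (by linarith) hab' hω hω1
      _ ≤ _ := by
        rw [← mul_sum, sum_add_distrib, sum_add_distrib]
        have := hθpos a (by linarith)
        have := hθpos b hb0
        gcongr
        · exact sum_Icc_inv_le κ
        · exact sum_inv_abs_sub_add_le (by linarith) (by positivity) κ
        · exact sum_inv_abs_sub_add_le (by linarith) (by positivity) κ
  have hs' := (norm_sum_le _ _).trans hs
  rw [sum_sub_distrib] at hs'
  refine (norm_sub_le_norm_sub_add_norm_sub _
    (∑ ν ∈ Icc 1 κ, ∫ x in (a : ℝ)..b, e (y * x ^ δ - ν * x)) _).trans ?_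
  refine (add_le_add hp hs').trans ?_
  have hQ : 0 < y * (b : ℝ) ^ (δ - 1) := by positivity
  have t1 : θ b = δ * (y * (b : ℝ) ^ (δ - 1)) := by simp only [hθ]; ring
  have t2 : 1 / (ω * θ b) = 1 / δ * (1 / (ω * (y * (b : ℝ) ^ (δ - 1)))) := by
    rw [t1]; field_simp
  have t3 : 1 / (ω * θ a) ≤ 1 / (ω * θ b) := by
    have := hmono a b (by linarith) hab'
    have := hθpos b hb0
    gcongr
  have t4 : 1 / θ b ≤ 1 / (ω * θ b) := by
    have := hθpos b hb0
    gcongr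
    nlinarith
  rw [t2] at t3 t4 ⊢
  set R := 1 / (ω * (y * (b : ℝ) ^ (δ - 1))) with hR
  have hR0 : 0 < R := by positivity
  have hδ : 0 < 1 / δ := by positivity
  set L := Real.log κ
  set U := 1 / (ω * θ a)
  set V := 1 / θ b
  have e1 : C * 4 / δ = C * 4 * (1 / δ) := by ring
  rw [e1]
  set d := 1 / δ
  have : C * U ≤ C * (d * R) := by gcongr
  nlinarith [mul_nonneg hC.le hlog, mul_nonneg hδ.le hlog, mul_nonneg (mul_pos hC hδ).le hlog,
    mul_pos hC hR0, mul_pos hC hδ]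

lemma exists_ph_bounds {δ : ℝ} (h0 : 0 < δ) (h1 : δ < 1) :
    ∃ p, 0 < p ∧ ∀ v ∈ Set.Icc (lft δ) (rgt δ), p ≤ ph δ v ∧ ph δ v ≤ 1 := by
  have hlp := lft_pos h0
  have hpos : ∀ v ∈ Set.Icc (lft δ) (rgt δ), 0 < v := fun v hv => hlp.trans_le hv.1
  have hlt : ∀ v ∈ Set.Icc (lft δ) (rgt δ), v < 1 := fun v hv => hv.2.trans_lt (rgt_lt_one h0 h1)
  obtain ⟨x, hx, hmin⟩ := (isCompact_Icc (a := lft δ) (b := rgt δ)).exists_isMinOn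
    ⟨_, le_rfl, (lft_lt_rgt h0 h1).le⟩ (continuousOn_ph δ hpos)
  refine ⟨ph δ x, ph_pos h1 (hpos x hx) (hlt x hx), fun v hv => ⟨hmin hv, ?_⟩⟩
  have := Real.rpow_le_one (hpos v hv).le (hlt v hv).le h0.le
  have := hpos v hv
  unfold ph; linarith

lemma rho_le_iff {δ c m ν x : ℝ} (h1 : δ < 1) (hc : 0 < c) (hm : 0 < m) (hν : 0 < ν)
    (hx : 0 < x) :
    rho δ (c * m ^ δ) ν ≤ x ↔ c * m ^ δ * x ^ (δ - 1) ≤ ν := by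
  have hd : 0 < 1 - δ := by linarith
  unfold rho
  rw [one_div, Real.rpow_inv_le_iff_of_pos (by positivity) hx.le hd, div_le_iff₀ hν,
    show δ - 1 = -(1 - δ) by ring, Real.rpow_neg hx.le, ← div_eq_mul_inv,
    div_le_iff₀ (by positivity), mul_comm ν]

lemma rho_eq {δ c M ρ₀ m ν : ℝ} (h1 : δ < 1) (hc : 0 < c) (hM : 0 < M)
    (hρ : 0 < ρ₀) (hm : 0 < m) (hν : 0 < ν)
    : rho δ (c * m ^ δ) ν = ρ₀ * (m / M) ^ (δ / (1 - δ)) *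
    ((c * M ^ δ * ρ₀ ^ (δ - 1)) / ν) ^ (δ / (1 - δ) + 1) := by
  have hd : 0 < 1 - δ := by linarith
  have e1 : c * m ^ δ / ν = ρ₀ ^ (1 - δ) * (m / M) ^ δ * ((c * M ^ δ * ρ₀ ^ (δ - 1)) / ν) := by
    rw [Real.div_rpow hm.le hM.le, show δ - 1 = -(1 - δ) by ring, Real.rpow_neg hρ.le]
    have := (Real.rpow_pos_of_pos hM δ).ne'
    have := (Real.rpow_pos_of_pos hρ (1 - δ)).ne'
    field_simp
  have hq : 0 < m / M := by positivity
  unfold rho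
  rw [e1, Real.mul_rpow (by positivity) (by positivity), Real.mul_rpow (by positivity)
    (by positivity), ← Real.rpow_mul hρ.le, ← Real.rpow_mul hq.le, mul_one_div, mul_one_div,
    div_self hd.ne', Real.rpow_one, show δ / (1 - δ) + 1 = 1 / (1 - δ) by field_simp; ring]

lemma mul_rho_eq {δ c M ρ₀ m ν : ℝ} (h1 : δ < 1) (hc : 0 < c) (hM : 0 < M)
    (hρ : 0 < ρ₀) (hm : 0 < m) (hν : 0 < ν)
    : ν * rho δ (c * m ^ δ) ν = ρ₀ * (c * M ^ δ * ρ₀ ^ (δ - 1)) *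
    M ^ (-(δ / (1 - δ))) * (c * M ^ δ * ρ₀ ^ (δ - 1)) ^ (δ / (1 - δ)) * m ^ (δ / (1 - δ)) *
    ν ^ (-(δ / (1 - δ))) := by
  rw [rho_eq h1 hc hM hρ hm hν]
  set N := c * M ^ δ * ρ₀ ^ (δ - 1) with hN
  have hN0 : 0 < N := by positivity
  rw [Real.rpow_add_one (by positivity), Real.div_rpow hm.le hM.le, Real.div_rpow hN0.le hν.le,
    Real.rpow_neg hM.le, Real.rpow_neg hν.le]
  have := (Real.rpow_pos_of_pos hM (δ / (1 - δ))).ne'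
  have := (Real.rpow_pos_of_pos hν (δ / (1 - δ))).ne'
  field_simp

lemma norm_weighted_sub_le {δ ω v ρ₀ N B : ℝ} (h0 : 0 < δ) (h1 : δ < 1) (hω : 0 < ω)
    (hρ : 0 < ρ₀) (hN : 0 < N) (hv : 0 < v) {S₁ S₂ : ℂ} (hS₁ : ‖S₁‖ ≤ B) (hS₂ : ‖S₂‖ ≤ B) :
    ‖ρ₀ * wloc δ ω v * S₁ - wreg' δ ω v / (2 * π * I * N) * S₂‖ ≤
      (ρ₀ * wloc δ ω v + wmaj δ ω v / N) * B := by
  refine (norm_sub_le _ _).trans ?_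
  rw [norm_mul, norm_mul, norm_mul, norm_div, Complex.norm_real, Complex.norm_real,
    Complex.norm_real, Real.norm_of_nonneg hρ.le, Real.norm_of_nonneg (wloc_nonneg hω v),
    Real.norm_eq_abs]
  have e4 : ‖(2 * π * I * N : ℂ)‖ = 2 * π * N := by
    simp [abs_of_pos Real.pi_pos, abs_of_pos hN]
  have e5 : |wreg' δ ω v| / (2 * π * N) ≤ wmaj δ ω v / N := by
    have := abs_wreg'_le hω h0 h1 hv
    have := wmaj_nonneg hω h0 h1 hv
    have := Real.pi_gt_three
    gcongr
    nlinarith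
  have e6 := wloc_nonneg (δ := δ) hω v
  have e7 := wmaj_nonneg hω h0 h1 hv
  rw [e4, add_mul]
  gcongr

set_option maxHeartbeats 1000000 in
lemma dual_bilinear {δ c : ℝ} (h0 : 1 / 2 < δ) (h1 : δ < 1) (hc : 0 < c) : ∃ C, 0 < C ∧
    ∀ (M ρ₀ A v ω : ℝ) (H κ : ℕ) (s : Finset ℕ) (a b : ℕ → ℕ) (α : ℕ → ℂ), 1 ≤ M → 0 < ρ₀ →
      0 ≤ A → 1 ≤ H → (H : ℝ) ≤ c * M ^ δ * ρ₀ ^ (δ - 1) → IsIntvl s →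
      (∀ m ∈ s, M ≤ m ∧ (m : ℝ) ≤ 4 * M) → Antitone a → Antitone b →
      (∀ m ∈ s, lft δ * ρ₀ / 2 ≤ a m ∧ (b m : ℝ) ≤ lft δ * ρ₀) → (∀ m ∈ s, ‖α m‖ ≤ A) →
      0 < ω → v ∈ Set.Icc (lft δ) (rgt δ) →
      ‖∑ m ∈ s, α m * ∑ ν ∈ Icc 1 κ,
        (if a m < rho δ (c * (m : ℝ) ^ δ) ν * v ∧ rho δ (c * (m : ℝ) ^ δ) ν * v ≤ b m then
          rho δ (c * (m : ℝ) ^ δ) ν * wgt δ ω (ν * rho δ (c * (m : ℝ) ^ δ) ν) v *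
            e (ν * rho δ (c * (m : ℝ) ^ δ) ν * ph δ v) else 0)‖ ≤
      C * A * (ρ₀ * wloc δ ω v + wmaj δ ω v / (c * M ^ δ * ρ₀ ^ (δ - 1))) *
        √(M * (c * M ^ δ * ρ₀ ^ (δ - 1)) ^ 2 * (M / H + √ρ₀ * √H + M / √ρ₀ / √H)) := by
  have hδ : 0 < δ := by linarith
  have hd : 0 < 1 - δ := by linarith
  have hlp := lft_pos hδ
  obtain ⟨p, hp0, hp⟩ := exists_ph_bounds hδ h1
  set β := δ / (1 - δ) with hβ
  have hβ1 : 1 < β := by rw [hβ, lt_div_iff₀ hd]; linarith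
  set R := 4 + 4 ^ δ * (lft δ / 2) ^ (δ - 1) with hR
  have hR4 : 4 ≤ R := le_add_of_nonneg_right (by positivity)
  obtain ⟨C, hC, hbil⟩ := bilinear_estimate (γ := β) (σ := -β) (R := R)
    (mul_pos (by linarith) (by linarith)).ne' (by linarith) (by linarith)
  refine ⟨√C * 4 ^ β * √(1 + 1 / √p), by positivity, ?_⟩
  intro M ρ₀ A v ω H κ s a b α hM hρ hA hH hHN hs hsM ha hb hab hα hω hv
  have hM0 : 0 < M := by linarith
  set N := c * M ^ δ * ρ₀ ^ (δ - 1) with hN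
  have hH1 : (1 : ℝ) ≤ H := by exact_mod_cast hH
  have hN1 : 1 ≤ N := hH1.trans hHN
  have hN0 : 0 < N := by linarith
  have hv0 : 0 < v := hlp.trans_le hv.1
  have hv1 : v ≤ 1 := hv.2.trans (rgt_lt_one hδ h1).le
  have hs0 : ∀ m ∈ s, (0 : ℝ) < m := fun m hm => hM0.trans_le (hsM m hm).1
  set D : ℕ → ℕ → Prop := fun m ν =>
    a m < rho δ (c * (m : ℝ) ^ δ) ν * v ∧ rho δ (c * (m : ℝ) ^ δ) ν * v ≤ b m with hD
  set t := (Icc 1 κ).filter fun ν : ℕ => N ≤ ν ∧ (ν : ℝ) ≤ R * N with ht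
  have hDt : ∀ m ∈ s, ∀ ν ∈ Icc 1 κ, D m ν → ν ∈ t := by
    rintro m hm ν hν ⟨d1, d2⟩
    have hm0 := hs0 m hm
    have hν0 : (0 : ℝ) < ν := by exact_mod_cast (mem_Icc.1 hν).1
    have hr := rho_pos δ (mul_pos hc (Real.rpow_pos_of_pos hm0 δ)) hν0
    refine mem_filter.2 ⟨hν, ?_, ?_⟩
    · have e1 : rho δ (c * (m : ℝ) ^ δ) ν ≤ ρ₀ := by
        refine le_of_mul_le_mul_right (d2.trans ((hab m hm).2.trans ?_)) hv0
        rw [mul_comm ρ₀]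
        exact mul_le_mul_of_nonneg_right hv.1 hρ.le
      refine le_trans ?_ ((rho_le_iff h1 hc hm0 hν0 hρ).1 e1)
      have := (hsM m hm).1
      rw [hN]
      gcongr
    · have e1 : ¬ rho δ (c * (m : ℝ) ^ δ) ν ≤ lft δ / 2 * ρ₀ := by
        rw [not_le]
        calc lft δ / 2 * ρ₀ = lft δ * ρ₀ / 2 := by ring
          _ ≤ a m := (hab m hm).1
          _ < _ := d1
          _ ≤ _ := mul_le_of_le_one_right hr.le hv1
      rw [rho_le_iff h1 hc hm0 hν0 (by positivity), not_le] at e1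
      refine e1.le.trans ?_
      have := (hsM m hm).2
      calc c * (m : ℝ) ^ δ * (lft δ / 2 * ρ₀) ^ (δ - 1) ≤
            c * (4 * M) ^ δ * (lft δ / 2 * ρ₀) ^ (δ - 1) := by gcongr
        _ = 4 ^ δ * (lft δ / 2) ^ (δ - 1) * N := by
            rw [Real.mul_rpow (by norm_num) hM0.le, Real.mul_rpow (by positivity) hρ.le]; ring
        _ ≤ R * N := by rw [hR]; gcongr; linarith
  have hDi : ∀ ν ∈ t, IsIntvl (s.filter fun m => D m ν) := by
    intro ν hν x hx z hz u hxu huz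
    obtain ⟨hx, x1, -⟩ := mem_filter.1 hx
    obtain ⟨hz, -, z2⟩ := mem_filter.1 hz
    have hu := hs x hx z hz u hxu huz
    have hν0 : (0 : ℝ) < ν := by exact_mod_cast (mem_Icc.1 (mem_filter.1 hν).1).1
    have hmono : ∀ i j : ℕ, i ≤ j → rho δ (c * (i : ℝ) ^ δ) ν * v ≤ rho δ (c * (j : ℝ) ^ δ) ν * v := by
      intro i j hij
      have : (i : ℝ) ≤ j := by exact_mod_cast hij
      unfold rho
      gcongr
    refine mem_filter.2 ⟨hu, ?_, ?_⟩
    · exact lt_of_le_of_lt (by exact_mod_cast ha hxu) (x1.trans_le (hmono x u hxu))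
    · exact (hmono u z huz).trans (z2.trans (by exact_mod_cast hb huz))
  set A₀ := ph δ v * (ρ₀ * N * M ^ (-β) * N ^ β) with hA₀
  have hph := hp v hv
  have hA₀0 : 0 < A₀ := by have := hp0.trans_le hph.1; positivity
  set G := M * N ^ 2 * (M / H + √ρ₀ * √H + M / √ρ₀ / √H) with hG
  have hsum : ∀ (α' b' : ℕ → ℂ), (∀ m ∈ s, ‖α' m‖ ≤ 4 ^ β * A) → (∀ ν ∈ t, ‖b' ν‖ ≤ 1) →
      ‖∑ m ∈ s, α' m * ∑ ν ∈ t, if D m ν then b' ν * e (A₀ * (m : ℝ) ^ β * (ν : ℝ) ^ (-β))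
        else 0‖ ≤ √C * 4 ^ β * √(1 + 1 / √p) * A * √G := by
    intro α' b' hα' hb'
    have := hbil M N A₀ (4 ^ β * A) H s t D α' b' hM hN1 hA₀0.ne' hH hHN
      (fun m hm => ⟨(hsM m hm).1, (hsM m hm).2.trans (by gcongr)⟩)
      (fun ν hν => (mem_filter.1 hν).2) hDi hα' hb'
    have e1 : |A₀| * M ^ β * N ^ (-β) / N = ph δ v * ρ₀ := by
      rw [abs_of_pos hA₀0, hA₀, Real.rpow_neg hM0.le, Real.rpow_neg hN0.le]
      have := (Real.rpow_pos_of_pos hM0 β).ne'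
      have := (Real.rpow_pos_of_pos hN0 β).ne'
      field_simp
    have hp1 : 0 < ph δ v := hp0.trans_le hph.1
    have e2 : M / H + √(ph δ v * ρ₀) * √H + M / √(ph δ v * ρ₀) / √H ≤
        (1 + 1 / √p) * (M / H + √ρ₀ * √H + M / √ρ₀ / √H) := by
      have f1 : √(ph δ v * ρ₀) ≤ √ρ₀ := Real.sqrt_le_sqrt (mul_le_of_le_one_left hρ.le hph.2)
      have f2 : M / √(ph δ v * ρ₀) / √H ≤ 1 / √p * (M / √ρ₀ / √H) := by
        have : √p * √ρ₀ ≤ √(ph δ v * ρ₀) := by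
          rw [← Real.sqrt_mul hp0.le]
          exact Real.sqrt_le_sqrt (by gcongr; exact hph.1)
        calc M / √(ph δ v * ρ₀) / √H ≤ M / (√p * √ρ₀) / √H := by gcongr
          _ = _ := by field_simp
      have f3 : √(ph δ v * ρ₀) * √H ≤ √ρ₀ * √H := by gcongr
      have f4 : 0 ≤ 1 / √p * (M / H) := by positivity
      have f5 : 0 ≤ 1 / √p * (√ρ₀ * √H) := by positivity
      have f6 : 0 ≤ M / √ρ₀ / √H := by positivity
      nlinarith
    rw [e1] at this
    have hG0 : 0 ≤ G := by positivity
    refine (pow_le_pow_iff_left₀ (norm_nonneg _) (by positivity) two_ne_zero).1 (this.trans ?_)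
    calc _ ≤ C * (4 ^ β * A) ^ 2 * (M * N ^ 2) *
          ((1 + 1 / √p) * (M / H + √ρ₀ * √H + M / √ρ₀ / √H)) := by gcongr
      _ = C * (4 ^ β * A) ^ 2 * ((1 + 1 / √p) * G) := by rw [hG]; ring
      _ = _ := by
        simp only [mul_pow]
        rw [Real.sq_sqrt hC.le, Real.sq_sqrt hG0,
          Real.sq_sqrt (by positivity)]
        ring
  have h2 := hsum (fun m => α m * ((m / M : ℝ) ^ β : ℝ)) (fun ν => ((N / ν : ℝ) ^ (β + 1) : ℝ))
    (fun m hm => by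
      have hm0 := hs0 m hm
      rw [norm_mul, Complex.norm_real, Real.norm_of_nonneg (by positivity), mul_comm]
      have : (m : ℝ) / M ≤ 4 := by rw [div_le_iff₀ hM0]; exact (hsM m hm).2
      gcongr
      exact hα m hm)
    (fun ν hν => by
      have hν0 : N ≤ ν := (mem_filter.1 hν).2.1
      rw [Complex.norm_real, Real.norm_of_nonneg (by positivity)]
      exact Real.rpow_le_one (by positivity) ((div_le_one (by linarith)).2 hν0) (by linarith))
  have h3 := hsum α (fun ν => ((N / ν : ℝ) : ℂ))
    (fun m hm => (hα m hm).trans (le_mul_of_one_le_left hA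
      (Real.one_le_rpow (by norm_num) (by linarith))))
    (fun ν hν => by
      have hν0 : N ≤ ν := (mem_filter.1 hν).2.1
      rw [Complex.norm_real, Real.norm_of_nonneg (by positivity)]
      exact (div_le_one (by linarith)).2 hν0)
  set S₁ := ∑ m ∈ s, α m * ((m / M : ℝ) ^ β : ℝ) * ∑ ν ∈ t, if D m ν then
    (((N / ν : ℝ) ^ (β + 1) : ℝ) : ℂ) * e (A₀ * (m : ℝ) ^ β * (ν : ℝ) ^ (-β)) else 0 with hS₁
  set S₂ := ∑ m ∈ s, α m * ∑ ν ∈ t, if D m ν then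
    ((N / ν : ℝ) : ℂ) * e (A₀ * (m : ℝ) ^ β * (ν : ℝ) ^ (-β)) else 0 with hS₂
  have hid : ∑ m ∈ s, α m * ∑ ν ∈ Icc 1 κ,
        (if D m ν then
          rho δ (c * (m : ℝ) ^ δ) ν * wgt δ ω (ν * rho δ (c * (m : ℝ) ^ δ) ν) v *
            e (ν * rho δ (c * (m : ℝ) ^ δ) ν * ph δ v) else 0) =
      ρ₀ * wloc δ ω v * S₁ - wreg' δ ω v / (2 * π * I * N) * S₂ := by
    rw [hS₁, hS₂, mul_sum, mul_sum, ← sum_sub_distrib]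
    refine sum_congr rfl fun m hm => ?_
    rw [← sum_subset (filter_subset _ (Icc 1 κ) : t ⊆ Icc 1 κ) fun ν hν hνt =>
      if_neg fun hDm => hνt (hDt m hm ν hν hDm), mul_sum, mul_sum, mul_sum, mul_sum, mul_sum,
      ← sum_sub_distrib]
    refine sum_congr rfl fun ν hν => ?_
    by_cases hDm : D m ν
    · rw [if_pos hDm, if_pos hDm, if_pos hDm]
      have hm0 := hs0 m hm
      have hν0 : (0 : ℝ) < ν := by exact_mod_cast (mem_Icc.1 (mem_filter.1 hν).1).1
      have e1 := rho_eq h1 hc hM0 hρ hm0 hν0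
      have e2 := mul_rho_eq h1 hc hM0 hρ hm0 hν0
      have hr := rho_pos δ (mul_pos hc (Real.rpow_pos_of_pos hm0 δ)) hν0
      set r := rho δ (c * (m : ℝ) ^ δ) ν with hr'
      have e3 : (ν : ℝ) * r * ph δ v = A₀ * (m : ℝ) ^ β * (ν : ℝ) ^ (-β) := by
        rw [e2, hA₀]; ring
      have e4 : (r : ℂ) * wgt δ ω (ν * r) v = ρ₀ * wloc δ ω v * ((m / M : ℝ) ^ β : ℝ) *
          (((N / ν : ℝ) ^ (β + 1) : ℝ) : ℂ) - wreg' δ ω v / (2 * π * I * N) * ((N / ν : ℝ) : ℂ) := by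
        have e5 : (r : ℂ) = ρ₀ * ((m / M : ℝ) ^ β : ℝ) * (((N / ν : ℝ) ^ (β + 1) : ℝ) : ℂ) := by
          exact_mod_cast e1
        have hrc : (r : ℂ) ≠ 0 := by exact_mod_cast hr.ne'
        have hνc : (ν : ℂ) ≠ 0 := by exact_mod_cast hν0.ne'
        have hNc : (N : ℂ) ≠ 0 := by exact_mod_cast hN0.ne'
        calc (r : ℂ) * wgt δ ω (ν * r) v = r * wloc δ ω v - wreg' δ ω v / (2 * π * I * ν) := by
              unfold wgt; push_cast; field_simp
          _ = _ := by rw [e5]; push_cast; field_simp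
      rw [e3, e4]
      ring
    · simp only [if_neg hDm, mul_zero, sub_zero]
  rw [hid]
  refine (norm_weighted_sub_le hδ h1 hω hρ hN0 hv0 h2 h3).trans (le_of_eq ?_)
  ring

lemma intervalIntegrable_ite {l u : ℝ} (hlu : l ≤ u) {g : ℝ → ℂ} (hg : ContinuousOn g (Set.Icc l u))
    (r a b : ℝ) :
    IntervalIntegrable (fun v => if a < r * v ∧ r * v ≤ b then g v else 0) volume l u := by
  have h1 : IntervalIntegrable g volume l u :=
    ContinuousOn.intervalIntegrable (Set.uIcc_of_le hlu ▸ hg)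
  rw [intervalIntegrable_iff_integrableOn_Ioc_of_le hlu] at h1 ⊢
  have hm : MeasurableSet {v : ℝ | a < r * v ∧ r * v ≤ b} := by
    have hf : Measurable fun v : ℝ => r * v := measurable_const_mul r
    exact hf measurableSet_Ioc
  refine (Integrable.indicator h1 hm).congr (Eventually.of_forall fun v => ?_)
  simp [Set.indicator_apply]

lemma sum_mul_sum_integral {s t : Finset ℕ} {l u : ℝ} (α : ℕ → ℂ) {f : ℕ → ℕ → ℝ → ℂ}
    (hf : ∀ m ∈ s, ∀ ν ∈ t, IntervalIntegrable (f m ν) volume l u) :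
    ∑ m ∈ s, α m * ∑ ν ∈ t, ∫ v in l..u, f m ν v =
      ∫ v in l..u, ∑ m ∈ s, α m * ∑ ν ∈ t, f m ν v := by
  have h : ∀ m ∈ s, IntervalIntegrable (fun v => α m * ∑ ν ∈ t, f m ν v) volume l u := by
    intro m hm
    simpa only [Finset.sum_apply] using (IntervalIntegrable.sum t (hf m hm)).const_mul (α m)
  rw [intervalIntegral.integral_finsetSum h]
  refine sum_congr rfl fun m hm => ?_
  rw [intervalIntegral.integral_const_mul, intervalIntegral.integral_finsetSum (hf m hm)]

lemma continuousOn_wgt {δ ω l : ℝ} (hω : 0 < ω) {s : Set ℝ} (hs : ∀ v ∈ s, 0 < v) :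
    ContinuousOn (wgt δ ω l) s := by
  have h1 := continuousOn_wreg' (δ := δ) hω hs
  have h2 := continuousOn_wloc (δ := δ) hω hs
  unfold wgt
  fun_prop

lemma norm_dual_integral_le {δ c : ℝ} (h0 : 1 / 2 < δ) (h1 : δ < 1) (hc : 0 < c) : ∃ C, 0 < C ∧
    ∀ (M ρ₀ A ω : ℝ) (H κ : ℕ) (s : Finset ℕ) (a b : ℕ → ℕ) (α : ℕ → ℂ), 1 ≤ M → 0 < ρ₀ →
      0 ≤ A → 1 ≤ H → (H : ℝ) ≤ c * M ^ δ * ρ₀ ^ (δ - 1) → IsIntvl s →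
      (∀ m ∈ s, M ≤ m ∧ (m : ℝ) ≤ 4 * M) → Antitone a → Antitone b →
      (∀ m ∈ s, lft δ * ρ₀ / 2 ≤ a m ∧ (b m : ℝ) ≤ lft δ * ρ₀) → (∀ m ∈ s, ‖α m‖ ≤ A) →
      0 < ω →
      ‖∑ m ∈ s, α m * ∑ ν ∈ Icc 1 κ, ∫ v in lft δ..rgt δ,
        (if a m < rho δ (c * (m : ℝ) ^ δ) ν * v ∧ rho δ (c * (m : ℝ) ^ δ) ν * v ≤ b m then
          rho δ (c * (m : ℝ) ^ δ) ν * wgt δ ω (ν * rho δ (c * (m : ℝ) ^ δ) ν) v *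
            e (ν * rho δ (c * (m : ℝ) ^ δ) ν * ph δ v) else 0)‖ ≤
      C * A * (ρ₀ * ω + 1 / (ω * (c * M ^ δ * ρ₀ ^ (δ - 1)))) *
        √(M * (c * M ^ δ * ρ₀ ^ (δ - 1)) ^ 2 * (M / H + √ρ₀ * √H + M / √ρ₀ / √H)) := by
  have hδ : 0 < δ := by linarith
  have hlr := (lft_lt_rgt hδ h1).le
  have hu : Set.uIcc (lft δ) (rgt δ) = Set.Icc (lft δ) (rgt δ) := Set.uIcc_of_le hlr
  have hpos : ∀ v ∈ Set.Icc (lft δ) (rgt δ), 0 < v := fun v hv => (lft_pos hδ).trans_le hv.1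
  have hle1 : ∀ v ∈ Set.Icc (lft δ) (rgt δ), v ≤ 1 :=
    fun v hv => hv.2.trans (rgt_lt_one hδ h1).le
  obtain ⟨C, hC, hdual⟩ := dual_bilinear h0 h1 hc
  have hdd : 0 < δ * (1 - δ) := mul_pos hδ (by linarith)
  refine ⟨C * (π / (δ * (1 - δ)) + π), by positivity, ?_⟩
  intro M ρ₀ A ω H κ s a b α hM hρ hA hH hHN hs hsM ha hb hab hα hω
  set N := c * M ^ δ * ρ₀ ^ (δ - 1) with hN
  have hM0 : 0 < M := by linarith
  have hN0 : 0 < N := by positivity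
  set G := M * N ^ 2 * (M / H + √ρ₀ * √H + M / √ρ₀ / √H) with hG
  have hint : ∀ m ∈ s, ∀ ν ∈ Icc 1 κ, IntervalIntegrable (fun v =>
        (if a m < rho δ (c * (m : ℝ) ^ δ) ν * v ∧ rho δ (c * (m : ℝ) ^ δ) ν * v ≤ b m then
          rho δ (c * (m : ℝ) ^ δ) ν * wgt δ ω (ν * rho δ (c * (m : ℝ) ^ δ) ν) v *
            e (ν * rho δ (c * (m : ℝ) ^ δ) ν * ph δ v) else 0)) volume (lft δ) (rgt δ) := by
    intro m hm ν hν
    refine intervalIntegrable_ite hlr ?_ _ _ _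
    have := continuousOn_wgt (δ := δ) (l := ν * rho δ (c * (m : ℝ) ^ δ) ν) hω hpos
    exact (continuousOn_const.mul this).mul
      (continuous_e.comp_continuousOn (continuousOn_const.mul (continuousOn_ph δ hpos)))
  rw [sum_mul_sum_integral α hint]
  have cw : IntervalIntegrable (fun v => C * A * ((ρ₀ * (ω ^ 2 / (δ * (1 - δ))) + 1 / N) * √G) *
      wmaj δ ω v) volume (lft δ) (rgt δ) := by
    refine ContinuousOn.intervalIntegrable (hu ▸ ?_)
    exact continuousOn_const.mul (continuousOn_wmaj hω hpos)
  refine (intervalIntegral.norm_integral_le_of_norm_le hlr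
    (ae_of_all _ fun v hv => ?_) cw).trans ?_
  · have hv' : v ∈ Set.Icc (lft δ) (rgt δ) := ⟨hv.1.le, hv.2⟩
    refine (hdual M ρ₀ A v ω H κ s a b α hM hρ hA hH hHN hs hsM ha hb hab hα hω hv').trans ?_
    have e2 := wloc_le hω hδ h1 (hpos v hv') (hle1 v hv')
    calc _ ≤ C * A * (ρ₀ * (ω ^ 2 / (δ * (1 - δ)) * wmaj δ ω v) + wmaj δ ω v / N) * √G := by
          gcongr
      _ = _ := by ring
  · rw [intervalIntegral.integral_const_mul]
    have e3 := integral_wmaj_le hω hδ h1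
    calc _ ≤ C * A * ((ρ₀ * (ω ^ 2 / (δ * (1 - δ))) + 1 / N) * √G) * (π / ω) := by gcongr
      _ = C * A * (π / (δ * (1 - δ)) * (ρ₀ * ω) + π * (1 / (ω * N))) * √G := by
          field_simp
      _ ≤ C * A * ((π / (δ * (1 - δ)) + π) * (ρ₀ * ω) +
          (π / (δ * (1 - δ)) + π) * (1 / (ω * N))) * √G := by
          have : 0 < π / (δ * (1 - δ)) := by positivity
          gcongr
          · linarith [Real.pi_pos]
          · linarith [Real.pi_pos]
      _ = _ := by ring

lemma norm_bilinear_le_of_dual {δ c : ℝ} (h0 : 1 / 2 < δ) (h1 : δ < 1) (hc : 0 < c) : ∃ C, 0 < C ∧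
    ∀ (M ρ₀ A ω E : ℝ) (H κ : ℕ) (s : Finset ℕ) (a b : ℕ → ℕ) (α : ℕ → ℂ), 1 ≤ M → 0 < ρ₀ →
      0 ≤ A → 1 ≤ H → (H : ℝ) ≤ c * M ^ δ * ρ₀ ^ (δ - 1) → IsIntvl s →
      (∀ m ∈ s, M ≤ m ∧ (m : ℝ) ≤ 4 * M) → Antitone a → Antitone b →
      (∀ m ∈ s, lft δ * ρ₀ / 2 ≤ a m ∧ (b m : ℝ) ≤ lft δ * ρ₀) → (∀ m ∈ s, ‖α m‖ ≤ A) →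
      0 < ω → ω ≤ 1 → 1 ≤ κ → (∀ m ∈ s, 1 ≤ a m) → 0 ≤ E →
      (∀ m ∈ s, a m ≤ b m → 2 * (c * (m : ℝ) ^ δ * (δ * (a m : ℝ) ^ (δ - 1))) ≤ κ ∧
        1 / (ω * (c * (m : ℝ) ^ δ * (b m : ℝ) ^ (δ - 1))) ≤ E) →
      ‖∑ m ∈ s, α m * ∑ n ∈ Icc (a m) (b m), e (c * (m : ℝ) ^ δ * (n : ℝ) ^ δ)‖ ≤
      C * A * (#s * (1 + Real.log κ + E) + (ρ₀ * ω + 1 / (ω * (c * M ^ δ * ρ₀ ^ (δ - 1)))) *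
        √(M * (c * M ^ δ * ρ₀ ^ (δ - 1)) ^ 2 * (M / H + √ρ₀ * √H + M / √ρ₀ / √H))) := by
  obtain ⟨C₁, hC₁, hB⟩ := process_B (by linarith : 0 < δ) h1
  obtain ⟨C₂, hC₂, hD⟩ := norm_dual_integral_le h0 h1 hc
  refine ⟨C₁ + C₂, by positivity, ?_⟩
  intro M ρ₀ A ω E H κ s a b α hM hρ hA hH hHN hs hsM ha hb hab hα hω hω1 hκ ha1 hE hmab
  have key := hD M ρ₀ A ω H κ s a b α hM hρ hA hH hHN hs hsM ha hb hab hα hω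
  set J : ℕ → ℂ := fun m => ∑ ν ∈ Icc 1 κ, ∫ v in lft δ..rgt δ,
        (if a m < rho δ (c * (m : ℝ) ^ δ) ν * v ∧ rho δ (c * (m : ℝ) ^ δ) ν * v ≤ b m then
          rho δ (c * (m : ℝ) ^ δ) ν * wgt δ ω (ν * rho δ (c * (m : ℝ) ^ δ) ν) v *
            e (ν * rho δ (c * (m : ℝ) ^ δ) ν * ph δ v) else 0) with hJ
  have hlog : 0 ≤ Real.log κ := Real.log_natCast_nonneg κ
  have hm : ∀ m ∈ s, ‖∑ n ∈ Icc (a m) (b m), e (c * (m : ℝ) ^ δ * (n : ℝ) ^ δ) - J m‖ ≤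
      C₁ * (1 + Real.log κ + E) := by
    intro m hm
    have hm0 : (0 : ℝ) < m := by linarith [(hsM m hm).1]
    by_cases hle : a m ≤ b m
    · have := hB (c * (m : ℝ) ^ δ) ω (a m) (b m) κ (by positivity) (ha1 m hm) hle hκ hω hω1
        (hmab m hm hle).1
      refine this.trans ?_
      gcongr
      exact (hmab m hm hle).2
    · have : J m = 0 := by
        refine sum_eq_zero fun ν _ => ?_
        rw [intervalIntegral.integral_congr (g := fun _ => (0 : ℂ)) fun v _ => if_neg ?_]
        · simp
        · rintro ⟨x1, x2⟩
          exact hle (by exact_mod_cast (x1.trans_le x2).le)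
      rw [this, Finset.Icc_eq_empty hle]
      simp only [sum_empty, sub_zero, norm_zero]
      positivity
  set S := ∑ m ∈ s, α m * ∑ n ∈ Icc (a m) (b m), e (c * (m : ℝ) ^ δ * (n : ℝ) ^ δ) with hS
  have e1 : ‖S - ∑ m ∈ s, α m * J m‖ ≤ #s * (A * (C₁ * (1 + Real.log κ + E))) := by
    rw [hS, ← sum_sub_distrib, ← nsmul_eq_mul]
    refine (norm_sum_le _ _).trans (sum_le_card_nsmul _ _ _ fun m hms => ?_)
    rw [← mul_sub, norm_mul]
    gcongr
    · exact hα m hms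
    · exact hm m hms
  have e2 := norm_sub_norm_le S (∑ m ∈ s, α m * J m)
  set Q := (ρ₀ * ω + 1 / (ω * (c * M ^ δ * ρ₀ ^ (δ - 1)))) *
    √(M * (c * M ^ δ * ρ₀ ^ (δ - 1)) ^ 2 * (M / H + √ρ₀ * √H + M / √ρ₀ / √H)) with hQ
  have hQ0 : 0 ≤ Q := by have : 0 < M := by linarith
                         positivity
  have hP0 : 0 ≤ #s * (1 + Real.log κ + E) := by positivity
  calc ‖S‖ ≤ #s * (A * (C₁ * (1 + Real.log κ + E))) + C₂ * A * Q := by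
        rw [hQ, ← mul_assoc]; linarith
    _ = C₁ * A * (#s * (1 + Real.log κ + E)) + C₂ * A * Q := by ring
    _ ≤ (C₁ + C₂) * A * (#s * (1 + Real.log κ + E)) + (C₁ + C₂) * A * Q := by
        gcongr <;> linarith
    _ = _ := by ring

noncomputable def trm (c δ T : ℝ) (n : ℕ) : ℂ :=
  if T ≤ n ∧ (n : ℝ) ≤ 2 * T then e (c * (n : ℝ) ^ δ) else 0

lemma trm_mul (c δ T : ℝ) (m n : ℕ) : trm c δ T (m * n) =
    if T ≤ m * n ∧ (m * n : ℝ) ≤ 2 * T then e (c * (m : ℝ) ^ δ * (n : ℝ) ^ δ) else 0 := by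
  unfold trm
  push_cast
  rw [mul_rpow (Nat.cast_nonneg _) (Nat.cast_nonneg _), mul_assoc]

lemma box_small {δ c : ℝ} (h0 : 2 / 3 ≤ δ) (h1 : δ < 1) (hc : 0 < c) : ∃ C, 0 < C ∧
    ∀ (T : ℝ) (N : ℕ) (u A : ℝ) (s : Finset ℕ) (a : ℕ → ℂ), 4096 ≤ T → (N : ℝ) = T ^ u →
      T ^ (1 / 3 : ℝ) / 2 ≤ N → u ≤ δ / 2 → 0 ≤ A → IsIntvl s →
      (∀ m ∈ s, T / (2 * N) ≤ m ∧ (m : ℝ) ≤ 4 * (T / (2 * N))) → (∀ m ∈ s, ‖a m‖ ≤ A) →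
      ‖∑ m ∈ s, a m * ∑ n ∈ Ico N (2 * N), trm c δ T (m * n)‖ ≤
        C * A * T ^ (2 / 3 + δ / 4) := by
  obtain ⟨C, hC, hB⟩ := bilinear_estimate (γ := δ) (σ := δ) (R := 4)
    (mul_ne_zero (by linarith) (by linarith)) (by linarith) (by norm_num)
  set k := √(c * (1 / 2) ^ δ) with hk
  have hk0 : 0 < k := by positivity
  refine ⟨√(C * (2 + k + 2 / k)), by positivity, ?_⟩
  intro T N u A s a hT hN hNT hu hA hs hsM ha
  have hT0 : 0 < T := by linarith
  have hT1 : 1 ≤ T := by linarith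
  have hmono : ∀ {x y : ℝ}, x ≤ y → T ^ x ≤ T ^ y := fun h => rpow_le_rpow_of_exponent_le hT1 h
  have hT4 : 4 ≤ T ^ (1 / 6 : ℝ) := by
    calc (4 : ℝ) = (4096 : ℝ) ^ (1 / 6 : ℝ) := by
          rw [show (4096 : ℝ) = 4 ^ (6 : ℝ) by norm_num, ← rpow_mul (by norm_num)]; norm_num
      _ ≤ _ := by gcongr
  have hM : T / (2 * N) = T ^ (1 - u) / 2 := by
    rw [hN, rpow_sub hT0, rpow_one]; field_simp
  set h := 2 / 3 - δ / 2 with hh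
  have hTh : 4 ≤ T ^ h := hT4.trans (hmono (by linarith))
  have hTh0 : 0 < T ^ h := by positivity
  set H := ⌈T ^ h / 4⌉₊ with hH
  have hH1 : T ^ h / 4 ≤ H := Nat.le_ceil _
  have hH2 : (H : ℝ) ≤ T ^ h / 2 := by
    have := (Nat.ceil_lt_add_one (show 0 ≤ T ^ h / 4 by positivity)).le
    linarith
  have hH3 : 1 ≤ H := Nat.one_le_ceil_iff.2 (by positivity)
  have hNpos : (0 : ℝ) < N := by rw [hN]; positivity
  have hM1 : 1 ≤ T / (2 * N) := by
    rw [hM]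
    have : T ^ (1 / 6 : ℝ) ≤ T ^ (1 - u) := hmono (by linarith)
    linarith
  have hN1 : (1 : ℝ) ≤ N := by
    have : 0 < N := by exact_mod_cast hNpos
    exact_mod_cast this
  have key := hB (T / (2 * N)) N c A H s (Ico N (2 * N))
    (fun m ν => T ≤ m * ν ∧ (m * ν : ℝ) ≤ 2 * T) a (fun _ => 1) hM1 hN1 hc.ne' hH3
    (by
      have : T ^ h ≤ T ^ (1 / 3 : ℝ) := hmono (by linarith)
      linarith) hsM
    (by
      intro ν hν
      rw [mem_Ico] at hν
      have e1 : (N : ℝ) ≤ ν := by exact_mod_cast hν.1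
      have e2 : (ν : ℝ) < 2 * N := by exact_mod_cast hν.2
      exact ⟨e1, by linarith⟩)
    (by
      intro ν hν x hx y hy z hxz hzy
      rw [mem_filter] at hx hy ⊢
      have e1 : (x : ℝ) ≤ z := by exact_mod_cast hxz
      have e2 : (z : ℝ) ≤ y := by exact_mod_cast hzy
      have e3 : (0 : ℝ) ≤ ν := Nat.cast_nonneg _
      exact ⟨hs x hx.1 y hy.1 z hxz hzy, hx.2.1.trans (by gcongr),
        le_trans (by gcongr) hy.2.2⟩)
    ha (fun _ _ => by simp)
  have eS : ∑ m ∈ s, a m * ∑ n ∈ Ico N (2 * N), trm c δ T (m * n) =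
      ∑ m ∈ s, a m * ∑ ν ∈ Ico N (2 * N), if T ≤ m * ν ∧ (m * ν : ℝ) ≤ 2 * T then
        (1 : ℂ) * e (c * (m : ℝ) ^ δ * (ν : ℝ) ^ δ) else 0 := by
    simp only [trm_mul, one_mul]
  rw [← eS] at key
  have eE : √(|c| * (T / (2 * N)) ^ δ * (N : ℝ) ^ δ / N) = k * T ^ ((δ - u) / 2) := by
    have : |c| * (T / (2 * N)) ^ δ * (N : ℝ) ^ δ / N = c * (1 / 2) ^ δ * T ^ (δ - u) := by
      rw [abs_of_pos hc, mul_assoc c, ← mul_rpow (by positivity) hNpos.le,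
        show T / (2 * N) * N = 1 / 2 * T by field_simp, mul_rpow (by norm_num) hT0.le,
        rpow_sub hT0, hN]
      ring
    rw [this, Real.sqrt_mul (by positivity), sqrt_eq_rpow (T ^ (δ - u)), ← rpow_mul hT0.le, hk]
    ring_nf
  rw [eE] at key
  have sH : √(H : ℝ) ≤ T ^ (h / 2) := by
    rw [show T ^ (h / 2) = √(T ^ h) by rw [sqrt_eq_rpow, ← rpow_mul hT0.le]; ring_nf]
    exact Real.sqrt_le_sqrt (by linarith)
  have sH' : T ^ (h / 2) / 2 ≤ √(H : ℝ) := by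
    refine Real.le_sqrt_of_sq_le ?_
    rw [div_pow, ← rpow_natCast, ← rpow_mul hT0.le]
    refine le_trans (le_of_eq ?_) hH1
    norm_num
  have hX : (T / (2 * N)) * (N : ℝ) ^ 2 * ((T / (2 * N)) / H + k * T ^ ((δ - u) / 2) * √(H : ℝ) +
      T / (2 * N) / (k * T ^ ((δ - u) / 2)) / √(H : ℝ)) ≤
      (2 + k + 2 / k) * T ^ (4 / 3 + δ / 2) := by
    have e0 : T / (2 * N) * (N : ℝ) ^ 2 ≤ T ^ (1 + u) := by
      rw [rpow_add hT0, ← hN, rpow_one]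
      field_simp
      linarith
    have b1 : T / (2 * N) / H ≤ 2 * T ^ (1 - u - h) := by
      rw [hM, rpow_sub hT0 _ h]
      calc T ^ (1 - u) / 2 / H ≤ T ^ (1 - u) / 2 / (T ^ h / 4) := by gcongr
        _ = _ := by field_simp; norm_num
    have b2 : k * T ^ ((δ - u) / 2) * √(H : ℝ) ≤ k * T ^ ((δ - u) / 2 + h / 2) := by
      rw [rpow_add hT0, ← mul_assoc]; gcongr
    have b3 : T / (2 * N) / (k * T ^ ((δ - u) / 2)) / √(H : ℝ) ≤
        2 / k * T ^ (1 - u - (δ - u) / 2 - h / 2) := by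
      rw [hM, rpow_sub hT0 _ (h / 2), rpow_sub hT0 (1 - u) _]
      calc T ^ (1 - u) / 2 / (k * T ^ ((δ - u) / 2)) / √(H : ℝ) ≤
          T ^ (1 - u) / 2 / (k * T ^ ((δ - u) / 2)) / (T ^ (h / 2) / 2) := by gcongr
        _ = 1 / k * (T ^ (1 - u) / T ^ ((δ - u) / 2) / T ^ (h / 2)) := by field_simp
        _ ≤ _ := by gcongr; norm_num
    calc _ ≤ T ^ (1 + u) * (2 * T ^ (1 - u - h) + k * T ^ ((δ - u) / 2 + h / 2) +
        2 / k * T ^ (1 - u - (δ - u) / 2 - h / 2)) := by gcongr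
      _ = 2 * T ^ (1 + u + (1 - u - h)) + k * T ^ (1 + u + ((δ - u) / 2 + h / 2)) +
        2 / k * T ^ (1 + u + (1 - u - (δ - u) / 2 - h / 2)) := by
          rw [rpow_add hT0 (1 + u), rpow_add hT0 (1 + u), rpow_add hT0 (1 + u)]; ring
      _ ≤ 2 * T ^ (4 / 3 + δ / 2) + k * T ^ (4 / 3 + δ / 2) +
        2 / k * T ^ (4 / 3 + δ / 2) := by
          gcongr 2 * ?_ + k * ?_ + 2 / k * ?_ <;> exact hmono (by linarith)
      _ = _ := by ring
  have hfin : C * A ^ 2 * ((2 + k + 2 / k) * T ^ (4 / 3 + δ / 2)) =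
      (√(C * (2 + k + 2 / k)) * A * T ^ (2 / 3 + δ / 4)) ^ 2 := by
    rw [mul_pow, mul_pow, Real.sq_sqrt (by positivity), ← rpow_natCast (T ^ (2 / 3 + δ / 4)),
      ← rpow_mul hT0.le, show (2 / 3 + δ / 4) * ((2 : ℕ) : ℝ) = 4 / 3 + δ / 2 by push_cast; ring]
    ring
  refine (sq_le_sq₀ (norm_nonneg _) (by positivity)).1 ?_
  rw [← hfin]
  refine key.trans ?_
  rw [mul_assoc]
  gcongr

lemma box_large {δ c : ℝ} (h0 : 2 / 3 ≤ δ) (h1 : δ < 1) (hc : 0 < c) : ∃ C, 0 < C ∧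
    ∀ (T : ℝ) (N : ℕ) (u A : ℝ) (s : Finset ℕ) (a : ℕ → ℂ), 1 ≤ T → (N : ℝ) = T ^ u →
      1 / 3 + δ / 4 ≤ u → 0 ≤ A →
      (∀ m ∈ s, T / (2 * N) ≤ m ∧ (m : ℝ) ≤ 4 * (T / (2 * N))) → (∀ m ∈ s, ‖a m‖ ≤ A) →
      ‖∑ m ∈ s, a m * ∑ n ∈ Ico N (2 * N), trm c δ T (m * n)‖ ≤
        C * A * T ^ (2 / 3 + δ / 4) := by
  obtain ⟨C, hC, hB⟩ := monomial_sum (γ := δ) (R := 2)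
    (mul_ne_zero (by linarith) (by linarith)) (by norm_num)
  set k₁ := √(c * 2 ^ δ) with hk₁
  set k₂ := √(c * (1 / 2) ^ δ) with hk₂
  have hk1 : 0 < k₁ := by positivity
  have hk2 : 0 < k₂ := by positivity
  refine ⟨2 * C * (k₁ + 1 / k₂), by positivity, ?_⟩
  intro T N u A s a hT1 hN hu hA hsM ha
  have hT0 : 0 < T := by linarith
  have hmono : ∀ {x y : ℝ}, x ≤ y → T ^ x ≤ T ^ y := fun h => rpow_le_rpow_of_exponent_le hT1 h
  have hNpos : (0 : ℝ) < N := by rw [hN]; positivity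
  have hN1 : (1 : ℝ) ≤ N := by
    have : 0 < N := by exact_mod_cast hNpos
    exact_mod_cast this
  have hM : 4 * (T / (2 * N)) = 2 * T ^ (1 - u) := by
    rw [hN, rpow_sub hT0, rpow_one]; field_simp; norm_num
  have hcard : (#s : ℝ) ≤ 2 * T ^ (1 - u) := by
    rw [← hM]
    refine card_le_of_subset_Icc (M := 1) le_rfl (by positivity) fun m hm => ⟨?_, (hsM m hm).2⟩
    have : (0 : ℝ) < m := lt_of_lt_of_le (by positivity) (hsM m hm).1
    have : 0 < m := by exact_mod_cast this
    exact_mod_cast this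
  have hsq : ∀ q : ℝ, 0 < q → √(c * (q * T) ^ δ) = √(c * q ^ δ) * T ^ (δ / 2) := by
    intro q hq
    rw [mul_rpow hq.le hT0.le, ← mul_assoc, Real.sqrt_mul (by positivity), sqrt_eq_rpow (T ^ δ),
      ← rpow_mul hT0.le]
    ring_nf
  have hm : ∀ m ∈ s, ‖a m * ∑ n ∈ Ico N (2 * N), trm c δ T (m * n)‖ ≤
      A * (C * (k₁ * T ^ (δ / 2) + T ^ u / (k₂ * T ^ (δ / 2)))) := by
    intro m hm
    have hmb := hsM m hm
    have hm0 : (0 : ℝ) < m := lt_of_lt_of_le (by positivity) hmb.1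
    rw [norm_mul]
    gcongr
    · exact ha m hm
    simp only [trm_mul]
    rw [← sum_filter]
    refine (hB (c * (m : ℝ) ^ δ) N _ (by positivity) hN1 ?_ ?_).trans ?_
    · intro x hx y hy z hxz hzy
      simp only [mem_filter, mem_Ico] at hx hy ⊢
      have e1 : (x : ℝ) ≤ z := by exact_mod_cast hxz
      have e2 : (z : ℝ) ≤ y := by exact_mod_cast hzy
      exact ⟨⟨by omega, by omega⟩, hx.2.1.trans (by gcongr), le_trans (by gcongr) hy.2.2⟩
    · intro n hn
      simp only [mem_filter, mem_Ico] at hn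
      exact ⟨by exact_mod_cast hn.1.1, by exact_mod_cast hn.1.2.le⟩
    · have e1 : |c * (m : ℝ) ^ δ| * (N : ℝ) ^ δ = c * (m * N : ℝ) ^ δ := by
        rw [abs_of_pos (by positivity), mul_rpow hm0.le hNpos.le]; ring
      have l1 : 1 / 2 * T ≤ m * N := by
        have := mul_le_mul_of_nonneg_right hmb.1 hNpos.le
        rw [show T / (2 * N) * N = 1 / 2 * T by field_simp] at this
        exact this
      have l2 : (m * N : ℝ) ≤ 2 * T := by
        have := mul_le_mul_of_nonneg_right hmb.2 hNpos.le
        rw [show 4 * (T / (2 * N)) * N = 2 * T by field_simp; norm_num] at this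
        exact this
      have l3 : √(c * (m * N : ℝ) ^ δ) ≤ k₁ * T ^ (δ / 2) := by
        rw [hk₁, ← hsq 2 two_pos]; gcongr
      have l4 : k₂ * T ^ (δ / 2) ≤ √(c * (m * N : ℝ) ^ δ) := by
        rw [hk₂, ← hsq (1 / 2) (by norm_num)]; gcongr
      rw [e1, ← hN]
      gcongr
  refine (norm_sum_le_of_le _ hm).trans ?_
  rw [sum_const, nsmul_eq_mul]
  calc (#s : ℝ) * (A * (C * (k₁ * T ^ (δ / 2) + T ^ u / (k₂ * T ^ (δ / 2))))) ≤
      2 * T ^ (1 - u) * (A * (C * (k₁ * T ^ (δ / 2) + T ^ u / (k₂ * T ^ (δ / 2))))) := by gcongr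
    _ = 2 * C * A * (k₁ * T ^ (1 - u + δ / 2) + 1 / k₂ * T ^ (1 - u + (u - δ / 2))) := by
      rw [rpow_add hT0 (1 - u), rpow_add hT0 (1 - u), rpow_sub hT0 u]
      field_simp
    _ ≤ 2 * C * A * (k₁ * T ^ (2 / 3 + δ / 4) + 1 / k₂ * T ^ (2 / 3 + δ / 4)) := by
      gcongr 2 * C * A * (k₁ * ?_ + 1 / k₂ * ?_) <;> exact hmono (by linarith)
    _ = _ := by ring

lemma sum_Ico_trm (c δ T : ℝ) {m N : ℕ} (hm : 1 ≤ m) (hN : 1 ≤ N) :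
    ∑ n ∈ Ico N (2 * N), trm c δ T (m * n) =
      ∑ n ∈ Icc (max N ⌈T / (max m 1 : ℕ)⌉₊) (min (2 * N - 1) ⌊2 * T / (max m 1 : ℕ)⌋₊),
        e (c * (m : ℝ) ^ δ * (n : ℝ) ^ δ) := by
  have hm0 : (0 : ℝ) < m := by exact_mod_cast hm
  simp only [trm_mul]
  rw [← sum_filter]
  refine sum_congr ?_ fun _ _ => rfl
  ext n
  rw [max_eq_left hm]
  simp only [mem_filter, mem_Ico, mem_Icc, max_le_iff, le_min_iff, Nat.ceil_le]
  have e1 : T / m ≤ n ↔ T ≤ m * n := by rw [div_le_iff₀ hm0, mul_comm]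
  rw [e1]
  by_cases hn : n = 0
  · constructor <;> rintro ⟨⟨x1, x2⟩, -⟩ <;> omega
  · rw [Nat.le_floor_iff' hn, le_div_iff₀ hm0, mul_comm (n : ℝ)]
    constructor
    · rintro ⟨⟨x1, x2⟩, x3, x4⟩; exact ⟨⟨x1, x3⟩, by omega, x4⟩
    · rintro ⟨⟨x1, x3⟩, x2, x4⟩; exact ⟨⟨x1, by omega⟩, x3, x4⟩

lemma log_ceil_le {x : ℝ} (hx : 0 ≤ x) : Real.log ⌈x⌉₊ ≤ 6 * (x + 1) ^ (1 / 6 : ℝ) := by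
  have h1 : (⌈x⌉₊ : ℝ) ≤ x + 1 := (Nat.ceil_lt_add_one hx).le
  have := Real.log_le_rpow_div (Nat.cast_nonneg ⌈x⌉₊) (show (0 : ℝ) < 1 / 6 by norm_num)
  calc _ ≤ (⌈x⌉₊ : ℝ) ^ (1 / 6 : ℝ) / (1 / 6) := this
    _ ≤ (x + 1) ^ (1 / 6 : ℝ) / (1 / 6) := by gcongr
    _ = _ := by ring

set_option maxHeartbeats 1000000 in
lemma box_mid {δ c : ℝ} (h0 : 2 / 3 ≤ δ) (h1 : δ < 1) (hc : 0 < c) : ∃ C, 0 < C ∧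
    ∀ᶠ T : ℝ in atTop, ∀ (N : ℕ) (u A : ℝ) (s : Finset ℕ) (a : ℕ → ℂ), (N : ℝ) = T ^ u →
      δ / 2 ≤ u → u ≤ 1 / 3 + δ / 4 → 0 ≤ A → IsIntvl s →
      (∀ m ∈ s, T / (2 * N) ≤ m ∧ (m : ℝ) ≤ 4 * (T / (2 * N))) → (∀ m ∈ s, ‖a m‖ ≤ A) →
      ‖∑ m ∈ s, a m * ∑ n ∈ Ico N (2 * N), trm c δ T (m * n)‖ ≤
        C * A * T ^ (2 / 3 + δ / 4) := by
  have hδ : 0 < δ := by linarith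
  have hl := lft_pos hδ
  obtain ⟨C, hC, hB⟩ := norm_bilinear_le_of_dual (by linarith : 1 / 2 < δ) h1 hc
  set r := 2 / lft δ with hr
  have hr0 : 0 < r := by positivity
  set k := c * (1 / 2) ^ δ * r ^ (δ - 1) with hk
  have hk0 : 0 < k := by positivity
  set q := min 1 k / 2 with hq
  have hq0 : 0 < q := by positivity
  have hq1 : q ≤ 1 := by have := min_le_left 1 k; linarith
  have hqk : q ≤ k / 2 := by have := min_le_right 1 k; linarith
  set K := 2 * δ * c * 2 ^ δ with hK
  have hK0 : 0 < K := by positivity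
  set B₁ := 2 * (1 + 6 * (K + 1) ^ (1 / 6 : ℝ) + 2 / c) with hB₁
  set G := k ^ 2 / 2 * (1 / (2 * q) + √r * √2 + 1 / (2 * √r * √q)) with hG
  have hG0 : 0 < G := by positivity
  refine ⟨C * (B₁ + (r + 1 / k) * √G), by positivity, ?_⟩
  have hev : ∀ᶠ T : ℝ in atTop, max 2 (2 / k) ≤ T ^ (1 / 6 : ℝ) :=
    (tendsto_rpow_atTop (by norm_num)).eventually_ge_atTop _
  filter_upwards [hev, eventually_ge_atTop 1] with T hT6 hT1 N u A s a hN hu1 hu2 hA hs hsM ha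
  have hT0 : 0 < T := by linarith
  have hmono : ∀ {x y : ℝ}, x ≤ y → T ^ x ≤ T ^ y := fun h => rpow_le_rpow_of_exponent_le hT1 h
  have hsqrt : ∀ x : ℝ, √(T ^ x) = T ^ (x / 2) := fun x => by
    rw [sqrt_eq_rpow, ← rpow_mul hT0.le]; ring_nf
  have hM : T / (2 * N) = T ^ (1 - u) / 2 := by
    rw [hN, rpow_sub hT0, rpow_one]; field_simp
  have hNpos : (0 : ℝ) < N := by rw [hN]; positivity
  have hN1 : 1 ≤ N := by
    have : 0 < N := by exact_mod_cast hNpos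
    exact this
  have hT2 : 2 ≤ T ^ (1 / 6 : ℝ) := (le_max_left _ _).trans hT6
  have hTk : 2 / k ≤ T ^ (1 / 6 : ℝ) := (le_max_right _ _).trans hT6
  have hM1 : 1 ≤ T / (2 * N) := by
    rw [hM]
    have : T ^ (1 / 6 : ℝ) ≤ T ^ (1 - u) := hmono (by linarith)
    linarith
  have hm1 : ∀ m ∈ s, 1 ≤ m := fun m hm => by
    have := hM1.trans (hsM m hm).1
    exact_mod_cast this
  set ρ₀ := r * T ^ u with hρ
  have hρ0 : 0 < ρ₀ := by positivity
  have hlρ : lft δ * ρ₀ = 2 * N := by rw [hρ, hr, hN]; field_simp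
  have hN' : c * (T / (2 * N)) ^ δ * ρ₀ ^ (δ - 1) = k * T ^ (δ - u) := by
    rw [hM, hρ, hk, mul_rpow hr0.le (by positivity), div_rpow (by positivity) (by norm_num),
      ← rpow_mul hT0.le, ← rpow_mul hT0.le, one_div, Real.inv_rpow (by norm_num),
      show δ - u = (1 - u) * δ + u * (δ - 1) by ring, rpow_add hT0]
    field_simp
  set h := 2 / 3 + δ / 2 - 2 * u with hh
  have hTh : 1 ≤ T ^ h := by
    have := hmono (show 0 ≤ h by linarith)
    rwa [rpow_zero] at this
  have hTh0 : 0 < T ^ h := by positivity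
  set H := ⌈q * T ^ h⌉₊ with hH
  have hH1 : q * T ^ h ≤ H := Nat.le_ceil _
  have hH2 : (H : ℝ) ≤ q * T ^ h + 1 := (Nat.ceil_lt_add_one (by positivity)).le
  have hH3 : 1 ≤ H := Nat.one_le_ceil_iff.2 (by positivity)
  have hH4 : (H : ℝ) ≤ 2 * T ^ h := by
    have : q * T ^ h ≤ 1 * T ^ h := by gcongr
    linarith
  have hH5 : (H : ℝ) ≤ c * (T / (2 * N)) ^ δ * ρ₀ ^ (δ - 1) := by
    rw [hN']
    have e1 : q * T ^ h ≤ k / 2 * T ^ (δ - u) := by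
      have : T ^ h ≤ T ^ (δ - u) := hmono (by linarith)
      gcongr
    have e2 : 2 / k ≤ T ^ (δ - u) := hTk.trans (hmono (by linarith))
    rw [div_le_iff₀ hk0] at e2
    linarith
  set κ := ⌈K * T ^ (δ - u)⌉₊ with hκ
  have hκ1 : 1 ≤ κ := Nat.one_le_ceil_iff.2 (by positivity)
  set ω := T ^ (-(δ / 2)) with hω
  have hω0 : 0 < ω := by positivity
  have hω1 : ω ≤ 1 := by
    have := hmono (show -(δ / 2) ≤ 0 by linarith)
    rwa [rpow_zero] at this
  have key := hB (T / (2 * N)) ρ₀ A ω (2 / c * T ^ (u - δ / 2)) H κ s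
    (fun m => max N ⌈T / (max m 1 : ℕ)⌉₊) (fun m => min (2 * N - 1) ⌊2 * T / (max m 1 : ℕ)⌋₊) a
    hM1 hρ0 hA hH3 hH5 hs hsM
    (by
      intro x y hxy
      dsimp only
      have : (0 : ℝ) < (max x 1 : ℕ) := by positivity
      gcongr)
    (by
      intro x y hxy
      dsimp only
      have : (0 : ℝ) < (max x 1 : ℕ) := by positivity
      gcongr)
    (by
      intro m hm
      rw [hlρ]
      constructor
      · push_cast
        exact le_trans (by linarith) (le_max_left _ _)
      · have : min (2 * N - 1) ⌊2 * T / (max m 1 : ℕ)⌋₊ ≤ 2 * N :=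
          (min_le_left _ _).trans (Nat.sub_le _ _)
        exact_mod_cast this)
    ha hω0 hω1 hκ1 (fun m _ => hN1.trans (le_max_left _ _)) (by positivity)
    (by
      intro m hm hab
      have hmm : (max m 1 : ℕ) = m := max_eq_left (hm1 m hm)
      have hm0 : (0 : ℝ) < m := by exact_mod_cast hm1 m hm
      rw [hmm] at hab ⊢
      set x := max N ⌈T / (m : ℝ)⌉₊ with hx
      set y := min (2 * N - 1) ⌊2 * T / (m : ℝ)⌋₊ with hy
      have hxN : (N : ℝ) ≤ x := by exact_mod_cast le_max_left _ _
      have hyN : (y : ℝ) ≤ 2 * N := by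
        have : y ≤ 2 * N := (min_le_left _ _).trans (Nat.sub_le _ _)
        exact_mod_cast this
      have hxy : (x : ℝ) ≤ y := by exact_mod_cast hab
      have hx0 : (0 : ℝ) < x := by linarith
      have hxT : T ≤ m * x := by
        have : T / m ≤ x := (Nat.le_ceil _).trans (by exact_mod_cast le_max_right _ _)
        rwa [div_le_iff₀ hm0, mul_comm] at this
      have hyT : m * y ≤ 2 * T := by
        have : (y : ℝ) ≤ 2 * T / m :=
          le_trans (by exact_mod_cast min_le_right _ _) (Nat.floor_le (by positivity))
        rwa [le_div_iff₀ hm0, mul_comm] at this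
      have hprod : ∀ z : ℝ, 0 < z → c * (m : ℝ) ^ δ * z ^ (δ - 1) = c * (m * z) ^ δ / z := by
        intro z hz
        rw [mul_rpow hm0.le hz.le, rpow_sub_one hz.ne']
        ring
      constructor
      · refine le_trans ?_ (Nat.le_ceil _)
        calc 2 * (c * (m : ℝ) ^ δ * (δ * (x : ℝ) ^ (δ - 1))) =
            2 * δ * (c * (m : ℝ) ^ δ * (x : ℝ) ^ (δ - 1)) := by ring
          _ = 2 * δ * (c * (m * x) ^ δ / x) := by rw [hprod x hx0]
          _ ≤ 2 * δ * (c * (2 * T) ^ δ / N) := by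
            have : m * (x : ℝ) ≤ 2 * T := le_trans (by gcongr) hyT
            gcongr
          _ = K * T ^ (δ - u) := by
            rw [mul_rpow two_pos.le hT0.le, rpow_sub hT0, hN, hK]; ring
      · have hy0 : (0 : ℝ) < y := by linarith
        rw [hprod y hy0]
        calc 1 / (ω * (c * (m * y) ^ δ / y)) ≤ 1 / (ω * (c * T ^ δ / (2 * N))) := by
              have : T ≤ m * (y : ℝ) := hxT.trans (by gcongr)
              gcongr
          _ = 2 / c * T ^ (u - δ / 2) := by
            rw [hω, show u - δ / 2 = u - -(δ / 2) - δ by ring, rpow_sub hT0, rpow_sub hT0, hN]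
            field_simp)
  have eS : ∑ m ∈ s, a m * ∑ n ∈ Ico N (2 * N), trm c δ T (m * n) =
      ∑ m ∈ s, a m * ∑ n ∈ Icc (max N ⌈T / (max m 1 : ℕ)⌉₊)
        (min (2 * N - 1) ⌊2 * T / (max m 1 : ℕ)⌋₊), e (c * (m : ℝ) ^ δ * (n : ℝ) ^ δ) :=
    sum_congr rfl fun m hm => by rw [sum_Ico_trm c δ T (hm1 m hm) hN1]
  rw [eS]
  refine key.trans ?_
  rw [hN']
  have hcard : (#s : ℝ) ≤ 2 * T ^ (1 - u) := by
    have := card_le_of_subset_Icc (M := 1) (B := 4 * (T / (2 * N))) le_rfl (by positivity)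
      (s := s) fun m hm => ⟨by exact_mod_cast hm1 m hm, (hsM m hm).2⟩
    rw [hM] at this
    linarith
  have hp1 : #s * (1 + Real.log κ + 2 / c * T ^ (u - δ / 2)) ≤ B₁ * T ^ (2 / 3 + δ / 4) := by
    have l1 : Real.log κ ≤ 6 * (K + 1) ^ (1 / 6 : ℝ) * T ^ (1 / 6 : ℝ) := by
      refine (log_ceil_le (by positivity)).trans ?_
      rw [mul_assoc 6 ((K + 1) ^ (1 / 6 : ℝ)), ← mul_rpow (by positivity) hT0.le]
      have : T ^ (δ - u) ≤ T := by
        have := hmono (show δ - u ≤ 1 by linarith)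
        rwa [rpow_one] at this
      have h₁ : K * T ^ (δ - u) ≤ K * T := mul_le_mul_of_nonneg_left this hK0.le
      have h₂ : K * T ^ (δ - u) + 1 ≤ (K + 1) * T := by linarith
      exact mul_le_mul_of_nonneg_left (rpow_le_rpow (by positivity) h₂ (by norm_num)) (by norm_num)
    calc #s * (1 + Real.log κ + 2 / c * T ^ (u - δ / 2)) ≤
        2 * T ^ (1 - u) * (1 + 6 * (K + 1) ^ (1 / 6 : ℝ) * T ^ (1 / 6 : ℝ) +
          2 / c * T ^ (u - δ / 2)) := by
          have := Real.log_natCast_nonneg κ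
          gcongr
      _ = 2 * (T ^ (1 - u) + 6 * (K + 1) ^ (1 / 6 : ℝ) * T ^ (1 - u + 1 / 6) +
          2 / c * T ^ (1 - u + (u - δ / 2))) := by
          rw [rpow_add hT0 (1 - u), rpow_add hT0 (1 - u)]; ring
      _ ≤ 2 * (T ^ (2 / 3 + δ / 4) + 6 * (K + 1) ^ (1 / 6 : ℝ) * T ^ (2 / 3 + δ / 4) +
          2 / c * T ^ (2 / 3 + δ / 4)) := by
          gcongr 2 * (?_ + 6 * (K + 1) ^ (1 / 6 : ℝ) * ?_ + 2 / c * ?_) <;>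
            exact hmono (by linarith)
      _ = _ := by rw [hB₁]; ring
  have hp2 : ρ₀ * ω + 1 / (ω * (k * T ^ (δ - u))) = (r + 1 / k) * T ^ (u - δ / 2) := by
    have x1 : ρ₀ * ω = r * T ^ (u - δ / 2) := by
      rw [hρ, hω, mul_assoc, ← rpow_add hT0]; ring_nf
    have x2 : ω * T ^ (δ - u) * T ^ (u - δ / 2) = 1 := by
      rw [hω, ← rpow_add hT0, ← rpow_add hT0]
      ring_nf
      exact rpow_zero T
    rw [x1, add_mul]
    congr 1
    rw [one_div, inv_eq_of_mul_eq_one_left]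
    calc 1 / k * T ^ (u - δ / 2) * (ω * (k * T ^ (δ - u))) =
        k / k * (ω * T ^ (δ - u) * T ^ (u - δ / 2)) := by ring
      _ = 1 := by rw [x2, div_self hk0.ne', one_mul]
  have hp3 : T / (2 * N) * (k * T ^ (δ - u)) ^ 2 *
      (T / (2 * N) / H + √ρ₀ * √(H : ℝ) + T / (2 * N) / √ρ₀ / √(H : ℝ)) ≤
      G * T ^ (4 / 3 + 3 * δ / 2 - 2 * u) := by
    have sρ : √ρ₀ = √r * T ^ (u / 2) := by rw [hρ, Real.sqrt_mul hr0.le, hsqrt]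
    have s1 : √(H : ℝ) ≤ √2 * T ^ (h / 2) := by
      rw [← hsqrt, ← Real.sqrt_mul two_pos.le]
      exact Real.sqrt_le_sqrt hH4
    have s2 : √q * T ^ (h / 2) ≤ √(H : ℝ) := by
      rw [← hsqrt, ← Real.sqrt_mul hq0.le]
      exact Real.sqrt_le_sqrt hH1
    have e0 : T / (2 * N) * (k * T ^ (δ - u)) ^ 2 = k ^ 2 / 2 * T ^ (1 + 2 * δ - 3 * u) := by
      rw [hM, show 1 + 2 * δ - 3 * u = (1 - u) + ((δ - u) + (δ - u)) by ring, rpow_add hT0,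
        rpow_add hT0]
      ring
    have b1 : T / (2 * N) / H ≤ 1 / (2 * q) * T ^ (1 - u - h) := by
      rw [hM, rpow_sub hT0 _ h]
      calc T ^ (1 - u) / 2 / H ≤ T ^ (1 - u) / 2 / (q * T ^ h) := by gcongr
        _ = _ := by field_simp
    have b2 : √ρ₀ * √(H : ℝ) ≤ √r * √2 * T ^ (u / 2 + h / 2) := by
      rw [sρ, rpow_add hT0]
      calc √r * T ^ (u / 2) * √(H : ℝ) ≤ √r * T ^ (u / 2) * (√2 * T ^ (h / 2)) := by gcongr
        _ = _ := by ring
    have b3 : T / (2 * N) / √ρ₀ / √(H : ℝ) ≤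
        1 / (2 * √r * √q) * T ^ (1 - u - u / 2 - h / 2) := by
      rw [hM, sρ, rpow_sub hT0 _ (h / 2), rpow_sub hT0 (1 - u) _]
      calc T ^ (1 - u) / 2 / (√r * T ^ (u / 2)) / √(H : ℝ) ≤
          T ^ (1 - u) / 2 / (√r * T ^ (u / 2)) / (√q * T ^ (h / 2)) := by gcongr
        _ = _ := by field_simp
    rw [e0, hG]
    calc _ ≤ k ^ 2 / 2 * T ^ (1 + 2 * δ - 3 * u) * (1 / (2 * q) * T ^ (1 - u - h) +
        √r * √2 * T ^ (u / 2 + h / 2) + 1 / (2 * √r * √q) * T ^ (1 - u - u / 2 - h / 2)) := by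
          gcongr
      _ = k ^ 2 / 2 * (1 / (2 * q) * T ^ (1 + 2 * δ - 3 * u + (1 - u - h)) +
        √r * √2 * T ^ (1 + 2 * δ - 3 * u + (u / 2 + h / 2)) +
        1 / (2 * √r * √q) * T ^ (1 + 2 * δ - 3 * u + (1 - u - u / 2 - h / 2))) := by
          rw [rpow_add hT0 (1 + 2 * δ - 3 * u), rpow_add hT0 (1 + 2 * δ - 3 * u),
            rpow_add hT0 (1 + 2 * δ - 3 * u)]
          ring
      _ ≤ k ^ 2 / 2 * (1 / (2 * q) * T ^ (4 / 3 + 3 * δ / 2 - 2 * u) +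
        √r * √2 * T ^ (4 / 3 + 3 * δ / 2 - 2 * u) +
        1 / (2 * √r * √q) * T ^ (4 / 3 + 3 * δ / 2 - 2 * u)) := by
          gcongr k ^ 2 / 2 * (1 / (2 * q) * ?_ + √r * √2 * ?_ + 1 / (2 * √r * √q) * ?_) <;>
            exact hmono (by linarith)
      _ = _ := by ring
  have hp4 : (r + 1 / k) * T ^ (u - δ / 2) * √(T / (2 * N) * (k * T ^ (δ - u)) ^ 2 *
      (T / (2 * N) / H + √ρ₀ * √(H : ℝ) + T / (2 * N) / √ρ₀ / √(H : ℝ))) ≤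
      (r + 1 / k) * √G * T ^ (2 / 3 + δ / 4) := by
    calc _ ≤ (r + 1 / k) * T ^ (u - δ / 2) * √(G * T ^ (4 / 3 + 3 * δ / 2 - 2 * u)) := by
          gcongr
      _ = (r + 1 / k) * √G * (T ^ (u - δ / 2) * T ^ ((4 / 3 + 3 * δ / 2 - 2 * u) / 2)) := by
          rw [Real.sqrt_mul hG0.le, hsqrt]; ring
      _ = _ := by rw [← rpow_add hT0]; ring_nf
  rw [hp2]
  calc _ ≤ C * A * (B₁ * T ^ (2 / 3 + δ / 4) + (r + 1 / k) * √G * T ^ (2 / 3 + δ / 4)) := by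
        gcongr
    _ = _ := by ring

lemma exists_card_divisors_le {η : ℝ} (hη : 0 < η) : ∃ C, 0 < C ∧ ∀ n : ℕ, n ≠ 0 →
    (#n.divisors : ℝ) ≤ C * (n : ℝ) ^ η := by
  have hl2 : 0 < Real.log 2 := Real.log_pos one_lt_two
  set K := 1 + 1 / (η * Real.log 2) with hK
  have hK1 : 1 ≤ K := by
    have : 0 ≤ 1 / (η * Real.log 2) := by positivity
    linarith
  obtain ⟨P, hP⟩ := exists_nat_ge ((2 : ℝ) ^ (1 / η))
  refine ⟨K ^ P, by positivity, fun n hn => ?_⟩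
  have hpow : (n : ℝ) ^ η = ∏ p ∈ n.primeFactors, ((p : ℝ) ^ η) ^ n.factorization p := by
    conv_lhs => rw [← Nat.prod_factorization_pow_eq_self hn]
    rw [Finsupp.prod, Nat.cast_prod, ← Real.finsetProd_rpow _ _ fun _ _ => by positivity]
    refine prod_congr (Nat.support_factorization n) fun p _ => ?_
    rw [Nat.cast_pow, ← rpow_natCast, ← rpow_natCast, ← rpow_mul (by positivity),
      ← rpow_mul (by positivity), mul_comm]
  have hfac : ∀ p ∈ n.primeFactors, ((n.factorization p + 1 : ℕ) : ℝ) ≤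
      (if p < P then K else 1) * ((p : ℝ) ^ η) ^ n.factorization p := by
    intro p hp
    have hp2 : (2 : ℝ) ≤ p := by exact_mod_cast (Nat.prime_of_mem_primeFactors hp).two_le
    push_cast
    set v := n.factorization p
    split_ifs with hpP
    · have h1 : 1 + η * Real.log 2 ≤ (p : ℝ) ^ η := by
        calc 1 + η * Real.log 2 ≤ Real.exp (Real.log 2 * η) := by
              have := Real.add_one_le_exp (Real.log 2 * η); linarith
          _ = (2 : ℝ) ^ η := (rpow_def_of_pos two_pos _).symm
          _ ≤ _ := by gcongr
      have h2 : 1 + v * (η * Real.log 2) ≤ ((p : ℝ) ^ η) ^ v :=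
        (one_add_mul_le_pow (by have := mul_pos hη hl2; linarith) v).trans (by gcongr)
      calc (v + 1 : ℝ) ≤ K * (1 + v * (η * Real.log 2)) := by
            have : K * (1 + v * (η * Real.log 2)) =
              v + 1 + v * (η * Real.log 2) + 1 / (η * Real.log 2) := by
              rw [hK]; field_simp; ring
            rw [this]
            have : 0 ≤ v * (η * Real.log 2) + 1 / (η * Real.log 2) := by positivity
            linarith
        _ ≤ _ := by gcongr
    · have h1 : (2 : ℝ) ≤ (p : ℝ) ^ η := by
        have : (2 : ℝ) ^ (1 / η) ≤ p := hP.trans (by exact_mod_cast not_lt.1 hpP)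
        calc (2 : ℝ) = ((2 : ℝ) ^ (1 / η)) ^ η := by
              rw [← rpow_mul two_pos.le, one_div_mul_cancel hη.ne', rpow_one]
          _ ≤ _ := by gcongr
      rw [one_mul]
      calc (v + 1 : ℝ) ≤ 2 ^ v := by exact_mod_cast Nat.lt_two_pow_self
        _ ≤ _ := by gcongr
  rw [Nat.card_divisors hn, Nat.cast_prod, hpow]
  refine (prod_le_prod (fun _ _ => Nat.cast_nonneg _) hfac).trans ?_
  rw [prod_mul_distrib]
  gcongr
  rw [prod_ite, prod_const, prod_const_one, mul_one]
  refine pow_le_pow_right₀ hK1 ?_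
  calc #(n.primeFactors.filter (· < P)) ≤ #(range P) :=
        card_le_card fun p hp => mem_range.2 (mem_filter.1 hp).2
    _ = P := card_range P

lemma box_bound {δ c : ℝ} (h0 : 2 / 3 ≤ δ) (h1 : δ < 1) (hc : 0 < c) : ∃ C, 0 < C ∧
    ∀ᶠ T : ℝ in atTop, ∀ (N : ℕ) (A : ℝ) (s : Finset ℕ) (a : ℕ → ℂ),
      T ^ (1 / 3 : ℝ) / 2 ≤ N → 0 ≤ A → IsIntvl s →
      (∀ m ∈ s, T / (2 * N) ≤ m ∧ (m : ℝ) ≤ 4 * (T / (2 * N))) → (∀ m ∈ s, ‖a m‖ ≤ A) →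
      ‖∑ m ∈ s, a m * ∑ n ∈ Ico N (2 * N), trm c δ T (m * n)‖ ≤
        C * A * T ^ (2 / 3 + δ / 4) := by
  obtain ⟨C₁, hC₁, hB₁⟩ := box_small h0 h1 hc
  obtain ⟨C₂, hC₂, hB₂⟩ := box_mid h0 h1 hc
  obtain ⟨C₃, hC₃, hB₃⟩ := box_large h0 h1 hc
  refine ⟨C₁ + C₂ + C₃, by positivity, ?_⟩
  filter_upwards [hB₂, eventually_ge_atTop 4096] with T hB₂ hT N A s a hN hA hs hsM ha
  have hT0 : 0 < T := by linarith
  have hN0 : (0 : ℝ) < N := lt_of_lt_of_le (by positivity) hN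
  have hNu : (N : ℝ) = T ^ Real.logb T N := (Real.rpow_logb hT0 (by linarith) hN0).symm
  rcases le_total (Real.logb T N) (δ / 2) with h | h
  · refine (hB₁ T N _ A s a hT hNu hN h hA hs hsM ha).trans ?_
    gcongr; linarith
  rcases le_total (Real.logb T N) (1 / 3 + δ / 4) with h' | h'
  · refine (hB₂ N _ A s a hNu h h' hA hs hsM ha).trans ?_
    gcongr; linarith
  · refine (hB₃ T N _ A s a (by linarith) hNu h' hA hsM ha).trans ?_
    gcongr; linarith

lemma sum_product_eq {X Y s : Finset ℕ} {f : ℕ → ℂ} (hf : ∀ m, m ∉ s → f m = 0) :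
    ∑ x ∈ X, ∑ y ∈ Y, f (x * y) =
      ∑ m ∈ s, (#((X ×ˢ Y).filter fun p => p.1 * p.2 = m) : ℂ) * f m := by
  rw [← sum_product']
  have : ∑ p ∈ X ×ˢ Y, f (p.1 * p.2) = ∑ p ∈ (X ×ˢ Y).filter (fun p => p.1 * p.2 ∈ s),
      f (p.1 * p.2) := by
    rw [sum_filter]
    refine sum_congr rfl fun p _ => ?_
    split_ifs with h
    · rfl
    · exact hf _ h
  rw [this, ← sum_fiberwise_of_maps_to (s := (X ×ˢ Y).filter (fun p => p.1 * p.2 ∈ s)) (t := s)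
    (g := fun p : ℕ × ℕ => p.1 * p.2) fun p hp => (mem_filter.1 hp).2]
  refine sum_congr rfl fun m hm => ?_
  rw [filter_filter, ← nsmul_eq_mul, ← sum_const]
  refine sum_congr ?_ fun p hp => ?_
  · ext p
    simp only [mem_filter]
    constructor
    · rintro ⟨h1, -, h2⟩; exact ⟨h1, h2⟩
    · rintro ⟨h1, h2⟩; exact ⟨h1, h2 ▸ hm, h2⟩
  · rw [(mem_filter.1 hp).2]

lemma card_product_filter_le (X Y : Finset ℕ) {m : ℕ} (hm : m ≠ 0) :
    #((X ×ˢ Y).filter fun p => p.1 * p.2 = m) ≤ #m.divisors := by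
  refine card_le_card_of_injOn Prod.fst (fun p hp => ?_) fun p hp q hq hpq => ?_
  · have := (mem_filter.1 hp).2
    exact Nat.mem_divisors.2 ⟨⟨p.2, this.symm⟩, hm⟩
  · have e1 := (mem_filter.1 hp).2
    have e2 := (mem_filter.1 hq).2
    have hp0 : 0 < p.1 := Nat.pos_of_ne_zero fun h => hm (by rw [← e1, h, zero_mul])
    refine Prod.ext hpq (Nat.eq_of_mul_eq_mul_left hp0 ?_)
    rw [e1, hpq, e2]

lemma triple_box_bound {δ c η : ℝ} (h0 : 2 / 3 ≤ δ) (h1 : δ < 1) (hc : 0 < c) (hη : 0 < η) :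
    ∃ C, 0 < C ∧ ∀ᶠ T : ℝ in atTop, ∀ (N : ℕ) (X Y : Finset ℕ), T ^ (1 / 3 : ℝ) / 2 ≤ N →
      ‖∑ x ∈ X, ∑ y ∈ Y, ∑ n ∈ Ico N (2 * N), trm c δ T (x * y * n)‖ ≤
        C * T ^ η * T ^ (2 / 3 + δ / 4) := by
  obtain ⟨C, hC, hB⟩ := box_bound h0 h1 hc
  obtain ⟨C', hC', hd⟩ := exists_card_divisors_le hη
  refine ⟨C * (C' * 4 ^ η), by positivity, ?_⟩
  filter_upwards [hB, eventually_ge_atTop 4096] with T hB hT N X Y hN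
  have hT0 : 0 < T := by linarith
  have hN0 : (0 : ℝ) < N := lt_of_lt_of_le (by positivity) hN
  have hN1 : (1 : ℝ) ≤ N := by
    have : 0 < N := by exact_mod_cast hN0
    exact_mod_cast this
  have hM : 4 * (T / (2 * N)) = 2 * T / N := by field_simp; norm_num
  set s := Icc ⌈T / (2 * N)⌉₊ ⌊4 * (T / (2 * N))⌋₊ with hs
  have hmem : ∀ m ∈ s, T / (2 * N) ≤ m ∧ (m : ℝ) ≤ 4 * (T / (2 * N)) := by
    intro m hm
    rw [hs, mem_Icc] at hm
    exact ⟨(Nat.le_ceil _).trans (by exact_mod_cast hm.1),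
      le_trans (by exact_mod_cast hm.2) (Nat.floor_le (by positivity))⟩
  rw [sum_product_eq (s := s) (f := fun m => ∑ n ∈ Ico N (2 * N), trm c δ T (m * n))]
  · refine (hB N (C' * (4 * T) ^ η) s _ hN (by positivity) ?_ hmem ?_).trans ?_
    · intro x hx y hy z hxz hzy
      rw [hs, mem_Icc] at hx hy ⊢
      omega
    · intro m hm
      have hmb := hmem m hm
      have hm0 : (0 : ℝ) < m := lt_of_lt_of_le (by positivity) hmb.1
      have hm1 : m ≠ 0 := by rintro rfl; simp at hm0
      rw [Complex.norm_natCast]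
      calc (_ : ℝ) ≤ #m.divisors := by exact_mod_cast card_product_filter_le X Y hm1
        _ ≤ C' * (m : ℝ) ^ η := hd m hm1
        _ ≤ _ := by
          have : T / (2 * N) ≤ T := div_le_self hT0.le (by linarith)
          have : (m : ℝ) ≤ 4 * T := by linarith
          gcongr
    · rw [mul_rpow (by norm_num) hT0.le]
      exact le_of_eq (by ring)
  · intro m hm
    refine sum_eq_zero fun n hn => ?_
    rw [trm_mul, if_neg]
    rintro ⟨x1, x2⟩
    refine hm ?_
    rw [mem_Ico] at hn
    have e1 : (N : ℝ) ≤ n := by exact_mod_cast hn.1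
    have e2 : (n : ℝ) ≤ 2 * N := by exact_mod_cast hn.2.le
    have e3 : (0 : ℝ) ≤ m := Nat.cast_nonneg m
    rw [hs, mem_Icc, Nat.ceil_le]
    constructor
    · rw [div_le_iff₀ (by positivity)]
      exact x1.trans (by gcongr)
    · refine Nat.le_floor ?_
      rw [hM, le_div_iff₀ hN0]
      exact le_trans (by gcongr) x2

lemma sum_Ico_one_two_pow (f : ℕ → ℂ) (L : ℕ) :
    ∑ x ∈ Ico 1 (2 ^ L), f x = ∑ i ∈ range L, ∑ x ∈ Ico (2 ^ i) (2 * 2 ^ i), f x := by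
  induction L with
  | zero => simp
  | succ L ih =>
    rw [sum_range_succ, ← ih, pow_succ', sum_Ico_consecutive _ Nat.one_le_two_pow (by omega)]

lemma trm_neg (c δ T : ℝ) (n : ℕ) : trm (-c) δ T n = (starRingEnd ℂ) (trm c δ T n) := by
  unfold trm
  split_ifs
  · rw [neg_mul, e_neg]
  · simp

lemma sum_trm_eq_zero {c δ T : ℝ} {i j k : ℕ} (hi : i ≤ k) (hj : j ≤ k)
    (hk : (2 : ℝ) * 2 ^ k ≤ T ^ (1 / 3 : ℝ)) (hT : 0 < T) :
    ∑ x ∈ Ico (2 ^ i) (2 * 2 ^ i), ∑ y ∈ Ico (2 ^ j) (2 * 2 ^ j),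
      ∑ z ∈ Ico (2 ^ k) (2 * 2 ^ k), trm c δ T (x * y * z) = 0 := by
  refine sum_eq_zero fun x hx => sum_eq_zero fun y hy => sum_eq_zero fun z hz => ?_
  have h : ∀ {l w : ℕ}, l ≤ k → w ∈ Ico (2 ^ l) (2 * 2 ^ l) → (w : ℝ) < T ^ (1 / 3 : ℝ) := by
    intro l w hl hw
    have h1 : w < 2 * 2 ^ k :=
      (mem_Ico.1 hw).2.trans_le (Nat.mul_le_mul_left 2 (Nat.pow_le_pow_right two_pos hl))
    have h2 : (w : ℝ) < 2 * 2 ^ k := by exact_mod_cast h1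
    linarith
  rw [trm, if_neg]
  rintro ⟨h1, -⟩
  refine absurd h1 (not_le.2 ?_)
  push_cast
  calc (x : ℝ) * y * z < T ^ (1 / 3 : ℝ) * T ^ (1 / 3 : ℝ) * T ^ (1 / 3 : ℝ) := by
        have hx' := h hi hx
        have hy' := h hj hy
        have hz' := h le_rfl hz
        gcongr
    _ = T := by
        rw [← rpow_add hT, ← rpow_add hT]; norm_num

lemma dyadic_box_bound {δ c η : ℝ} (h0 : 2 / 3 ≤ δ) (h1 : δ < 1) (hc : 0 < c) (hη : 0 < η) :
    ∃ C, 0 < C ∧ ∀ᶠ T : ℝ in atTop, ∀ i j k : ℕ,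
      ‖∑ x ∈ Ico (2 ^ i) (2 * 2 ^ i), ∑ y ∈ Ico (2 ^ j) (2 * 2 ^ j),
        ∑ z ∈ Ico (2 ^ k) (2 * 2 ^ k), trm c δ T (x * y * z)‖ ≤
        C * T ^ η * T ^ (2 / 3 + δ / 4) := by
  obtain ⟨C, hC, hB⟩ := triple_box_bound h0 h1 hc hη
  refine ⟨C, hC, ?_⟩
  filter_upwards [hB, eventually_gt_atTop 0] with T hB hT
  have key : ∀ i j k : ℕ, i ≤ k → j ≤ k →
      ‖∑ x ∈ Ico (2 ^ i) (2 * 2 ^ i), ∑ y ∈ Ico (2 ^ j) (2 * 2 ^ j),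
        ∑ z ∈ Ico (2 ^ k) (2 * 2 ^ k), trm c δ T (x * y * z)‖ ≤
        C * T ^ η * T ^ (2 / 3 + δ / 4) := by
    intro i j k hi hj
    rcases le_total ((2 : ℝ) * 2 ^ k) (T ^ (1 / 3 : ℝ)) with h | h
    · rw [sum_trm_eq_zero hi hj h hT, norm_zero]; positivity
    · refine hB (2 ^ k) _ _ ?_
      push_cast
      linarith
  intro i j k
  rcases le_total i k with hik | hki
  · rcases le_total j k with hjk | hkj
    · exact key i j k hik hjk
    · have := key i k j (hik.trans hkj) hkj
      refine le_of_eq_of_le (congrArg _ ?_) this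
      refine sum_congr rfl fun x _ => ?_
      rw [sum_comm]
      exact sum_congr rfl fun z _ => sum_congr rfl fun y _ => by rw [mul_right_comm]
  · rcases le_total j i with hji | hij
    · have := key k j i hki hji
      refine le_of_eq_of_le (congrArg _ ?_) this
      rw [sum_comm]
      simp_rw [sum_comm (s := Ico (2 ^ i) (2 * 2 ^ i))]
      rw [sum_comm]
      exact sum_congr rfl fun z _ => sum_congr rfl fun y _ => sum_congr rfl fun x _ => by
        congr 1; ring
    · have := key i k j hij (hki.trans hij)
      refine le_of_eq_of_le (congrArg _ ?_) this
      refine sum_congr rfl fun x _ => ?_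
      rw [sum_comm]
      exact sum_congr rfl fun z _ => sum_congr rfl fun y _ => by rw [mul_right_comm]

lemma full_sum_bound {δ c η : ℝ} (h0 : 2 / 3 ≤ δ) (h1 : δ < 1) (hc : 0 < c) (hη : 0 < η) :
    ∃ C, 0 < C ∧ ∀ᶠ T : ℝ in atTop,
      ‖∑ x ∈ Icc 1 ⌊2 * T⌋₊, ∑ y ∈ Icc 1 ⌊2 * T⌋₊, ∑ z ∈ Icc 1 ⌊2 * T⌋₊,
        trm c δ T (x * y * z)‖ ≤ C * T ^ (2 / 3 + δ / 4 + η) := by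
  set η' := η / 4 with hη'
  have hη0 : 0 < η' := by positivity
  obtain ⟨C, hC, hB⟩ := dyadic_box_bound h0 h1 hc hη0
  set Q := (2 / η' * 4 ^ η') with hQ
  have hQ0 : 0 < Q := by positivity
  refine ⟨Q ^ 3 * C, by positivity, ?_⟩
  filter_upwards [hB, eventually_ge_atTop 1] with T hB hT
  have hT0 : 0 < T := by linarith
  set W := ⌊2 * T⌋₊ with hW
  have hW0 : W ≠ 0 := (Nat.floor_pos.2 (by linarith)).ne'
  set L := Nat.log 2 W + 1 with hL
  have hWL : W < 2 ^ L := Nat.lt_pow_succ_log_self one_lt_two W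
  have hLQ : (L : ℝ) ≤ Q * T ^ η' := by
    have e1 : (2 : ℝ) ^ L ≤ 4 * T := by
      have : 2 ^ Nat.log 2 W ≤ W := Nat.pow_log_le_self 2 hW0
      have e2 : (2 : ℝ) ^ Nat.log 2 W ≤ W := by exact_mod_cast this
      have e3 : (W : ℝ) ≤ 2 * T := Nat.floor_le (by positivity)
      rw [hL, pow_succ]
      linarith
    have e2 : L * Real.log 2 ≤ Real.log (4 * T) := by
      rw [← Real.log_pow]; exact Real.log_le_log (by positivity) e1
    have e3 := Real.log_le_rpow_div (show 0 ≤ 4 * T by positivity) hη0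
    have e4 := Real.log_two_gt_d9
    have e5 : (0 : ℝ) ≤ L := Nat.cast_nonneg L
    calc (L : ℝ) ≤ 2 * (L * Real.log 2) := by nlinarith
      _ ≤ 2 * ((4 * T) ^ η' / η') := by linarith
      _ = _ := by rw [mul_rpow (by norm_num) hT0.le]; ring
  have ext : ∑ x ∈ Icc 1 W, ∑ y ∈ Icc 1 W, ∑ z ∈ Icc 1 W, trm c δ T (x * y * z) =
      ∑ x ∈ Ico 1 (2 ^ L), ∑ y ∈ Ico 1 (2 ^ L), ∑ z ∈ Ico 1 (2 ^ L), trm c δ T (x * y * z) := by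
    have hsub : Icc 1 W ⊆ Ico 1 (2 ^ L) := fun x hx => by
      rw [mem_Icc] at hx; exact mem_Ico.2 ⟨hx.1, hx.2.trans_lt hWL⟩
    simp_rw [← sum_product']
    refine sum_subset (product_subset_product hsub (product_subset_product hsub hsub)) ?_
    rintro ⟨x, y, z⟩ hp hp'
    simp only [mem_product, mem_Ico, mem_Icc] at hp hp' ⊢
    rw [trm, if_neg]
    rintro ⟨-, h2⟩
    have h3 : x * y * z ≤ W := Nat.le_floor h2
    have hxy : 1 ≤ x * y := Nat.mul_pos hp.1.1 hp.2.1.1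
    have hz : z ≤ W := (Nat.le_mul_of_pos_left z hxy).trans h3
    have hxy' : x * y ≤ W := (Nat.le_mul_of_pos_right _ hp.2.2.1).trans h3
    have hx : x ≤ W := (Nat.le_mul_of_pos_right _ hp.2.1.1).trans hxy'
    have hy : y ≤ W := (Nat.le_mul_of_pos_left _ hp.1.1).trans hxy'
    exact hp' ⟨⟨hp.1.1, hx⟩, ⟨hp.2.1.1, hy⟩, hp.2.2.1, hz⟩
  have split : ∑ x ∈ Ico 1 (2 ^ L), ∑ y ∈ Ico 1 (2 ^ L), ∑ z ∈ Ico 1 (2 ^ L),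
      trm c δ T (x * y * z) = ∑ i ∈ range L, ∑ j ∈ range L, ∑ k ∈ range L,
        ∑ x ∈ Ico (2 ^ i) (2 * 2 ^ i), ∑ y ∈ Ico (2 ^ j) (2 * 2 ^ j),
          ∑ z ∈ Ico (2 ^ k) (2 * 2 ^ k), trm c δ T (x * y * z) := by
    simp_rw [sum_Ico_one_two_pow _ L]
    refine sum_congr rfl fun i _ => ?_
    rw [sum_comm]
    refine sum_congr rfl fun j _ => ?_
    simp_rw [sum_comm (t := range L)]
  rw [ext, split]
  have hsum : ∀ (f : ℕ → ℂ) (B : ℝ), (∀ i, ‖f i‖ ≤ B) → ‖∑ i ∈ range L, f i‖ ≤ L * B := by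
    intro f B hf
    refine (norm_sum_le_of_le _ fun i _ => hf i).trans (le_of_eq ?_)
    rw [sum_const, card_range, nsmul_eq_mul]
  refine (hsum _ _ fun i => hsum _ _ fun j => hsum _ _ fun k => hB i j k).trans ?_
  calc (L : ℝ) * (L * (L * (C * T ^ η' * T ^ (2 / 3 + δ / 4)))) =
      (L : ℝ) ^ 3 * (C * T ^ η' * T ^ (2 / 3 + δ / 4)) := by ring
    _ ≤ (Q * T ^ η') ^ 3 * (C * T ^ η' * T ^ (2 / 3 + δ / 4)) := by gcongr
    _ = Q ^ 3 * C * (T ^ η' * T ^ η' * T ^ η' * T ^ η' * T ^ (2 / 3 + δ / 4)) := by ring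
    _ = _ := by
      rw [← rpow_add hT0, ← rpow_add hT0, ← rpow_add hT0, ← rpow_add hT0, hη']
      ring_nf

lemma full_sum_bound_of_ne_zero {δ c η : ℝ} (h0 : 2 / 3 ≤ δ) (h1 : δ < 1) (hc : c ≠ 0)
    (hη : 0 < η) : ∃ C, 0 < C ∧ ∀ᶠ T : ℝ in atTop,
      ‖∑ x ∈ Icc 1 ⌊2 * T⌋₊, ∑ y ∈ Icc 1 ⌊2 * T⌋₊, ∑ z ∈ Icc 1 ⌊2 * T⌋₊,
        trm c δ T (x * y * z)‖ ≤ C * T ^ (2 / 3 + δ / 4 + η) := by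
  rcases hc.lt_or_gt with h | h
  · obtain ⟨C, hC, hB⟩ := full_sum_bound h0 h1 (neg_pos.2 h) hη
    refine ⟨C, hC, hB.mono fun T hT => ?_⟩
    simpa only [trm_neg, ← map_sum, RCLike.norm_conj] using hT
  · exact full_sum_bound h0 h1 h hη

end ExpSum

theorem stmt19 (α ε c : ℝ) (hα₁ : 0 ≤ α) (hα₂ : α < 1/2) (hε : 0 < ε) (hc : c ≠ 0) :
    (fun T₁ : ℝ =>
        ∑ p ∈ (Finset.Icc 1 ⌊2 * T₁⌋₊ ×ˢ Finset.Icc 1 ⌊2 * T₁⌋₊ ×ˢ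
              Finset.Icc 1 ⌊2 * T₁⌋₊).filter
            (fun p : ℕ × ℕ × ℕ =>
              T₁ ≤ (p.1 * p.2.1 * p.2.2 : ℝ) ∧ (p.1 * p.2.1 * p.2.2 : ℝ) ≤ 2 * T₁),
          Complex.exp (2 * π * I *
            ((c * ((p.1 * p.2.1 * p.2.2 : ℕ) : ℝ) ^ (1 / ((3:ℝ)/2 - α)) : ℝ) : ℂ)))
      =O[atTop] fun T₁ : ℝ => T₁ ^ ((2:ℝ)/3 + (1 / ((3:ℝ)/2 - α)) / 4 + ε) := by
  have hpos : (0 : ℝ) < 3 / 2 - α := by linarith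
  have h0 : (2 : ℝ) / 3 ≤ 1 / (3 / 2 - α) := by rw [le_div_iff₀ hpos]; linarith
  have h1 : 1 / ((3 : ℝ) / 2 - α) < 1 := by rw [div_lt_one hpos]; linarith
  obtain ⟨C, -, hB⟩ := ExpSum.full_sum_bound_of_ne_zero h0 h1 hc hε
  refine Asymptotics.IsBigO.of_bound C ?_
  filter_upwards [hB, eventually_gt_atTop 0] with T hB hT
  rw [Real.norm_of_nonneg (rpow_nonneg hT.le _)]
  refine le_of_eq_of_le (congrArg _ ?_) hB
  rw [sum_filter]
  simp_rw [← sum_product']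
  refine sum_congr rfl fun p _ => ?_
  rw [ExpSum.trm]
  push_cast
  refine if_congr Iff.rfl ?_ rfl
  rw [ExpSum.e]
  push_cast
  ring_nf
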